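/- Let f be a profile function and let Λ : ℕ → ℝ be the strictly increasing enumeration of E(f) = ⋃_{k ≥ 0} Spec L_k. Then the following are equivalent: (i) for every m ∈ ℕ, 2·card{k : ℕ | k ≥ 1 and Λ(m) ∈ Spec L_k} + (1 if Λ(m) ∈ Spec L_0, else 0) = 2m + 1; (ii) f(x) = 1 - x² for all x ∈ [-1,1]. (That is, the multiplicity of the m-th distinct eigenvalue equals 2m+1 for all m if and only if the surface is isometric to the round sphere of constant curvature 1.) -/

import Mathlib

open Set MeasureTheory intervalIntegral Filter
open scoped Classical

/-- A profile function for a surface of revolution diffeomorphic to `S²` of area `4π`: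
continuous on `[-1,1]`, smooth and positive on `(-1,1)`, vanishing at `±1`,
with derivative `2` at `-1` and `-2` at `1`. -/
structure IsProfile (f : ℝ → ℝ) : Prop where
  contOn : ContinuousOn f (Icc (-1) 1)
  smoothOn : ContDiffOn ℝ (⊤ : ℕ∞) f (Ioo (-1) 1)
  pos : ∀ x ∈ Ioo (-1:ℝ) 1, 0 < f x
  zero_neg_one : f (-1) = 0
  zero_one : f 1 = 0
  deriv_neg_one : HasDerivAt f 2 (-1)
  deriv_one : HasDerivAt f (-2) 1

/-- `λ` is an eigenvalue of the Sturm–Liouville operator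
`L_k = -(d/dx)(f(x) d/dx) + k²/f(x)` on `(-1,1)`, with Dirichlet boundary
conditions at `±1` when `k ≥ 1`. -/
def InSpec (f : ℝ → ℝ) (k : ℕ) (lam : ℝ) : Prop :=
  ∃ u : ℝ → ℝ, ContinuousOn u (Icc (-1) 1) ∧ ContDiffOn ℝ (⊤ : ℕ∞) u (Ioo (-1) 1) ∧
    (∃ x ∈ Ioo (-1:ℝ) 1, u x ≠ 0) ∧
    (1 ≤ k → u (-1) = 0 ∧ u 1 = 0) ∧
    ∀ x ∈ Ioo (-1:ℝ) 1,
      -(deriv (fun y => f y * deriv u y) x) + ((k:ℝ)^2 / f x) * u x = lam * u x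

/-- The spectrum of `L_k`. -/
def Spec (f : ℝ → ℝ) (k : ℕ) : Set ℝ := {lam | InSpec f k lam}

/-- The set of distinct eigenvalues of the Laplacian of the surface of
revolution determined by `f`. -/
def Eigs (f : ℝ → ℝ) : Set ℝ := ⋃ k : ℕ, Spec f k

section HilbertSchmidt

variable {E F : Type*} [NormedAddCommGroup E] [InnerProductSpace ℝ E] [NormedAddCommGroup F]
  [InnerProductSpace ℝ F] [CompleteSpace F]

/-- A Hilbert–Schmidt operator is compact. -/
theorem isCompactOperator_of_summable_norm_sq {ι : Type*} (b : HilbertBasis ι ℝ E)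
    (T : E →L[ℝ] F) (h : Summable fun i => ‖T (b i)‖ ^ 2) : IsCompactOperator T := by
  let P : Finset ι → E →L[ℝ] F := fun s =>
    ∑ i ∈ s, (innerSL ℝ (b i)).smulRight (T (b i))
  have hP : ∀ s, IsCompactOperator (P s) := by
    intro s
    have : IsCompactOperator (∑ i ∈ s, (⇑((innerSL ℝ (b i)).smulRight (T (b i))))) := by
      refine Finset.sum_induction _ (fun g : E → F => IsCompactOperator g)
        (fun _ _ => IsCompactOperator.add) isCompactOperator_zero ?_
      intro i _
      have h1 : IsCompactOperator (⇑((ContinuousLinearMap.id ℝ ℝ).smulRight (T (b i))) ∘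
          ⇑(innerSL ℝ (b i))) :=
        (IsCompactOperator.clm_comp (f := (innerSL ℝ (b i) : E → ℝ))
          (by
            refine ⟨_, ProperSpace.isCompact_closedBall (0:ℝ) 1, ?_⟩
            exact (innerSL ℝ (b i)).continuous.continuousAt.preimage_mem_nhds
              (by simpa using Metric.closedBall_mem_nhds (0:ℝ) one_pos)) _)
      exact h1
    convert this using 1
    ext x
    simp [P]
  refine isCompactOperator_of_tendsto (l := atTop) (F := P) ?_ (Eventually.of_forall hP)
  rw [Metric.tendsto_atTop]
  intro ε hε
  have hε2 : 0 < (ε / 2) ^ 2 := by positivity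
  obtain ⟨s, hs⟩ := (summable_iff_vanishing_norm.1 h) _ hε2
  refine ⟨s, fun t hst => ?_⟩
  rw [dist_eq_norm]
  refine lt_of_le_of_lt (ContinuousLinearMap.opNorm_le_bound _ (by positivity : 0 ≤ ε / 2) ?_)
    (half_lt_self hε)
  intro x
  have hx : HasSum (fun i => inner ℝ (b i) x • T (b i)) (T x) := by
    have := (b.hasSum_repr x).mapL T
    simpa [b.repr_apply_apply] using this
  have hlim : Tendsto (fun u : Finset ι => ‖(P t - ∑ i ∈ u, (innerSL ℝ (b i)).smulRight (T (b i))) x‖)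
      atTop (nhds ‖(P t - T) x‖) := by
    refine Tendsto.norm ?_
    simp only [sub_apply]
    refine tendsto_const_nhds.sub ?_
    simpa [sum_apply, HasSum] using hx
  refine le_of_tendsto hlim ?_
  filter_upwards [eventually_ge_atTop t] with u hu
  have e1 : (P t - ∑ i ∈ u, (innerSL ℝ (b i)).smulRight (T (b i))) x =
      - ∑ i ∈ u \ t, inner ℝ (b i) x • T (b i) := by
    simp only [P, sub_apply, sum_apply,
      ContinuousLinearMap.smulRight_apply, innerSL_apply_apply]
    rw [← Finset.sum_sdiff hu]; abel
  rw [e1, norm_neg]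
  have b1 : ∑ i ∈ u \ t, |inner ℝ (b i) x| ^ 2 ≤ ‖x‖ ^ 2 := by
    have := b.orthonormal.sum_inner_products_le x (s := u \ t)
    simpa using this
  have b2 : ∑ i ∈ u \ t, ‖T (b i)‖ ^ 2 ≤ (ε / 2) ^ 2 := by
    have := hs (u \ t) (Finset.disjoint_left.2 fun i hi hi' =>
      (Finset.mem_sdiff.1 hi).2 (hst hi'))
    exact (le_abs_self _).trans this.le
  calc ‖∑ i ∈ u \ t, inner ℝ (b i) x • T (b i)‖
      ≤ ∑ i ∈ u \ t, |inner ℝ (b i) x| * ‖T (b i)‖ := by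
        refine (norm_sum_le _ _).trans (le_of_eq ?_)
        simp [norm_smul]
    _ ≤ √(∑ i ∈ u \ t, |inner ℝ (b i) x| ^ 2) * √(∑ i ∈ u \ t, ‖T (b i)‖ ^ 2) :=
        Real.sum_mul_le_sqrt_mul_sqrt _ _ _
    _ ≤ ‖x‖ * (ε / 2) := by
        gcongr
        · exact Real.sqrt_le_iff.2 ⟨norm_nonneg _, b1⟩
        · exact Real.sqrt_le_iff.2 ⟨by positivity, b2⟩
    _ = _ := mul_comm _ _

/-- If the quadratic form of a nonzero compact symmetric operator is dominated by its positive
values, then the norm of the operator is an eigenvalue. -/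
theorem hasEigenvalue_norm_of_dominated [CompleteSpace E] {T : E →L[ℝ] E} (hT : IsCompactOperator T)
    (hsymm : T.IsSymmetric) (hT0 : T ≠ 0)
    (hdom : ∀ x, ∃ y, ‖y‖ = ‖x‖ ∧ |inner ℝ (T x) x| ≤ inner ℝ (T y) y) :
    Module.End.HasEigenvalue (T : Module.End ℝ E) ‖T‖ := by
  have hn : ‖T‖ ≠ 0 := norm_ne_zero_iff.2 hT0
  have : Nontrivial E := by
    by_contra hE
    rw [not_nontrivial_iff_subsingleton] at hE
    exact hT0 (by ext x; simp [Subsingleton.elim x 0])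
  rw [hT.hasEigenvalue_iff_mem_spectrum hn]
  by_contra hspec
  have hres : algebraMap ℝ ℝ ‖T‖ ∈ resolventSet ℝ T := by
    simpa [spectrum] using hspec
  obtain ⟨ε, hε, hbound⟩ := T.rayleighQuotient_le_of_norm_mem_resolventSet hres
  have : ‖T‖ ≤ ‖T‖ - ε := by
    conv_lhs => rw [T.norm_eq_iSup_rayleighQuotient hsymm]
    refine ciSup_le fun x => ?_
    obtain ⟨y, hy, hxy⟩ := hdom x
    refine le_trans ?_ (hbound y)
    simp only [ContinuousLinearMap.rayleighQuotient, ContinuousLinearMap.reApplyInnerSelf_apply,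
      RCLike.re_to_real, abs_div, abs_sq, hy]
    gcongr
  linarith

end HilbertSchmidt

section KernelOperator

variable {α : Type*} [MeasurableSpace α] {μ : Measure α}

/-- A bounded measurable kernel on `α × α`. -/
structure IsBddKernel (G : α → α → ℝ) (C : ℝ) : Prop where
  measurable : Measurable (Function.uncurry G)
  bound : ∀ x y, |G x y| ≤ C

theorem IsBddKernel.memLp [IsFiniteMeasure μ] {G : α → α → ℝ} {C : ℝ} (hG : IsBddKernel G C)
    (x : α) : MemLp (G x) 2 μ :=
  MemLp.of_bound (hG.measurable.comp measurable_prodMk_left).aestronglyMeasurable C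
    (Eventually.of_forall fun y => by simpa using hG.bound x y)

theorem IsBddKernel.abs_integral_le [IsFiniteMeasure μ] {G : α → α → ℝ} {C : ℝ}
    (hG : IsBddKernel G C) {g : α → ℝ} (hg : Integrable g μ) (x : α) :
    |∫ y, G x y * g y ∂μ| ≤ C * ∫ y, |g y| ∂μ := by
  rw [← Real.norm_eq_abs, ← MeasureTheory.integral_const_mul]
  refine norm_integral_le_of_norm_le (hg.abs.const_mul C) (Eventually.of_forall fun y => ?_)
  rw [norm_mul, Real.norm_eq_abs, Real.norm_eq_abs]
  exact mul_le_mul_of_nonneg_right (hG.bound x y) (abs_nonneg _)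

theorem IsBddKernel.integrable_mul [IsFiniteMeasure μ] {G : α → α → ℝ} {C : ℝ}
    (hG : IsBddKernel G C) {g : α → ℝ} (hg : Integrable g μ) (x : α) :
    Integrable (fun y => G x y * g y) μ :=
  hg.bdd_mul (hG.measurable.comp measurable_prodMk_left).aestronglyMeasurable
    (c := C) (Eventually.of_forall fun y => by simpa using hG.bound x y)

theorem IsBddKernel.aestronglyMeasurable_integral [IsFiniteMeasure μ] {G : α → α → ℝ} {C : ℝ}
    (hG : IsBddKernel G C) {g : α → ℝ} (hg : AEStronglyMeasurable g μ) :
    AEStronglyMeasurable (fun x => ∫ y, G x y * g y ∂μ) μ := by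
  refine AEStronglyMeasurable.integral_prod_right' (f := fun z : α × α => G z.1 z.2 * g z.2) ?_
  exact hG.measurable.aestronglyMeasurable.mul hg.comp_snd

theorem IsBddKernel.nonneg [Nonempty α] {G : α → α → ℝ} {C : ℝ} (hG : IsBddKernel G C) : 0 ≤ C :=
  let x := Classical.arbitrary α
  (abs_nonneg _).trans (hG.bound x x)

theorem Lp.integrable_of_two [IsFiniteMeasure μ] (g : Lp ℝ 2 μ) : Integrable g μ :=
  (Lp.memLp g).integrable (by norm_num)

theorem IsBddKernel.memLp_integral [IsFiniteMeasure μ] {G : α → α → ℝ} {C : ℝ}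
    (hG : IsBddKernel G C) {g : α → ℝ} (hg : Integrable g μ) :
    MemLp (fun x => ∫ y, G x y * g y ∂μ) 2 μ :=
  MemLp.of_bound (hG.aestronglyMeasurable_integral hg.aestronglyMeasurable) _
    (Eventually.of_forall fun x => hG.abs_integral_le hg x)

theorem Lp.real_inner_eq (g h : Lp ℝ 2 μ) : inner ℝ g h = ∫ x, g x * h x ∂μ := by
  rw [L2.inner_def]
  simp [mul_comm]

theorem Lp.real_inner_toLp {g h : α → ℝ} (hg : MemLp g 2 μ) (hh : MemLp h 2 μ) :
    inner ℝ (hg.toLp g) (hh.toLp h) = ∫ x, g x * h x ∂μ := by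
  rw [Lp.real_inner_eq]
  refine integral_congr_ae ?_
  filter_upwards [hg.coeFn_toLp, hh.coeFn_toLp] with x h1 h2
  rw [h1, h2]

theorem integral_abs_le_sqrt_mul_norm [IsFiniteMeasure μ] (g : Lp ℝ 2 μ) :
    ∫ y, |g y| ∂μ ≤ √(μ.real univ) * ‖g‖ := by
  have h1 : MemLp (fun _ : α => (1:ℝ)) 2 μ := memLp_const 1
  have h2 : MemLp (fun y => |g y|) 2 μ := (Lp.memLp g).abs
  have key := real_inner_le_norm (h1.toLp _) (h2.toLp _)
  rw [Lp.real_inner_toLp] at key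
  have e1 : ‖h1.toLp _‖ = √(μ.real univ) := by
    rw [norm_eq_sqrt_real_inner, Lp.real_inner_toLp]; simp
  have e2 : ‖h2.toLp _‖ = ‖g‖ := by
    rw [norm_eq_sqrt_real_inner, norm_eq_sqrt_real_inner, Lp.real_inner_toLp, Lp.real_inner_eq]
    simp
  rw [e1, e2] at key
  simpa using key

/-- The integral operator on `L²` with a given bounded kernel. -/
noncomputable def kernelOp (μ : Measure α) [IsFiniteMeasure μ] {G : α → α → ℝ} {C : ℝ}
    (hG : IsBddKernel G C) : Lp ℝ 2 μ →L[ℝ] Lp ℝ 2 μ :=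
  LinearMap.mkContinuous
    { toFun := fun g => (hG.memLp_integral (Lp.integrable_of_two g)).toLp _
      map_add' := fun g h => by
        rw [← MemLp.toLp_add]
        refine MemLp.toLp_congr _ _ (Eventually.of_forall fun x => ?_)
        simp only [Pi.add_apply]
        rw [← integral_add (hG.integrable_mul (Lp.integrable_of_two g) x)
          (hG.integrable_mul (Lp.integrable_of_two h) x)]
        refine integral_congr_ae ?_
        filter_upwards [Lp.coeFn_add g h] with y hy
        rw [hy, Pi.add_apply, mul_add]
      map_smul' := fun c g => by
        rw [RingHom.id_apply, ← MemLp.toLp_const_smul]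
        refine MemLp.toLp_congr _ _ (Eventually.of_forall fun x => ?_)
        simp only [Pi.smul_apply, smul_eq_mul]
        rw [← MeasureTheory.integral_const_mul]
        refine integral_congr_ae ?_
        filter_upwards [Lp.coeFn_smul c g] with y hy
        rw [hy, Pi.smul_apply, smul_eq_mul]; ring }
    (√(μ.real univ) * (C * √(μ.real univ))) fun g => by
      rcases isEmpty_or_nonempty α with hα | hα
      · have : g = 0 := Lp.ext (Eventually.of_forall fun x => isEmptyElim x)
        simp [this]
      have hC := hG.nonneg
      set h := hG.memLp_integral (Lp.integrable_of_two g)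
      change ‖h.toLp _‖ ≤ _
      rw [norm_eq_sqrt_real_inner, Lp.real_inner_toLp]
      refine Real.sqrt_le_iff.2 ⟨by positivity, ?_⟩
      have b : ∀ x, (∫ y, G x y * g y ∂μ) * (∫ y, G x y * g y ∂μ) ≤
          (C * (√(μ.real univ) * ‖g‖)) ^ 2 := fun x => by
        rw [← pow_two]
        refine sq_le_sq' ?_ ?_
        · exact (abs_le.1 ((hG.abs_integral_le (Lp.integrable_of_two g) x).trans
            (by gcongr; exact integral_abs_le_sqrt_mul_norm g))).1
        · exact (abs_le.1 ((hG.abs_integral_le (Lp.integrable_of_two g) x).trans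
            (by gcongr; exact integral_abs_le_sqrt_mul_norm g))).2
      refine (integral_mono (h.integrable_mul h) (integrable_const _) b).trans (le_of_eq ?_)
      rw [MeasureTheory.integral_const, smul_eq_mul, mul_pow, mul_pow, mul_pow, mul_pow, mul_pow,
        Real.sq_sqrt (by positivity)]
      ring

variable [IsFiniteMeasure μ] {G : α → α → ℝ} {C : ℝ}

theorem kernelOp_apply (hG : IsBddKernel G C) (g : Lp ℝ 2 μ) :
    kernelOp μ hG g = (hG.memLp_integral (Lp.integrable_of_two g)).toLp _ := rfl

theorem kernelOp_coeFn (hG : IsBddKernel G C) (g : Lp ℝ 2 μ) :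
    kernelOp μ hG g =ᵐ[μ] fun x => ∫ y, G x y * g y ∂μ := by
  rw [kernelOp_apply]; exact MemLp.coeFn_toLp _

theorem inner_kernelOp (hG : IsBddKernel G C) (g h : Lp ℝ 2 μ) :
    inner ℝ (kernelOp μ hG g) h = ∫ x, (∫ y, G x y * g y ∂μ) * h x ∂μ := by
  rw [Lp.real_inner_eq]
  refine integral_congr_ae ?_
  filter_upwards [kernelOp_coeFn hG g] with x h1
  rw [h1]

theorem inner_kernelOp_toLp (hG : IsBddKernel G C) {g h : α → ℝ} (hg : MemLp g 2 μ)
    (hh : MemLp h 2 μ) :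
    inner ℝ (kernelOp μ hG (hg.toLp g)) (hh.toLp h) =
      ∫ x, (∫ y, G x y * g y ∂μ) * h x ∂μ := by
  rw [inner_kernelOp]
  refine integral_congr_ae ?_
  filter_upwards [hh.coeFn_toLp] with x h2
  rw [h2]
  congr 1
  refine integral_congr_ae ?_
  filter_upwards [hg.coeFn_toLp] with y h3
  rw [h3]

theorem isSymmetric_kernelOp (hG : IsBddKernel G C) (hsymm : ∀ x y, G x y = G y x) :
    (kernelOp μ hG).IsSymmetric := by
  intro g h
  refine Eq.trans ?_ (real_inner_comm _ _)
  change inner ℝ (kernelOp μ hG _) _ = inner ℝ (kernelOp μ hG _) _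
  rw [inner_kernelOp, inner_kernelOp]
  have hint : Integrable (fun z : α × α => G z.1 z.2 * (h z.1 * g z.2)) (μ.prod μ) :=
    ((Lp.integrable_of_two h).mul_prod (Lp.integrable_of_two g)).bdd_mul
      hG.measurable.aestronglyMeasurable (c := C)
      (Eventually.of_forall fun z => by simpa using hG.bound z.1 z.2)
  have := integral_integral_swap (f := fun x y => G x y * (h x * g y)) hint
  calc ∫ x, (∫ y, G x y * g y ∂μ) * h x ∂μ = ∫ x, ∫ y, G x y * (h x * g y) ∂μ ∂μ := by
        refine integral_congr_ae (Eventually.of_forall fun x => ?_)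
        simp only
        rw [← MeasureTheory.integral_mul_const]
        refine integral_congr_ae (Eventually.of_forall fun y => ?_)
        simp only; ring
    _ = ∫ y, ∫ x, G x y * (h x * g y) ∂μ ∂μ := this
    _ = _ := by
        refine integral_congr_ae (Eventually.of_forall fun x => ?_)
        simp only
        rw [← MeasureTheory.integral_mul_const]
        refine integral_congr_ae (Eventually.of_forall fun y => ?_)
        simp only; rw [hsymm y x]; ring

theorem isCompactOperator_kernelOp (hG : IsBddKernel G C) :
    IsCompactOperator (kernelOp μ hG) := by
  obtain ⟨w, b, -⟩ := exists_hilbertBasis ℝ (Lp ℝ 2 μ)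
  refine isCompactOperator_of_summable_norm_sq b _ ?_
  refine summable_of_sum_le (c := ∫ _ : α, C ^ 2 * μ.real univ ∂μ) (fun i => by positivity) fun s => ?_
  have hnorm : ∀ i, ‖kernelOp μ hG (b i)‖ ^ 2 =
      ∫ x, (inner ℝ (b i) ((hG.memLp (μ := μ) x).toLp _)) ^ 2 ∂μ := fun i => by
    rw [← real_inner_self_eq_norm_sq, Lp.real_inner_eq]
    refine integral_congr_ae ?_
    filter_upwards [kernelOp_coeFn hG (b i)] with x hx
    rw [hx, ← pow_two]
    congr 1
    rw [Lp.real_inner_eq]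
    refine integral_congr_ae ?_
    filter_upwards [(hG.memLp (μ := μ) x).coeFn_toLp] with y hy
    rw [hy, mul_comm]
  have hmem : ∀ i, Integrable (fun x => (inner ℝ (b i) ((hG.memLp (μ := μ) x).toLp _)) ^ 2) μ := by
    intro i
    have h := hG.memLp_integral (Lp.integrable_of_two (b i))
    refine (h.integrable_sq).congr (Eventually.of_forall fun x => ?_)
    simp only
    congr 1
    rw [Lp.real_inner_eq]
    refine integral_congr_ae ?_
    filter_upwards [(hG.memLp (μ := μ) x).coeFn_toLp] with y hy
    rw [hy, mul_comm]
  simp_rw [hnorm]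
  rw [← integral_finsetSum _ fun i _ => hmem i]
  refine integral_mono (integrable_finsetSum _ fun i _ => hmem i) (integrable_const _) fun x => ?_
  have h1 := b.orthonormal.sum_inner_products_le ((hG.memLp (μ := μ) x).toLp _) (s := s)
  simp only [Real.norm_eq_abs, sq_abs] at h1
  refine h1.trans ?_
  rw [← real_inner_self_eq_norm_sq, Lp.real_inner_toLp]
  refine (integral_mono ((hG.memLp x).integrable_mul (hG.memLp x)) (integrable_const (C ^ 2))
    fun y => ?_).trans (le_of_eq (by simp [mul_comm]))
  have := hG.bound x y
  change G x y * G x y ≤ C ^ 2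
  rw [← pow_two, ← sq_abs]
  gcongr

/-- A strictly positive symmetric kernel has a top eigenvalue, which bounds the quadratic form. -/
theorem exists_top_eigenvalue (hG : IsBddKernel G C) (hsymm : ∀ x y, G x y = G y x)
    (hnonneg : ∀ x y, 0 ≤ G x y) (hpos : ∀ᵐ x ∂μ, ∀ᵐ y ∂μ, 0 < G x y) (hμ : μ ≠ 0) :
    ∃ κ : ℝ, 0 < κ ∧ (∃ e : Lp ℝ 2 μ, e ≠ 0 ∧ kernelOp μ hG e = κ • e) ∧
      ∀ g : Lp ℝ 2 μ, inner ℝ (kernelOp μ hG g) g ≤ κ * ‖g‖ ^ 2 := by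
  have hK0 : kernelOp μ hG ≠ 0 := by
    intro h0
    have h1 : MemLp (fun _ : α => (1:ℝ)) 2 μ := memLp_const 1
    have h2 := kernelOp_coeFn hG (h1.toLp _)
    rw [h0] at h2
    have : ∀ᵐ x ∂μ, False := by
      filter_upwards [h2, hpos, Lp.coeFn_zero ℝ 2 μ] with x hx hxp hz
      have e : ∫ y, G x y * (h1.toLp _) y ∂μ = ∫ y, G x y ∂μ := by
        refine integral_congr_ae ?_
        filter_upwards [h1.coeFn_toLp] with y hy
        rw [hy, mul_one]
      simp only [zero_apply] at hx
      rw [hz, e] at hx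
      have h3 : 0 < ∫ y, G x y ∂μ := by
        rw [integral_pos_iff_support_of_nonneg (fun y => hnonneg x y)
          ((hG.memLp x).integrable (by norm_num))]
        have : Function.support (G x) =ᵐ[μ] univ := by
          filter_upwards [hxp] with y hy
          simp only [eq_iff_iff]
          exact iff_of_true hy.ne' trivial
        rw [measure_congr this]
        simpa [pos_iff_ne_zero] using hμ
      simp only [Pi.zero_apply] at hx
      exact h3.ne hx
    exact hμ (by simpa using this)
  have hev := hasEigenvalue_norm_of_dominated (isCompactOperator_kernelOp (μ := μ) hG)
    (isSymmetric_kernelOp hG hsymm) hK0 fun g => by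
      have hab : MemLp (fun y => |g y|) 2 μ := (Lp.memLp g).abs
      refine ⟨hab.toLp _, ?_, ?_⟩
      · rw [norm_eq_sqrt_real_inner, norm_eq_sqrt_real_inner, Lp.real_inner_toLp, Lp.real_inner_eq]
        simp
      · rw [inner_kernelOp, inner_kernelOp_toLp, ← Real.norm_eq_abs]
        refine norm_integral_le_of_norm_le
          ((hG.memLp_integral (hab.integrable (by norm_num))).integrable_mul hab)
          (Eventually.of_forall fun x => ?_)
        rw [norm_mul, Real.norm_eq_abs, Real.norm_eq_abs]
        refine mul_le_mul_of_nonneg_right ?_ (abs_nonneg _)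
        rw [← Real.norm_eq_abs]
        refine norm_integral_le_of_norm_le (hG.integrable_mul (hab.integrable (by norm_num)) x)
          (Eventually.of_forall fun y => ?_)
        rw [norm_mul, Real.norm_eq_abs, Real.norm_eq_abs, abs_of_nonneg (hnonneg x y)]
  obtain ⟨e, he⟩ := hev.exists_hasEigenvector
  refine ⟨‖kernelOp μ hG‖, norm_pos_iff.2 hK0, ⟨e, he.2, he.apply_eq_smul⟩, fun g => ?_⟩
  calc _ ≤ ‖kernelOp μ hG g‖ * ‖g‖ := real_inner_le_norm _ _
    _ ≤ (‖kernelOp μ hG‖ * ‖g‖) * ‖g‖ := by gcongr; exact ContinuousLinearMap.le_opNorm _ _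
    _ = _ := by ring

end KernelOperator

theorem IsProfile.exists_factor {f : ℝ → ℝ} (hf : IsProfile f) :
    ∃ q : ℝ → ℝ, ContinuousOn q (Icc (-1) 1) ∧ (∀ x ∈ Icc (-1:ℝ) 1, 0 < q x) ∧
      ∀ x, f x = (1 - x ^ 2) * q x := by
  set d := dslope f 1 with hd
  have hd_eq : ∀ x, f x = (x - 1) * d x := fun x => by
    have := sub_smul_dslope f 1 x
    rw [hf.zero_one, sub_zero, smul_eq_mul] at this
    exact this.symm
  have hd1 : d 1 = -2 := by rw [hd, dslope_same]; exact hf.deriv_one.deriv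
  have hdm : d (-1) = 0 := by
    have := hd_eq (-1)
    rw [hf.zero_neg_one] at this
    linarith
  have hd_cont : ContinuousOn d (Icc (-1) 1) := by
    intro x hx
    by_cases h : x = 1
    · subst h
      exact (continuousAt_dslope_same.2 hf.deriv_one.differentiableAt).continuousWithinAt
    · exact (continuousWithinAt_dslope_of_ne h).2 (hf.contOn x hx)
  have hd_deriv : HasDerivAt d (-1) (-1) := by
    have h1 : HasDerivAt (fun x => f x / (x - 1)) (-1) (-1) := by
      have := hf.deriv_neg_one.div ((hasDerivAt_id (-1:ℝ)).sub_const 1) (by norm_num)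
      refine this.congr_deriv ?_
      rw [hf.zero_neg_one]
      norm_num
    refine h1.congr_of_eventuallyEq ?_
    filter_upwards [eventually_ne_nhds (show (-1:ℝ) ≠ 1 by norm_num)] with x hx
    rw [hd_eq x]
    field_simp [sub_ne_zero.2 hx]
  set e := dslope d (-1) with he
  have he_eq : ∀ x, d x = (x + 1) * e x := fun x => by
    have := sub_smul_dslope d (-1) x
    rw [hdm, sub_zero, smul_eq_mul] at this
    rw [← this]; ring
  have he_cont : ContinuousOn e (Icc (-1) 1) := by
    intro x hx
    by_cases h : x = -1
    · subst h
      exact (continuousAt_dslope_same.2 hd_deriv.differentiableAt).continuousWithinAt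
    · exact (continuousWithinAt_dslope_of_ne h).2 (hd_cont x hx)
  have hfe : ∀ x, f x = (1 - x ^ 2) * (-e x) := fun x => by rw [hd_eq, he_eq]; ring
  refine ⟨fun x => -e x, he_cont.neg, fun x hx => ?_, hfe⟩
  rcases eq_or_lt_of_le hx.1 with h | h
  · have h1 : e (-1) = -1 := by rw [he, dslope_same, hd_deriv.deriv]
    rw [← h]
    simp [h1]
  rcases eq_or_lt_of_le hx.2 with h' | h'
  · have := he_eq 1
    rw [hd1] at this
    rw [h']; linarith
  · have h1 := hf.pos x ⟨h, h'⟩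
    rw [hfe] at h1
    exact pos_of_mul_pos_right h1 (by nlinarith)

theorem IsProfile.exists_bounds {f : ℝ → ℝ} (hf : IsProfile f) :
    ∃ c C : ℝ, 0 < c ∧ 0 < C ∧ ∀ x ∈ Icc (-1:ℝ) 1, c * (1 - x ^ 2) ≤ f x ∧ f x ≤ C * (1 - x ^ 2) := by
  obtain ⟨q, hq, hpos, hfq⟩ := hf.exists_factor
  have hne : (Icc (-1:ℝ) 1).Nonempty := ⟨0, by norm_num⟩
  obtain ⟨a, ha, hmin⟩ := isCompact_Icc.exists_isMinOn hne hq
  obtain ⟨b, hb, hmax⟩ := isCompact_Icc.exists_isMaxOn hne hq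
  refine ⟨q a, q b, hpos a ha, hpos b hb, fun x hx => ?_⟩
  have h1 : q a ≤ q x := hmin hx
  have h2 : q x ≤ q b := hmax hx
  have h3 : 0 ≤ 1 - x ^ 2 := by nlinarith [hx.1, hx.2]
  rw [hfq x]
  constructor <;> nlinarith

theorem IsProfile.ne_zero {f : ℝ → ℝ} (hf : IsProfile f) {x : ℝ} (hx : x ∈ Ioo (-1:ℝ) 1) :
    f x ≠ 0 := (hf.pos x hx).ne'

/-- The exponential `exp (∫₀ˣ dt / f t)` of the conformal coordinate on the surface of
revolution, extended by zero outside `(-1,1)`. -/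
noncomputable def expCoord (f : ℝ → ℝ) (x : ℝ) : ℝ :=
  (Ioo (-1:ℝ) 1).indicator (fun x => Real.exp (∫ t in (0:ℝ)..x, (f t)⁻¹)) x

theorem expCoord_of_mem {f : ℝ → ℝ} {x : ℝ} (hx : x ∈ Ioo (-1:ℝ) 1) :
    expCoord f x = Real.exp (∫ t in (0:ℝ)..x, (f t)⁻¹) := indicator_of_mem hx _

theorem expCoord_of_notMem {f : ℝ → ℝ} {x : ℝ} (hx : x ∉ Ioo (-1:ℝ) 1) :
    expCoord f x = 0 := indicator_of_notMem hx _

theorem expCoord_nonneg (f : ℝ → ℝ) (x : ℝ) : 0 ≤ expCoord f x :=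
  indicator_nonneg (fun _ _ => (Real.exp_pos _).le) x

theorem expCoord_pos {f : ℝ → ℝ} {x : ℝ} (hx : x ∈ Ioo (-1:ℝ) 1) : 0 < expCoord f x := by
  rw [expCoord_of_mem hx]; exact Real.exp_pos _

theorem expCoord_zero (f : ℝ → ℝ) : expCoord f 0 = 1 := by
  rw [expCoord_of_mem (by norm_num)]; simp

theorem IsProfile.hasDerivAt_expCoord {f : ℝ → ℝ} (hf : IsProfile f) {x : ℝ}
    (hx : x ∈ Ioo (-1:ℝ) 1) : HasDerivAt (expCoord f) (expCoord f x / f x) x := by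
  have hcont : ContinuousOn (fun t => (f t)⁻¹) (Ioo (-1) 1) :=
    hf.smoothOn.continuousOn.inv₀ fun t ht => hf.ne_zero ht
  have hsub : uIcc 0 x ⊆ Ioo (-1:ℝ) 1 := by
    have : OrdConnected (Ioo (-1:ℝ) 1) := ordConnected_Ioo
    exact this.uIcc_subset (by norm_num) hx
  have h1 : HasDerivAt (fun y => ∫ t in (0:ℝ)..y, (f t)⁻¹) (f x)⁻¹ x :=
    integral_hasDerivAt_right ((hcont.mono hsub).intervalIntegrable)
      (hcont.stronglyMeasurableAtFilter isOpen_Ioo x hx)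
      (hcont.continuousAt (isOpen_Ioo.mem_nhds hx))
  have h2 := h1.exp
  rw [← expCoord_of_mem hx, ← div_eq_mul_inv] at h2
  refine h2.congr_of_eventuallyEq ?_
  filter_upwards [isOpen_Ioo.mem_nhds hx] with y hy
  exact expCoord_of_mem hy

theorem IsProfile.continuousOn_expCoord {f : ℝ → ℝ} (hf : IsProfile f) :
    ContinuousOn (expCoord f) (Ioo (-1) 1) := fun _ hx =>
  (hf.hasDerivAt_expCoord hx).continuousAt.continuousWithinAt

theorem IsProfile.measurable_expCoord {f : ℝ → ℝ} (hf : IsProfile f) :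
    Measurable (expCoord f) := by
  have := ContinuousOn.measurable_piecewise (f := expCoord f) (g := fun _ => (0:ℝ))
    (s := Ioo (-1:ℝ) 1) hf.continuousOn_expCoord continuousOn_const measurableSet_Ioo
  convert this using 1
  ext x
  by_cases hx : x ∈ Ioo (-1:ℝ) 1
  · rw [piecewise_eq_of_mem _ _ _ hx]
  · rw [piecewise_eq_of_notMem _ _ _ hx, expCoord_of_notMem hx]

theorem IsProfile.strictMonoOn_expCoord {f : ℝ → ℝ} (hf : IsProfile f) :
    StrictMonoOn (expCoord f) (Ioo (-1) 1) := by
  refine strictMonoOn_of_deriv_pos (convex_Ioo _ _) hf.continuousOn_expCoord fun x hx => ?_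
  rw [interior_Ioo] at hx
  rw [(hf.hasDerivAt_expCoord hx).deriv]
  exact div_pos (expCoord_pos hx) (hf.pos x hx)

theorem IsProfile.exists_expCoord_bounds {f : ℝ → ℝ} (hf : IsProfile f) :
    ∃ a : ℝ, 0 < a ∧ (∀ x ∈ Icc (0:ℝ) 1, (expCoord f x)⁻¹ ≤ (1 - x) ^ a) ∧
      ∀ x ∈ Icc (-1:ℝ) 0, expCoord f x ≤ (1 + x) ^ a := by
  obtain ⟨c, C, hc, hC, hb⟩ := hf.exists_bounds
  refine ⟨(2 * C)⁻¹, by positivity, ?_, ?_⟩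
  · intro x hx
    rcases eq_or_lt_of_le hx.2 with h | h
    · subst h
      rw [expCoord_of_notMem (by simp), sub_self, Real.zero_rpow (by positivity), inv_zero]
    have hmono : MonotoneOn (fun x => expCoord f x * (1 - x) ^ (2 * C)⁻¹) (Ico 0 1) := by
      have hd : ∀ y ∈ Ico (0:ℝ) 1, HasDerivAt (fun x => expCoord f x * (1 - x) ^ (2 * C)⁻¹)
          (expCoord f y / f y * (1 - y) ^ (2 * C)⁻¹ +
            expCoord f y * (-1 * (2 * C)⁻¹ * (1 - y) ^ ((2 * C)⁻¹ - 1))) y := fun y hy =>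
        (hf.hasDerivAt_expCoord ⟨by linarith [hy.1], hy.2⟩).mul
          (((hasDerivAt_id y).const_sub 1).rpow_const (Or.inl (by simp; linarith [hy.2])))
      refine monotoneOn_of_deriv_nonneg (convex_Ico _ _)
        (fun y hy => (hd y hy).continuousAt.continuousWithinAt)
        (fun y hy => (hd y (interior_subset hy)).differentiableAt.differentiableWithinAt) ?_
      intro y hy
      have hy := interior_subset hy
      rw [(hd y hy).deriv]
      have hy1 : 0 < 1 - y := by linarith [hy.2]
      have hyI : y ∈ Ioo (-1:ℝ) 1 := ⟨by linarith [hy.1], hy.2⟩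
      have hfy := hf.pos y hyI
      have hle : f y ≤ 2 * C * (1 - y) := by
        have := (hb y ⟨hyI.1.le, hyI.2.le⟩).2
        have h2 : C * (1 - y ^ 2) ≤ 2 * C * (1 - y) := by
          nlinarith [mul_nonneg hC.le (mul_nonneg hy1.le hy1.le)]
        linarith
      have e : (1 - y) ^ ((2 * C)⁻¹ - 1) = (1 - y) ^ (2 * C)⁻¹ / (1 - y) := by
        rw [Real.rpow_sub hy1, Real.rpow_one]
      rw [e]
      have key : (2 * C)⁻¹ / (1 - y) ≤ 1 / f y := by
        rw [div_le_div_iff₀ hy1 hfy, inv_mul_le_iff₀ (by positivity)]; linarith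
      have hE := expCoord_pos (f := f) hyI
      have hp : 0 < (1 - y) ^ (2 * C)⁻¹ := Real.rpow_pos_of_pos hy1 _
      have : expCoord f y / f y * (1 - y) ^ (2 * C)⁻¹ +
            expCoord f y * (-1 * (2 * C)⁻¹ * ((1 - y) ^ (2 * C)⁻¹ / (1 - y))) =
          expCoord f y * (1 - y) ^ (2 * C)⁻¹ * (1 / f y - (2 * C)⁻¹ / (1 - y)) := by ring
      rw [this]
      exact mul_nonneg (by positivity) (by linarith)
    have := hmono (by norm_num) ⟨hx.1, h⟩ hx.1
    simp only [expCoord_zero, sub_zero, Real.one_rpow, mul_one] at this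
    have hE : 0 < expCoord f x := expCoord_pos ⟨by linarith [hx.1], h⟩
    rw [inv_le_iff_one_le_mul₀ hE, mul_comm]
    exact this
  · intro x hx
    rcases eq_or_lt_of_le hx.1 with h | h
    · rw [← h, expCoord_of_notMem (by simp), add_neg_cancel, Real.zero_rpow (by positivity)]
    have hmono : MonotoneOn (fun x => expCoord f x * (1 + x) ^ (-(2 * C)⁻¹)) (Ioc (-1) 0) := by
      have hd : ∀ y ∈ Ioc (-1:ℝ) 0, HasDerivAt (fun x => expCoord f x * (1 + x) ^ (-(2 * C)⁻¹))
          (expCoord f y / f y * (1 + y) ^ (-(2 * C)⁻¹) +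
            expCoord f y * (1 * -(2 * C)⁻¹ * (1 + y) ^ (-(2 * C)⁻¹ - 1))) y := fun y hy =>
        (hf.hasDerivAt_expCoord ⟨hy.1, by linarith [hy.2]⟩).mul
          (((hasDerivAt_id y).const_add 1).rpow_const (Or.inl (by simp; linarith [hy.1])))
      refine monotoneOn_of_deriv_nonneg (convex_Ioc _ _)
        (fun y hy => (hd y hy).continuousAt.continuousWithinAt)
        (fun y hy => (hd y (interior_subset hy)).differentiableAt.differentiableWithinAt) ?_
      intro y hy
      have hy := interior_subset hy
      rw [(hd y hy).deriv]
      have hy1 : 0 < 1 + y := by linarith [hy.1]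
      have hyI : y ∈ Ioo (-1:ℝ) 1 := ⟨hy.1, by linarith [hy.2]⟩
      have hfy := hf.pos y hyI
      have hle : f y ≤ 2 * C * (1 + y) := by
        have := (hb y ⟨hyI.1.le, hyI.2.le⟩).2
        have h2 : C * (1 - y ^ 2) ≤ 2 * C * (1 + y) := by
          nlinarith [mul_nonneg hC.le (mul_nonneg hy1.le hy1.le)]
        linarith
      have e : (1 + y) ^ (-(2 * C)⁻¹ - 1) = (1 + y) ^ (-(2 * C)⁻¹) / (1 + y) := by
        rw [Real.rpow_sub hy1, Real.rpow_one]
      rw [e]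
      have key : (2 * C)⁻¹ / (1 + y) ≤ 1 / f y := by
        rw [div_le_div_iff₀ hy1 hfy, inv_mul_le_iff₀ (by positivity)]; linarith
      have hE := expCoord_pos (f := f) hyI
      have hp : 0 < (1 + y) ^ (-(2 * C)⁻¹) := Real.rpow_pos_of_pos hy1 _
      have : expCoord f y / f y * (1 + y) ^ (-(2 * C)⁻¹) +
            expCoord f y * (1 * -(2 * C)⁻¹ * ((1 + y) ^ (-(2 * C)⁻¹) / (1 + y))) =
          expCoord f y * (1 + y) ^ (-(2 * C)⁻¹) * (1 / f y - (2 * C)⁻¹ / (1 + y)) := by ring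
      rw [this]
      exact mul_nonneg (by positivity) (by linarith)
    have := hmono ⟨h, hx.2⟩ (by norm_num) hx.2
    have h1 : 0 < 1 + x := by linarith
    simp only [expCoord_zero, add_zero, Real.one_rpow, mul_one] at this
    rw [Real.rpow_neg h1.le, ← div_eq_mul_inv, div_le_one (Real.rpow_pos_of_pos h1 _)] at this
    exact this

theorem IsProfile.tendsto_inv_expCoord_one {f : ℝ → ℝ} (hf : IsProfile f) :
    Tendsto (fun x => (expCoord f x)⁻¹) (nhdsWithin 1 (Icc (-1) 1)) (nhds 0) := by
  obtain ⟨a, ha, h1, -⟩ := hf.exists_expCoord_bounds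
  have hlim : Tendsto (fun x : ℝ => (1 - x) ^ a) (nhdsWithin 1 (Icc (-1) 1)) (nhds 0) := by
    have : ContinuousAt (fun x : ℝ => (1 - x) ^ a) 1 :=
      (continuousAt_const.sub continuousAt_id).rpow_const (Or.inr ha.le)
    have := this.tendsto.mono_left (nhdsWithin_le_nhds (s := Icc (-1:ℝ) 1))
    simpa [Real.zero_rpow ha.ne'] using this
  refine squeeze_zero' (Eventually.of_forall fun x => inv_nonneg.2 (expCoord_nonneg f x)) ?_ hlim
  filter_upwards [self_mem_nhdsWithin, nhdsWithin_le_nhds (lt_mem_nhds (show (0:ℝ) < 1 by norm_num))]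
    with x hx hx'
  exact h1 x ⟨hx'.le, hx.2⟩

theorem IsProfile.tendsto_expCoord_neg_one {f : ℝ → ℝ} (hf : IsProfile f) :
    Tendsto (expCoord f) (nhdsWithin (-1) (Icc (-1) 1)) (nhds 0) := by
  obtain ⟨a, ha, -, h1⟩ := hf.exists_expCoord_bounds
  have hlim : Tendsto (fun x : ℝ => (1 + x) ^ a) (nhdsWithin (-1) (Icc (-1) 1)) (nhds 0) := by
    have : ContinuousAt (fun x : ℝ => (1 + x) ^ a) (-1) :=
      (continuousAt_const.add continuousAt_id).rpow_const (Or.inr ha.le)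
    have := this.tendsto.mono_left (nhdsWithin_le_nhds (s := Icc (-1:ℝ) 1))
    simpa [Real.zero_rpow ha.ne'] using this
  refine squeeze_zero' (Eventually.of_forall fun x => expCoord_nonneg f x) ?_ hlim
  filter_upwards [self_mem_nhdsWithin, nhdsWithin_le_nhds (gt_mem_nhds (show (-1:ℝ) < 0 by norm_num))]
    with x hx hx'
  exact h1 x ⟨hx.1, hx'.le⟩

/-- Lebesgue measure on `(-1,1)`. -/
noncomputable abbrev intervalMeasure : Measure ℝ := volume.restrict (Ioo (-1) 1)

theorem ae_intervalMeasure_mem : ∀ᵐ x ∂intervalMeasure, x ∈ Ioo (-1:ℝ) 1 :=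
  ae_restrict_mem measurableSet_Ioo

theorem integral_intervalMeasure (g : ℝ → ℝ) :
    ∫ x, g x ∂intervalMeasure = ∫ x in (-1:ℝ)..1, g x := by
  rw [intervalIntegral.integral_of_le (by norm_num), integral_Ioc_eq_integral_Ioo]

theorem intervalMeasure_real_univ : intervalMeasure.real univ = 2 := by
  norm_num [Measure.real]

theorem intervalMeasure_ne_zero : intervalMeasure ≠ 0 := fun h => by
  have := intervalMeasure_real_univ
  rw [h] at this
  simp at this

theorem integrable_intervalMeasure_iff {g : ℝ → ℝ} :
    Integrable g intervalMeasure ↔ IntervalIntegrable g volume (-1) 1 := by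
  rw [intervalIntegrable_iff_integrableOn_Ioo_of_le (by norm_num)]; rfl

/-- The quotient of the smaller of two numbers by the larger one. -/
noncomputable def minMaxRatio (a b : ℝ) : ℝ := min a b * (max a b)⁻¹

theorem minMaxRatio_nonneg {a b : ℝ} (ha : 0 ≤ a) (hb : 0 ≤ b) : 0 ≤ minMaxRatio a b :=
  mul_nonneg (le_min ha hb) (inv_nonneg.2 (le_max_of_le_left ha))

theorem minMaxRatio_pos {a b : ℝ} (ha : 0 < a) (hb : 0 < b) : 0 < minMaxRatio a b :=
  mul_pos (lt_min ha hb) (inv_pos.2 (lt_max_of_lt_left ha))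

theorem minMaxRatio_comm (a b : ℝ) : minMaxRatio a b = minMaxRatio b a := by
  rw [minMaxRatio, minMaxRatio, min_comm, max_comm]

theorem minMaxRatio_le_one {a b : ℝ} (ha : 0 ≤ a) : minMaxRatio a b ≤ 1 := by
  rw [minMaxRatio, ← div_eq_mul_inv]
  exact div_le_one_of_le₀ min_le_max (le_max_of_le_left ha)

theorem minMaxRatio_of_le {a b : ℝ} (h : a ≤ b) : minMaxRatio a b = a * b⁻¹ := by
  rw [minMaxRatio, min_eq_left h, max_eq_right h]

theorem minMaxRatio_of_ge {a b : ℝ} (h : b ≤ a) : minMaxRatio a b = b * a⁻¹ := by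
  rw [minMaxRatio_comm, minMaxRatio_of_le h]

theorem minMaxRatio_le_mul_inv {a b : ℝ} (ha : 0 < a) (hb : 0 < b) :
    minMaxRatio a b ≤ a * b⁻¹ :=
  mul_le_mul (min_le_left _ _) (inv_anti₀ hb (le_max_right _ _))
    (inv_nonneg.2 (le_max_of_le_left ha.le)) ha.le

/-- The Green kernel of the operator `L_k`. -/
noncomputable def green (f : ℝ → ℝ) (k : ℕ) (x y : ℝ) : ℝ :=
  minMaxRatio (expCoord f x) (expCoord f y) ^ k / (2 * k)

theorem green_comm (f : ℝ → ℝ) (k : ℕ) (x y : ℝ) : green f k x y = green f k y x := by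
  rw [green, green, minMaxRatio_comm]

theorem green_nonneg (f : ℝ → ℝ) (k : ℕ) (x y : ℝ) : 0 ≤ green f k x y :=
  div_nonneg (pow_nonneg (minMaxRatio_nonneg (expCoord_nonneg f x) (expCoord_nonneg f y)) _)
    (by positivity)

theorem green_pos (f : ℝ → ℝ) {k : ℕ} (hk : 1 ≤ k) {x y : ℝ} (hx : x ∈ Ioo (-1:ℝ) 1)
    (hy : y ∈ Ioo (-1:ℝ) 1) : 0 < green f k x y :=
  div_pos (pow_pos (minMaxRatio_pos (expCoord_pos hx) (expCoord_pos hy)) _)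
    (by have : (0:ℝ) < k := by exact_mod_cast hk
        positivity)

theorem green_le (f : ℝ → ℝ) (k : ℕ) (x y : ℝ) : green f k x y ≤ 1 / (2 * k) :=
  div_le_div_of_nonneg_right
    (pow_le_one₀ (minMaxRatio_nonneg (expCoord_nonneg f x) (expCoord_nonneg f y))
      (minMaxRatio_le_one (expCoord_nonneg f x))) (by positivity)

theorem IsProfile.isBddKernel_green {f : ℝ → ℝ} (hf : IsProfile f) (k : ℕ) :
    IsBddKernel (green f k) (1 / (2 * k)) where
  measurable := by
    have h1 : Measurable fun z : ℝ × ℝ => expCoord f z.1 :=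
      hf.measurable_expCoord.comp measurable_fst
    have h2 : Measurable fun z : ℝ × ℝ => expCoord f z.2 :=
      hf.measurable_expCoord.comp measurable_snd
    exact (((h1.min h2).mul (h1.max h2).inv).pow_const k).div_const _
  bound x y := by rw [abs_of_nonneg (green_nonneg f k x y)]; exact green_le f k x y

theorem green_of_notMem (f : ℝ → ℝ) {k : ℕ} (hk : 1 ≤ k) {x : ℝ} (hx : x ∉ Ioo (-1:ℝ) 1) (y : ℝ) :
    green f k x y = 0 := by
  rw [green, minMaxRatio, expCoord_of_notMem hx, min_eq_left (expCoord_nonneg f y), zero_mul,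
    zero_pow (by omega), zero_div]

theorem IsProfile.continuousOn_green {f : ℝ → ℝ} (hf : IsProfile f) (k : ℕ) {y : ℝ}
    (hy : y ∈ Ioo (-1:ℝ) 1) : ContinuousOn (fun x => green f k x y) (Icc (-1) 1) := by
  have hr : ContinuousOn (fun x => minMaxRatio (expCoord f x) (expCoord f y)) (Icc (-1) 1) := by
    intro x hx
    have hEy := expCoord_pos (f := f) hy
    have hval : ∀ x, x ∉ Ioo (-1:ℝ) 1 → minMaxRatio (expCoord f x) (expCoord f y) = 0 := by
      intro x hx
      rw [minMaxRatio, expCoord_of_notMem hx, min_eq_left hEy.le, zero_mul]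
    rcases eq_or_lt_of_le hx.1 with h | h
    · subst h
      rw [ContinuousWithinAt, hval _ (by simp)]
      have := hf.tendsto_expCoord_neg_one.mul_const (expCoord f y)⁻¹
      rw [zero_mul] at this
      refine squeeze_zero (fun x => minMaxRatio_nonneg (expCoord_nonneg f x) hEy.le)
        (fun x => ?_) this
      by_cases hx : x ∈ Ioo (-1:ℝ) 1
      · exact minMaxRatio_le_mul_inv (expCoord_pos hx) hEy
      · rw [hval x hx]; exact mul_nonneg (expCoord_nonneg f x) (inv_nonneg.2 hEy.le)
    rcases eq_or_lt_of_le hx.2 with h' | h'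
    · subst h'
      rw [ContinuousWithinAt, hval _ (by simp)]
      have := hf.tendsto_inv_expCoord_one.const_mul (expCoord f y)
      rw [mul_zero] at this
      refine squeeze_zero (fun x => minMaxRatio_nonneg (expCoord_nonneg f x) hEy.le)
        (fun x => ?_) this
      by_cases hx : x ∈ Ioo (-1:ℝ) 1
      · rw [minMaxRatio_comm]; exact minMaxRatio_le_mul_inv hEy (expCoord_pos hx)
      · rw [hval x hx]; exact mul_nonneg hEy.le (inv_nonneg.2 (expCoord_nonneg f x))
    · have hE := (hf.hasDerivAt_expCoord ⟨h, h'⟩).continuousAt.continuousWithinAt (s := Icc (-1) 1)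
      exact (hE.min continuousWithinAt_const).mul
        ((hE.max continuousWithinAt_const).inv₀ (lt_max_of_lt_right hEy).ne')
  exact (hr.pow k).div_const _

/-- The solution operator of `L_k u = g`. -/
noncomputable def greenInt (f : ℝ → ℝ) (k : ℕ) (g : ℝ → ℝ) (x : ℝ) : ℝ :=
  ∫ y, green f k x y * g y ∂intervalMeasure

theorem greenInt_of_notMem (f : ℝ → ℝ) {k : ℕ} (hk : 1 ≤ k) (g : ℝ → ℝ) {x : ℝ}
    (hx : x ∉ Ioo (-1:ℝ) 1) : greenInt f k g x = 0 := by
  simp [greenInt, green_of_notMem f hk hx]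

theorem IsProfile.continuousOn_greenInt {f : ℝ → ℝ} (hf : IsProfile f) (k : ℕ)
    {g : ℝ → ℝ} (hg : Integrable g intervalMeasure) :
    ContinuousOn (greenInt f k g) (Icc (-1) 1) := by
  refine continuousOn_of_dominated (bound := fun y => 1 / (2 * k) * |g y|) ?_ ?_
    (hg.abs.const_mul _) ?_
  · exact fun x _ => ((hf.isBddKernel_green k).integrable_mul hg x).aestronglyMeasurable
  · refine fun x _ => Eventually.of_forall fun y => ?_
    rw [norm_mul]
    exact mul_le_mul_of_nonneg_right ((hf.isBddKernel_green k).bound x y) (abs_nonneg _)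
  · filter_upwards [ae_intervalMeasure_mem] with y hy
    exact (hf.continuousOn_green k hy).mul continuousOn_const

/-- The part of the Green integral over `(-1,x)`. -/
noncomputable def lowInt (f : ℝ → ℝ) (k : ℕ) (g : ℝ → ℝ) (x : ℝ) : ℝ :=
  (expCoord f x)⁻¹ ^ k * ∫ t in (-1:ℝ)..x, expCoord f t ^ k * g t

/-- The part of the Green integral over `(x,1)`. -/
noncomputable def upInt (f : ℝ → ℝ) (k : ℕ) (g : ℝ → ℝ) (x : ℝ) : ℝ :=
  expCoord f x ^ k * ∫ t in x..1, (expCoord f t)⁻¹ ^ k * g t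

theorem IsProfile.expCoord_le {f : ℝ → ℝ} (hf : IsProfile f) {x t : ℝ} (hx : x ∈ Ioo (-1:ℝ) 1)
    (ht : t ≤ x) : expCoord f t ≤ expCoord f x := by
  by_cases h : t ∈ Ioo (-1:ℝ) 1
  · exact hf.strictMonoOn_expCoord.monotoneOn h hx ht
  · rw [expCoord_of_notMem h]; exact expCoord_nonneg f x

theorem IsProfile.inv_expCoord_le {f : ℝ → ℝ} (hf : IsProfile f) {x t : ℝ} (hx : x ∈ Ioo (-1:ℝ) 1)
    (ht : x ≤ t) : (expCoord f t)⁻¹ ≤ (expCoord f x)⁻¹ := by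
  by_cases h : t ∈ Ioo (-1:ℝ) 1
  · exact inv_anti₀ (expCoord_pos hx) (hf.strictMonoOn_expCoord.monotoneOn hx h ht)
  · rw [expCoord_of_notMem h, inv_zero]; exact inv_nonneg.2 (expCoord_nonneg f x)

theorem intervalIntegrable_sub {g : ℝ → ℝ} (hg : Integrable g intervalMeasure) {a b : ℝ}
    (ha : a ∈ Icc (-1:ℝ) 1) (hb : b ∈ Icc (-1:ℝ) 1) : IntervalIntegrable g volume a b :=
  (integrable_intervalMeasure_iff.1 hg).mono_set (by
    rw [uIcc_of_le (show (-1:ℝ) ≤ 1 by norm_num)]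
    exact OrdConnected.uIcc_subset ordConnected_Icc ha hb)

theorem IsProfile.intervalIntegrable_low {f : ℝ → ℝ} (hf : IsProfile f) (k : ℕ) {g : ℝ → ℝ}
    (hg : Integrable g intervalMeasure) {x : ℝ} (hx : x ∈ Ioo (-1:ℝ) 1) :
    IntervalIntegrable (fun t => expCoord f t ^ k * g t) volume (-1) x := by
  have h1 := intervalIntegrable_sub hg (a := -1) (b := x) (by simp) (Ioo_subset_Icc_self hx)
  rw [intervalIntegrable_iff_integrableOn_Ioc_of_le hx.1.le] at h1 ⊢
  refine h1.bdd_mul (hf.measurable_expCoord.pow_const k).aestronglyMeasurable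
    (c := expCoord f x ^ k) ?_
  filter_upwards [ae_restrict_mem measurableSet_Ioc] with t ht
  rw [Real.norm_of_nonneg (pow_nonneg (expCoord_nonneg f t) _)]
  exact pow_le_pow_left₀ (expCoord_nonneg f t) (hf.expCoord_le hx ht.2) _

theorem IsProfile.intervalIntegrable_up {f : ℝ → ℝ} (hf : IsProfile f) (k : ℕ) {g : ℝ → ℝ}
    (hg : Integrable g intervalMeasure) {x : ℝ} (hx : x ∈ Ioo (-1:ℝ) 1) :
    IntervalIntegrable (fun t => (expCoord f t)⁻¹ ^ k * g t) volume x 1 := by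
  have h1 := intervalIntegrable_sub hg (a := x) (b := 1) (Ioo_subset_Icc_self hx) (by simp)
  rw [intervalIntegrable_iff_integrableOn_Ioc_of_le hx.2.le] at h1 ⊢
  refine h1.bdd_mul (hf.measurable_expCoord.inv.pow_const k).aestronglyMeasurable
    (c := (expCoord f x)⁻¹ ^ k) ?_
  filter_upwards [ae_restrict_mem measurableSet_Ioc] with t ht
  have h0 := inv_nonneg.2 (expCoord_nonneg f t)
  rw [Real.norm_of_nonneg (pow_nonneg h0 _)]
  exact pow_le_pow_left₀ h0 (hf.inv_expCoord_le hx ht.1.le) _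

theorem IsProfile.lowInt_eq {f : ℝ → ℝ} (hf : IsProfile f) (k : ℕ) (g : ℝ → ℝ)
    {x : ℝ} (hx : x ∈ Ioo (-1:ℝ) 1) :
    lowInt f k g x = ∫ t in (-1:ℝ)..x, minMaxRatio (expCoord f x) (expCoord f t) ^ k * g t := by
  rw [lowInt, ← intervalIntegral.integral_const_mul]
  refine intervalIntegral.integral_congr fun t ht => ?_
  rw [uIcc_of_le hx.1.le] at ht
  rw [minMaxRatio_of_ge (hf.expCoord_le hx ht.2), mul_pow]
  ring

theorem IsProfile.upInt_eq {f : ℝ → ℝ} (hf : IsProfile f) {k : ℕ} (hk : 1 ≤ k) (g : ℝ → ℝ)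
    {x : ℝ} (hx : x ∈ Ioo (-1:ℝ) 1) :
    upInt f k g x = ∫ t in x..1, minMaxRatio (expCoord f x) (expCoord f t) ^ k * g t := by
  rw [upInt, ← intervalIntegral.integral_const_mul]
  refine intervalIntegral.integral_congr fun t ht => ?_
  rw [uIcc_of_le hx.2.le] at ht
  by_cases h : t ∈ Ioo (-1:ℝ) 1
  · rw [minMaxRatio_of_le (hf.expCoord_le h ht.1), mul_pow]; ring
  · rw [minMaxRatio, expCoord_of_notMem h, min_eq_right (expCoord_nonneg f x)]
    simp [show k ≠ 0 by omega]

theorem IsProfile.greenInt_eq {f : ℝ → ℝ} (hf : IsProfile f) {k : ℕ} (hk : 1 ≤ k) {g : ℝ → ℝ}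
    (hg : Integrable g intervalMeasure) {x : ℝ} (hx : x ∈ Ioo (-1:ℝ) 1) :
    greenInt f k g x = (lowInt f k g x + upInt f k g x) / (2 * k) := by
  have hk0 : (k:ℝ) ≠ 0 := by positivity
  have hint : Integrable (fun t => minMaxRatio (expCoord f x) (expCoord f t) ^ k * g t)
      intervalMeasure := by
    have := ((hf.isBddKernel_green k).integrable_mul hg x).const_mul (2 * k : ℝ)
    refine this.congr (Eventually.of_forall fun t => ?_)
    simp only [green]
    field_simp
  have hI := Ioo_subset_Icc_self hx
  rw [hf.lowInt_eq k g hx, hf.upInt_eq hk g hx,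
    integral_add_adjacent_intervals (intervalIntegrable_sub hint (by simp) hI)
    (intervalIntegrable_sub hint hI (by simp)), greenInt, integral_intervalMeasure,
    ← intervalIntegral.integral_div]
  refine intervalIntegral.integral_congr fun t _ => ?_
  simp only [green]
  ring

theorem IsProfile.abs_lowInt_le {f : ℝ → ℝ} (hf : IsProfile f) (k : ℕ) {g : ℝ → ℝ}
    (hg : Integrable g intervalMeasure) {x : ℝ} (hx : x ∈ Ioo (-1:ℝ) 1) :
    |lowInt f k g x| ≤ ∫ t, |g t| ∂intervalMeasure := by
  rw [hf.lowInt_eq k g hx]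
  have habs := integrable_intervalMeasure_iff.1 hg.abs
  calc _ ≤ ∫ t in (-1:ℝ)..x, |g t| := by
        rw [← Real.norm_eq_abs]
        refine intervalIntegral.norm_integral_le_of_norm_le hx.1.le (Eventually.of_forall fun t _ => ?_)
          (intervalIntegrable_sub hg.abs (by simp) (Ioo_subset_Icc_self hx))
        have h0 := minMaxRatio_nonneg (expCoord_nonneg f x) (expCoord_nonneg f t)
        rw [norm_mul, norm_pow, Real.norm_of_nonneg h0, Real.norm_eq_abs]
        exact mul_le_of_le_one_left (abs_nonneg _)
          (pow_le_one₀ h0 (minMaxRatio_le_one (expCoord_nonneg f x)))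
    _ ≤ _ := by
        rw [integral_intervalMeasure]
        exact intervalIntegral.integral_mono_interval le_rfl hx.1.le hx.2.le
          (Eventually.of_forall fun t => abs_nonneg _) habs

theorem IsProfile.abs_upInt_le {f : ℝ → ℝ} (hf : IsProfile f) {k : ℕ} (hk : 1 ≤ k) {g : ℝ → ℝ}
    (hg : Integrable g intervalMeasure) {x : ℝ} (hx : x ∈ Ioo (-1:ℝ) 1) :
    |upInt f k g x| ≤ ∫ t, |g t| ∂intervalMeasure := by
  rw [hf.upInt_eq hk g hx]
  have habs := integrable_intervalMeasure_iff.1 hg.abs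
  calc _ ≤ ∫ t in x..1, |g t| := by
        rw [← Real.norm_eq_abs]
        refine intervalIntegral.norm_integral_le_of_norm_le hx.2.le (Eventually.of_forall fun t _ => ?_)
          (intervalIntegrable_sub hg.abs (Ioo_subset_Icc_self hx) (by simp))
        have h0 := minMaxRatio_nonneg (expCoord_nonneg f x) (expCoord_nonneg f t)
        rw [norm_mul, norm_pow, Real.norm_of_nonneg h0, Real.norm_eq_abs]
        exact mul_le_of_le_one_left (abs_nonneg _)
          (pow_le_one₀ h0 (minMaxRatio_le_one (expCoord_nonneg f x)))
    _ ≤ _ := by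
        rw [integral_intervalMeasure]
        exact intervalIntegral.integral_mono_interval hx.1.le hx.2.le le_rfl
          (Eventually.of_forall fun t => abs_nonneg _) habs

theorem IsProfile.hasDerivAt_inv_expCoord_pow {f : ℝ → ℝ} (hf : IsProfile f) (k : ℕ) {x : ℝ}
    (hx : x ∈ Ioo (-1:ℝ) 1) :
    HasDerivAt (fun x => (expCoord f x)⁻¹ ^ k) (-(k * (expCoord f x)⁻¹ ^ k / f x)) x := by
  have hE := (expCoord_pos (f := f) hx).ne'
  have hfx := hf.ne_zero hx
  refine (((hf.hasDerivAt_expCoord hx).inv hE).pow k).congr_deriv ?_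
  rcases k with _ | k
  · simp
  · simp only [Nat.add_sub_cancel, Pi.inv_apply]
    rw [inv_pow, inv_pow]
    field_simp
    ring

theorem IsProfile.hasDerivAt_expCoord_pow {f : ℝ → ℝ} (hf : IsProfile f) (k : ℕ) {x : ℝ}
    (hx : x ∈ Ioo (-1:ℝ) 1) :
    HasDerivAt (fun x => expCoord f x ^ k) (k * expCoord f x ^ k / f x) x := by
  have hfx := hf.ne_zero hx
  refine ((hf.hasDerivAt_expCoord hx).pow k).congr_deriv ?_
  rcases k with _ | k
  · simp
  · simp only [Nat.add_sub_cancel]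
    rw [pow_succ]
    field_simp

theorem IsProfile.hasDerivAt_lowInt {f : ℝ → ℝ} (hf : IsProfile f) (k : ℕ) {g : ℝ → ℝ}
    (hg : Integrable g intervalMeasure) (hgc : ContinuousOn g (Ioo (-1) 1)) {x : ℝ}
    (hx : x ∈ Ioo (-1:ℝ) 1) :
    HasDerivAt (lowInt f k g) (-(k * lowInt f k g x / f x) + g x) x := by
  have hc : ContinuousOn (fun t => expCoord f t ^ k * g t) (Ioo (-1) 1) :=
    (hf.continuousOn_expCoord.pow k).mul hgc
  have h1 := integral_hasDerivAt_right (hf.intervalIntegrable_low k hg hx)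
    (hc.stronglyMeasurableAtFilter isOpen_Ioo x hx) (hc.continuousAt (isOpen_Ioo.mem_nhds hx))
  refine ((hf.hasDerivAt_inv_expCoord_pow k hx).mul h1).congr_deriv ?_
  have hE := (expCoord_pos (f := f) hx).ne'
  rw [lowInt, inv_pow]
  field_simp

theorem IsProfile.hasDerivAt_upInt {f : ℝ → ℝ} (hf : IsProfile f) (k : ℕ) {g : ℝ → ℝ}
    (hg : Integrable g intervalMeasure) (hgc : ContinuousOn g (Ioo (-1) 1)) {x : ℝ}
    (hx : x ∈ Ioo (-1:ℝ) 1) :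
    HasDerivAt (upInt f k g) (k * upInt f k g x / f x - g x) x := by
  have hc : ContinuousOn (fun t => (expCoord f t)⁻¹ ^ k * g t) (Ioo (-1) 1) :=
    ((hf.continuousOn_expCoord.inv₀ fun t ht => (expCoord_pos ht).ne').pow k).mul hgc
  have h1 := integral_hasDerivAt_left (hf.intervalIntegrable_up k hg hx)
    (hc.stronglyMeasurableAtFilter isOpen_Ioo x hx) (hc.continuousAt (isOpen_Ioo.mem_nhds hx))
  refine ((hf.hasDerivAt_expCoord_pow k hx).mul h1).congr_deriv ?_
  have hE := (expCoord_pos (f := f) hx).ne'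
  rw [upInt, inv_pow]
  field_simp
  ring

theorem IsProfile.hasDerivAt_greenInt {f : ℝ → ℝ} (hf : IsProfile f) {k : ℕ} (hk : 1 ≤ k)
    {g : ℝ → ℝ} (hg : Integrable g intervalMeasure) (hgc : ContinuousOn g (Ioo (-1) 1)) {x : ℝ}
    (hx : x ∈ Ioo (-1:ℝ) 1) :
    HasDerivAt (greenInt f k g) ((upInt f k g x - lowInt f k g x) / 2 / f x) x := by
  have hk0 : (k:ℝ) ≠ 0 := by positivity
  have hfx := hf.ne_zero hx
  have h := (((hf.hasDerivAt_lowInt k hg hgc hx).add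
    (hf.hasDerivAt_upInt k hg hgc hx)).div_const (2 * k)).congr_of_eventuallyEq (f₁ := greenInt f k g)
    (by filter_upwards [isOpen_Ioo.mem_nhds hx] with y hy using hf.greenInt_eq hk hg hy)
  refine h.congr_deriv ?_
  field_simp
  ring

theorem IsProfile.hasDerivAt_half_upInt_sub_lowInt {f : ℝ → ℝ} (hf : IsProfile f) {k : ℕ}
    (hk : 1 ≤ k) {g : ℝ → ℝ} (hg : Integrable g intervalMeasure)
    (hgc : ContinuousOn g (Ioo (-1) 1)) {x : ℝ} (hx : x ∈ Ioo (-1:ℝ) 1) :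
    HasDerivAt (fun x => (upInt f k g x - lowInt f k g x) / 2)
      ((k:ℝ) ^ 2 / f x * greenInt f k g x - g x) x := by
  have hk0 : (k:ℝ) ≠ 0 := by positivity
  have hfx := hf.ne_zero hx
  refine (((hf.hasDerivAt_upInt k hg hgc hx).sub
    (hf.hasDerivAt_lowInt k hg hgc hx)).div_const 2).congr_deriv ?_
  rw [hf.greenInt_eq hk hg hx]
  field_simp
  ring

/-- `y` solves `L_k y = g` on `(-1,1)` and `p = f y'`. -/
def IsSolution (f : ℝ → ℝ) (k : ℕ) (g y p : ℝ → ℝ) : Prop :=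
  ∀ x ∈ Ioo (-1:ℝ) 1, HasDerivAt y (p x / f x) x ∧ HasDerivAt p ((k:ℝ) ^ 2 / f x * y x - g x) x

theorem IsSolution.continuousOn {f g y p : ℝ → ℝ} {k : ℕ} (h : IsSolution f k g y p) :
    ContinuousOn y (Ioo (-1) 1) := fun x hx => (h x hx).1.continuousAt.continuousWithinAt

theorem IsSolution.continuousOn_flux {f g y p : ℝ → ℝ} {k : ℕ} (h : IsSolution f k g y p) :
    ContinuousOn p (Ioo (-1) 1) := fun x hx => (h x hx).2.continuousAt.continuousWithinAt

theorem IsProfile.isSolution_greenInt {f : ℝ → ℝ} (hf : IsProfile f) {k : ℕ} (hk : 1 ≤ k)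
    {g : ℝ → ℝ} (hg : Integrable g intervalMeasure) (hgc : ContinuousOn g (Ioo (-1) 1)) :
    IsSolution f k g (greenInt f k g) (fun x => (upInt f k g x - lowInt f k g x) / 2) :=
  fun _ hx => ⟨hf.hasDerivAt_greenInt hk hg hgc hx,
    hf.hasDerivAt_half_upInt_sub_lowInt hk hg hgc hx⟩

theorem IsProfile.isSolution_of_eigen {f : ℝ → ℝ} (hf : IsProfile f) {k : ℕ} {lam : ℝ} {u : ℝ → ℝ}
    (hu : ContDiffOn ℝ (⊤ : ℕ∞) u (Ioo (-1) 1))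
    (h : ∀ x ∈ Ioo (-1:ℝ) 1,
      -(deriv (fun y => f y * deriv u y) x) + ((k:ℝ)^2 / f x) * u x = lam * u x) :
    IsSolution f k (fun x => lam * u x) u (fun x => f x * deriv u x) := by
  intro x hx
  have hmem := isOpen_Ioo.mem_nhds hx
  have hd : ContDiffOn ℝ (⊤ : ℕ∞) (deriv u) (Ioo (-1) 1) :=
    hu.deriv_of_isOpen isOpen_Ioo (by norm_num)
  constructor
  · rw [mul_div_cancel_left₀ _ (hf.ne_zero hx)]
    exact ((hu.contDiffAt hmem).differentiableAt (by norm_num)).hasDerivAt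
  · have h1 : DifferentiableAt ℝ (fun y => f y * deriv u y) x :=
      ((hf.smoothOn.mul hd).contDiffAt hmem).differentiableAt (by norm_num)
    refine h1.hasDerivAt.congr_deriv ?_
    linarith [h x hx]

theorem IsSolution.contDiffOn {f : ℝ → ℝ} (hf : IsProfile f) {k : ℕ} {lam : ℝ} {y p : ℝ → ℝ}
    (h : IsSolution f k (fun x => lam * y x) y p) :
    ContDiffOn ℝ (⊤ : ℕ∞) y (Ioo (-1) 1) := by
  have hinv : ContDiffOn ℝ (⊤ : ℕ∞) (fun x => (f x)⁻¹) (Ioo (-1) 1) :=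
    hf.smoothOn.inv fun x hx => hf.ne_zero hx
  have key : ∀ n : ℕ, ContDiffOn ℝ n y (Ioo (-1) 1) ∧ ContDiffOn ℝ n p (Ioo (-1) 1) := by
    intro n
    induction n with
    | zero => exact ⟨contDiffOn_zero.2 h.continuousOn, contDiffOn_zero.2 h.continuousOn_flux⟩
    | succ n ih =>
      have hi : ContDiffOn ℝ n (fun x => (f x)⁻¹) (Ioo (-1) 1) := hinv.of_le (by exact_mod_cast le_top)
      have hne : (n : WithTop ℕ∞) ≠ (⊤ : WithTop ℕ∞) := by simp
      constructor
      · push_cast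
        refine (contDiffOn_succ_iff_deriv_of_isOpen isOpen_Ioo).2
          ⟨fun x hx => (h x hx).1.differentiableAt.differentiableWithinAt, by simp, ?_⟩
        exact (ih.2.mul hi).congr fun x hx => by rw [(h x hx).1.deriv, div_eq_mul_inv]
      · push_cast
        refine (contDiffOn_succ_iff_deriv_of_isOpen isOpen_Ioo).2
          ⟨fun x hx => (h x hx).2.differentiableAt.differentiableWithinAt, by simp, ?_⟩
        exact (((contDiffOn_const (c := (k:ℝ) ^ 2).mul hi).mul ih.1).sub
          (contDiffOn_const (c := lam).mul ih.1)).congr fun x hx => by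
            rw [(h x hx).2.deriv, div_eq_mul_inv]
  exact contDiffOn_infty.2 fun n => (key n).1

theorem IsSolution.inSpec {f : ℝ → ℝ} (hf : IsProfile f) {k : ℕ} {lam : ℝ} {y p : ℝ → ℝ}
    (h : IsSolution f k (fun x => lam * y x) y p) (hc : ContinuousOn y (Icc (-1) 1))
    (hne : ∃ x ∈ Ioo (-1:ℝ) 1, y x ≠ 0) (hb : 1 ≤ k → y (-1) = 0 ∧ y 1 = 0) : InSpec f k lam := by
  refine ⟨y, hc, h.contDiffOn hf, hne, hb, fun x hx => ?_⟩
  have hev : (fun z => f z * deriv y z) =ᶠ[nhds x] p := by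
    filter_upwards [isOpen_Ioo.mem_nhds hx] with z hz
    rw [(h z hz).1.deriv, mul_div_cancel₀ _ (hf.ne_zero hz)]
  rw [hev.deriv_eq, (h x hx).2.deriv]
  ring

theorem eq_of_hasDerivAt_zero_Ioo {F : ℝ → ℝ} (h : ∀ x ∈ Ioo (-1:ℝ) 1, HasDerivAt F 0 x) {x y : ℝ}
    (hx : x ∈ Ioo (-1:ℝ) 1) (hy : y ∈ Ioo (-1:ℝ) 1) : F x = F y :=
  isOpen_Ioo.is_const_of_deriv_eq_zero isPreconnected_Ioo
    (fun z hz => (h z hz).differentiableAt.differentiableWithinAt)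
    (fun z hz => (h z hz).deriv) hx hy

/-- Restriction of a limit within `[-1,1]` at the right end to a left limit. -/
theorem nhdsLT_one_le : nhdsWithin (1:ℝ) (Ioo (-1) 1) ≤ nhdsWithin 1 (Icc (-1) 1) :=
  nhdsWithin_mono _ Ioo_subset_Icc_self

theorem nhdsGT_neg_one_le : nhdsWithin (-1:ℝ) (Ioo (-1) 1) ≤ nhdsWithin (-1) (Icc (-1) 1) :=
  nhdsWithin_mono _ Ioo_subset_Icc_self

instance neBot_nhdsWithin_Ioo_one : (nhdsWithin (1:ℝ) (Ioo (-1) 1)).NeBot :=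
  right_nhdsWithin_Ioo_neBot (by norm_num)

instance neBot_nhdsWithin_Ioo_neg_one : (nhdsWithin (-1:ℝ) (Ioo (-1) 1)).NeBot :=
  left_nhdsWithin_Ioo_neBot (by norm_num)

theorem IsSolution.eq_zero {f : ℝ → ℝ} (hf : IsProfile f) {k : ℕ} (hk : 1 ≤ k) {y p : ℝ → ℝ}
    (h : IsSolution f k (fun _ => 0) y p)
    (h1 : Tendsto y (nhdsWithin 1 (Ioo (-1) 1)) (nhds 0))
    (h2 : Tendsto y (nhdsWithin (-1) (Ioo (-1) 1)) (nhds 0)) {x : ℝ} (hx : x ∈ Ioo (-1:ℝ) 1) :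
    y x = 0 := by
  have hk0 : (k:ℝ) ≠ 0 := by positivity
  have hA : ∀ x ∈ Ioo (-1:ℝ) 1,
      HasDerivAt (fun x => (expCoord f x)⁻¹ ^ k * (p x + k * y x)) 0 x := fun x hx => by
    have hfx := hf.ne_zero hx
    refine ((hf.hasDerivAt_inv_expCoord_pow k hx).mul
      ((h x hx).2.add ((h x hx).1.const_mul (k:ℝ)))).congr_deriv ?_
    field_simp
    simp only [Pi.add_apply]
    ring
  have hB : ∀ x ∈ Ioo (-1:ℝ) 1,
      HasDerivAt (fun x => expCoord f x ^ k * (p x - k * y x)) 0 x := fun x hx => by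
    have hfx := hf.ne_zero hx
    refine ((hf.hasDerivAt_expCoord_pow k hx).mul
      ((h x hx).2.sub ((h x hx).1.const_mul (k:ℝ)))).congr_deriv ?_
    field_simp
    simp only [Pi.sub_apply]
    ring
  set A := (expCoord f x)⁻¹ ^ k * (p x + k * y x) with hAdef
  set B := expCoord f x ^ k * (p x - k * y x) with hBdef
  have eA : ∀ z ∈ Ioo (-1:ℝ) 1, (expCoord f z)⁻¹ ^ k * (p z + k * y z) = A :=
    fun z hz => eq_of_hasDerivAt_zero_Ioo hA hz hx
  have eB : ∀ z ∈ Ioo (-1:ℝ) 1, expCoord f z ^ k * (p z - k * y z) = B :=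
    fun z hz => eq_of_hasDerivAt_zero_Ioo hB hz hx
  have hE : ∀ z ∈ Ioo (-1:ℝ) 1, (expCoord f z)⁻¹ ^ k * expCoord f z ^ k = 1 := fun z hz => by
    rw [← mul_pow, inv_mul_cancel₀ (expCoord_pos hz).ne', one_pow]
  have A0 : A = 0 := by
    have t1 := (hf.tendsto_inv_expCoord_one.mono_left nhdsLT_one_le).pow k
    rw [zero_pow (by omega)] at t1
    have t2 : Tendsto (fun z => 2 * k * ((expCoord f z)⁻¹ ^ k * y z) +
        B * ((expCoord f z)⁻¹ ^ k * (expCoord f z)⁻¹ ^ k))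
        (nhdsWithin 1 (Ioo (-1) 1)) (nhds 0) := by
      simpa using ((t1.mul h1).const_mul (2 * k : ℝ)).add ((t1.mul t1).const_mul B)
    refine tendsto_nhds_unique (tendsto_const_nhds.congr' ?_) t2
    filter_upwards [self_mem_nhdsWithin] with z hz
    rw [← eA z hz, ← eB z hz]
    linear_combination (-(expCoord f z)⁻¹ ^ k * (p z - k * y z)) * hE z hz
  have B0 : B = 0 := by
    have t1 := (hf.tendsto_expCoord_neg_one.mono_left nhdsGT_neg_one_le).pow k
    rw [zero_pow (by omega)] at t1
    have t2 : Tendsto (fun z => A * (expCoord f z ^ k * expCoord f z ^ k) -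
        2 * k * (expCoord f z ^ k * y z))
        (nhdsWithin (-1) (Ioo (-1) 1)) (nhds 0) := by
      simpa using ((t1.mul t1).const_mul A).sub ((t1.mul h2).const_mul (2 * k : ℝ))
    refine tendsto_nhds_unique (tendsto_const_nhds.congr' ?_) t2
    filter_upwards [self_mem_nhdsWithin] with z hz
    rw [← eA z hz, ← eB z hz]
    linear_combination (-expCoord f z ^ k * (p z + k * y z)) * hE z hz
  rw [A0] at hAdef
  rw [B0] at hBdef
  have hEx := expCoord_pos (f := f) hx
  have e1 := (mul_eq_zero.1 hAdef.symm).resolve_left (pow_ne_zero _ (inv_ne_zero hEx.ne'))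
  have e2 := (mul_eq_zero.1 hBdef.symm).resolve_left (pow_ne_zero _ hEx.ne')
  have : (k:ℝ) * y x = 0 := by linarith
  exact (mul_eq_zero.1 this).resolve_left hk0

theorem IsSolution.sub {f g g' y p y' p' : ℝ → ℝ} {k : ℕ} (h : IsSolution f k g y p)
    (h' : IsSolution f k g' y' p') :
    IsSolution f k (fun x => g x - g' x) (fun x => y x - y' x) (fun x => p x - p' x) := fun x hx =>
  ⟨((h x hx).1.sub (h' x hx).1).congr_deriv (by ring),
    ((h x hx).2.sub (h' x hx).2).congr_deriv (by ring)⟩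

theorem IsSolution.const_mul {f g y p : ℝ → ℝ} {k : ℕ} (h : IsSolution f k g y p) (c : ℝ) :
    IsSolution f k (fun x => c * g x) (fun x => c * y x) (fun x => c * p x) := fun x hx =>
  ⟨((h x hx).1.const_mul c).congr_deriv (by ring),
    ((h x hx).2.const_mul c).congr_deriv (by ring)⟩

theorem IsProfile.tendsto_greenInt_one {f : ℝ → ℝ} (hf : IsProfile f) {k : ℕ} (hk : 1 ≤ k)
    {g : ℝ → ℝ} (hg : Integrable g intervalMeasure) :
    Tendsto (greenInt f k g) (nhdsWithin 1 (Icc (-1) 1)) (nhds 0) := by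
  have := hf.continuousOn_greenInt k hg 1 (by simp)
  rwa [ContinuousWithinAt, greenInt_of_notMem f hk g (by simp)] at this

theorem IsProfile.tendsto_greenInt_neg_one {f : ℝ → ℝ} (hf : IsProfile f) {k : ℕ} (hk : 1 ≤ k)
    {g : ℝ → ℝ} (hg : Integrable g intervalMeasure) :
    Tendsto (greenInt f k g) (nhdsWithin (-1) (Icc (-1) 1)) (nhds 0) := by
  have := hf.continuousOn_greenInt k hg (-1) (by simp)
  rwa [ContinuousWithinAt, greenInt_of_notMem f hk g (by simp)] at this

/-- A solution of `L_k y = g` vanishing at the ends is given by the Green kernel. -/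
theorem IsSolution.eq_greenInt {f : ℝ → ℝ} (hf : IsProfile f) {k : ℕ} (hk : 1 ≤ k) {g y p : ℝ → ℝ}
    (h : IsSolution f k g y p) (hg : Integrable g intervalMeasure)
    (hgc : ContinuousOn g (Ioo (-1) 1)) (hy : ContinuousOn y (Icc (-1) 1)) (hym : y (-1) = 0)
    (hy1 : y 1 = 0) : EqOn y (greenInt f k g) (Ioo (-1) 1) := by
  intro x hx
  have hs := h.sub (hf.isSolution_greenInt hk hg hgc)
  simp only [sub_self] at hs
  have t1 : Tendsto y (nhdsWithin 1 (Icc (-1) 1)) (nhds 0) := by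
    have := hy 1 (by simp); rwa [ContinuousWithinAt, hy1] at this
  have t2 : Tendsto y (nhdsWithin (-1) (Icc (-1) 1)) (nhds 0) := by
    have := hy (-1) (by simp); rwa [ContinuousWithinAt, hym] at this
  refine sub_eq_zero.1 (hs.eq_zero hf hk ?_ ?_ hx)
  · simpa using (t1.sub (hf.tendsto_greenInt_one hk hg)).mono_left nhdsLT_one_le
  · simpa using (t2.sub (hf.tendsto_greenInt_neg_one hk hg)).mono_left nhdsGT_neg_one_le

theorem ContinuousOn.integrable_intervalMeasure {g : ℝ → ℝ} (hg : ContinuousOn g (Icc (-1) 1)) :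
    Integrable g intervalMeasure :=
  (hg.integrableOn_compact isCompact_Icc).mono_set Ioo_subset_Icc_self

theorem ContinuousOn.memLp_intervalMeasure {g : ℝ → ℝ} (hg : ContinuousOn g (Icc (-1) 1)) :
    MemLp g 2 intervalMeasure := by
  obtain ⟨C, hC⟩ := isCompact_Icc.exists_bound_of_continuousOn hg
  refine MemLp.of_bound hg.integrable_intervalMeasure.aestronglyMeasurable C ?_
  filter_upwards [ae_intervalMeasure_mem] with x hx
  exact hC x (Ioo_subset_Icc_self hx)

theorem eq_zero_of_ae_eq_zero {g : ℝ → ℝ} (hg : ContinuousOn g (Ioo (-1) 1))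
    (h : g =ᵐ[intervalMeasure] 0) : ∀ x ∈ Ioo (-1:ℝ) 1, g x = 0 := fun _ hx =>
  Measure.eqOn_open_of_ae_eq (U := Ioo (-1:ℝ) 1) h isOpen_Ioo hg continuousOn_const hx

/-- If `F' = G₁ - G₂` with `G₁` integrable and `G₂ ≥ 0` then `G₂` is integrable and the
fundamental theorem of calculus holds. -/
theorem integrable_and_integral_of_hasDerivAt {F G₁ G₂ : ℝ → ℝ} {a b : ℝ}
    (hG₁ : Integrable G₁ intervalMeasure) (hG₁c : ContinuousOn G₁ (Ioo (-1) 1))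
    (hG₂ : ∀ x ∈ Ioo (-1:ℝ) 1, 0 ≤ G₂ x)
    (hF : ∀ x ∈ Ioo (-1:ℝ) 1, HasDerivAt F (G₁ x - G₂ x) x)
    (ha : Tendsto F (nhdsWithin (-1) (Ioo (-1) 1)) (nhds a))
    (hb : Tendsto F (nhdsWithin 1 (Ioo (-1) 1)) (nhds b)) :
    Integrable G₂ intervalMeasure ∧
      ∫ x, G₂ x ∂intervalMeasure = (∫ x, G₁ x ∂intervalMeasure) + a - b := by
  have hI := integrable_intervalMeasure_iff.1 hG₁
  set P : ℝ → ℝ := fun x => ∫ t in (-1:ℝ)..x, G₁ t with hP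
  have hPc : ContinuousOn P (Icc (-1) 1) := by
    have := intervalIntegral.continuousOn_primitive_interval (a := (-1:ℝ)) (b := 1) (f := G₁)
      (μ := volume) (by
        rw [uIcc_of_le (by norm_num)]
        exact (intervalIntegrable_iff_integrableOn_Icc_of_le (by norm_num)).1 hI)
    rwa [uIcc_of_le (by norm_num)] at this
  have hPd : ∀ x ∈ Ioo (-1:ℝ) 1, HasDerivAt P (G₁ x) x := fun x hx =>
    integral_hasDerivAt_right (intervalIntegrable_sub hG₁ (by simp) (Ioo_subset_Icc_self hx))
      (hG₁c.stronglyMeasurableAtFilter isOpen_Ioo x hx)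
      (hG₁c.continuousAt (isOpen_Ioo.mem_nhds hx))
  rw [nhdsWithin_Ioo_eq_nhdsGT (by norm_num)] at ha
  rw [nhdsWithin_Ioo_eq_nhdsLT (by norm_num)] at hb
  have hFc : ContinuousOn (extendFrom (Ioo (-1) 1) F) (Icc (-1) 1) :=
    continuousOn_Icc_extendFrom_Ioo (fun x hx => (hF x hx).continuousAt.continuousWithinAt) ha hb
  have hFd : ∀ x ∈ Ioo (-1:ℝ) 1, HasDerivAt (extendFrom (Ioo (-1) 1) F) (G₁ x - G₂ x) x :=
    fun x hx => (hF x hx).congr_of_eventuallyEq (by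
      filter_upwards [isOpen_Ioo.mem_nhds hx] with z hz
      exact extendFrom_eq (subset_closure hz) (hF z hz).continuousAt.continuousWithinAt)
  have hint : Integrable G₂ intervalMeasure :=
    (intervalIntegral.integrableOn_deriv_of_nonneg (hPc.sub hFc)
      (fun x hx => ((hPd x hx).sub (hFd x hx)).congr_deriv (by ring)) hG₂).mono_set Ioo_subset_Ioc_self
  refine ⟨hint, ?_⟩
  have := intervalIntegral.integral_eq_sub_of_hasDerivAt_of_tendsto (by norm_num) hF
    (integrable_intervalMeasure_iff.1 (hG₁.sub hint)) ha hb
  rw [intervalIntegral.integral_sub hI (integrable_intervalMeasure_iff.1 hint)] at this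
  rw [integral_intervalMeasure, integral_intervalMeasure]
  linarith

theorem IsProfile.integrable_greenInt_mul {f : ℝ → ℝ} (hf : IsProfile f) (k : ℕ) {g h : ℝ → ℝ}
    (hg : Integrable g intervalMeasure) (hh : Integrable h intervalMeasure) :
    Integrable (fun x => greenInt f k g x * h x) intervalMeasure := by
  refine hh.bdd_mul (c := 1 / (2 * k) * ∫ y, |g y| ∂intervalMeasure)
    ((hf.isBddKernel_green k).aestronglyMeasurable_integral hg.aestronglyMeasurable)
    (Eventually.of_forall fun x => ?_)
  exact (hf.isBddKernel_green k).abs_integral_le hg x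

/-- The Dirichlet energy of a Green potential as the integral of a square. -/
theorem IsProfile.integral_greenInt_mul_self {f : ℝ → ℝ} (hf : IsProfile f) {k : ℕ} (hk : 1 ≤ k)
    {g : ℝ → ℝ} (hg : Integrable g intervalMeasure) (hgc : ContinuousOn g (Ioo (-1) 1)) :
    Integrable (fun x => lowInt f k g x ^ 2 / f x) intervalMeasure ∧
      ∫ x, lowInt f k g x ^ 2 / f x ∂intervalMeasure =
        ∫ x, greenInt f k g x * g x ∂intervalMeasure := by
  have hk0 : (k:ℝ) ≠ 0 := by positivity
  have hbdd : ∀ l : Filter ℝ, (Ioo (-1:ℝ) 1) ∈ l → Tendsto (greenInt f k g) l (nhds 0) →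
      Tendsto (fun x => greenInt f k g x * lowInt f k g x) l (nhds 0) := by
    intro l hl ht
    refine squeeze_zero_norm' (a := fun x => |greenInt f k g x| * ∫ t, |g t| ∂intervalMeasure) ?_ ?_
    · filter_upwards [hl] with x hx
      rw [norm_mul]
      exact mul_le_mul_of_nonneg_left (hf.abs_lowInt_le k hg hx) (abs_nonneg _)
    · simpa using ht.abs.mul_const (∫ t, |g t| ∂intervalMeasure)
  have := integrable_and_integral_of_hasDerivAt (F := fun x => greenInt f k g x * lowInt f k g x)
    (G₁ := fun x => greenInt f k g x * g x) (G₂ := fun x => lowInt f k g x ^ 2 / f x)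
    (hf.integrable_greenInt_mul k hg hg)
    (((hf.continuousOn_greenInt k hg).mono Ioo_subset_Icc_self).mul hgc)
    (fun x hx => div_nonneg (sq_nonneg _) (hf.pos x hx).le)
    (fun x hx => by
      have hfx := hf.ne_zero hx
      refine ((hf.hasDerivAt_greenInt hk hg hgc hx).mul
        (hf.hasDerivAt_lowInt k hg hgc hx)).congr_deriv ?_
      have e : upInt f k g x = 2 * k * greenInt f k g x - lowInt f k g x := by
        rw [hf.greenInt_eq hk hg hx]; field_simp; ring
      rw [e]
      field_simp
      ring)
    (hbdd _ self_mem_nhdsWithin ((hf.tendsto_greenInt_neg_one hk hg).mono_left nhdsGT_neg_one_le))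
    (hbdd _ self_mem_nhdsWithin ((hf.tendsto_greenInt_one hk hg).mono_left nhdsLT_one_le))
  refine ⟨this.1, ?_⟩
  rw [this.2]
  ring

/-- `u` is an eigenfunction (possibly zero) of `L_k` with Dirichlet conditions, and `p = f u'`. -/
structure IsEigenfunction (f : ℝ → ℝ) (k : ℕ) (lam : ℝ) (u p : ℝ → ℝ) : Prop where
  cont : ContinuousOn u (Icc (-1) 1)
  neg_one : u (-1) = 0
  one : u 1 = 0
  sol : IsSolution f k (fun x => lam * u x) u p

theorem IsProfile.exists_isEigenfunction {f : ℝ → ℝ} (hf : IsProfile f) {k : ℕ} (hk : 1 ≤ k)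
    {lam : ℝ} (h : InSpec f k lam) :
    ∃ u p, IsEigenfunction f k lam u p ∧ ∃ x ∈ Ioo (-1:ℝ) 1, u x ≠ 0 := by
  obtain ⟨u, hc, hs, hne, hb, hode⟩ := h
  exact ⟨u, _, ⟨hc, (hb hk).1, (hb hk).2, hf.isSolution_of_eigen hs hode⟩, hne⟩

theorem IsEigenfunction.inSpec {f : ℝ → ℝ} (hf : IsProfile f) {k : ℕ} {lam : ℝ} {u p : ℝ → ℝ}
    (h : IsEigenfunction f k lam u p) (hne : ∃ x ∈ Ioo (-1:ℝ) 1, u x ≠ 0) : InSpec f k lam :=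
  h.sol.inSpec hf h.cont hne fun _ => ⟨h.neg_one, h.one⟩

theorem IsEigenfunction.eqOn_greenInt {f : ℝ → ℝ} (hf : IsProfile f) {k : ℕ} (hk : 1 ≤ k)
    {lam : ℝ} {u p : ℝ → ℝ} (h : IsEigenfunction f k lam u p) :
    EqOn u (greenInt f k fun x => lam * u x) (Ioo (-1) 1) :=
  h.sol.eq_greenInt hf hk (h.cont.integrable_intervalMeasure.const_mul lam)
    (continuousOn_const.mul (h.cont.mono Ioo_subset_Icc_self)) h.cont h.neg_one h.one

theorem greenInt_const_mul (f : ℝ → ℝ) (k : ℕ) (g : ℝ → ℝ) (c x : ℝ) :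
    greenInt f k (fun y => c * g y) x = c * greenInt f k g x := by
  rw [greenInt, greenInt, ← MeasureTheory.integral_const_mul]
  refine integral_congr_ae (Eventually.of_forall fun y => ?_)
  ring

theorem IsEigenfunction.eq_mul_greenInt {f : ℝ → ℝ} (hf : IsProfile f) {k : ℕ} (hk : 1 ≤ k)
    {lam : ℝ} {u p : ℝ → ℝ} (h : IsEigenfunction f k lam u p) {x : ℝ} (hx : x ∈ Ioo (-1:ℝ) 1) :
    u x = lam * greenInt f k u x := by
  rw [h.eqOn_greenInt hf hk hx, greenInt_const_mul]

theorem ContinuousOn.integrable_sq {u : ℝ → ℝ} (hc : ContinuousOn u (Icc (-1) 1)) :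
    Integrable (fun x => u x ^ 2) intervalMeasure := (hc.pow 2).integrable_intervalMeasure

theorem integral_pos_of_continuousOn {g : ℝ → ℝ} (hi : Integrable g intervalMeasure)
    (hc : ContinuousOn g (Ioo (-1) 1)) (h0 : ∀ x ∈ Ioo (-1:ℝ) 1, 0 ≤ g x)
    (hne : ∃ x ∈ Ioo (-1:ℝ) 1, g x ≠ 0) : 0 < ∫ x, g x ∂intervalMeasure := by
  have h0' : 0 ≤ᵐ[intervalMeasure] g := by
    filter_upwards [ae_intervalMeasure_mem] with x hx using h0 x hx
  refine (integral_nonneg_of_ae h0').lt_of_ne fun h => ?_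
  obtain ⟨x, hx, hne⟩ := hne
  exact hne (eq_zero_of_ae_eq_zero hc ((integral_eq_zero_iff_of_nonneg_ae h0' hi).1 h.symm) x hx)

theorem ContinuousOn.integral_sq_pos {u : ℝ → ℝ} (hc : ContinuousOn u (Icc (-1) 1))
    (hne : ∃ x ∈ Ioo (-1:ℝ) 1, u x ≠ 0) : 0 < ∫ x, u x ^ 2 ∂intervalMeasure := by
  refine integral_pos_of_continuousOn hc.integrable_sq ((hc.mono Ioo_subset_Icc_self).pow 2)
    (fun x _ => sq_nonneg _) ?_
  obtain ⟨x, hx, h⟩ := hne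
  exact ⟨x, hx, pow_ne_zero 2 h⟩

theorem IsEigenfunction.pos {f : ℝ → ℝ} (hf : IsProfile f) {k : ℕ} (hk : 1 ≤ k)
    {lam : ℝ} {u p : ℝ → ℝ} (h : IsEigenfunction f k lam u p)
    (hne : ∃ x ∈ Ioo (-1:ℝ) 1, u x ≠ 0) : 0 < lam := by
  have hsq := h.cont.integral_sq_pos hne
  have hl : lam ≠ 0 := fun h0 => by
    obtain ⟨x, hx, hxne⟩ := hne
    exact hxne (by rw [h.eq_mul_greenInt hf hk hx, h0, zero_mul])
  have h1 := (hf.integral_greenInt_mul_self hk (h.cont.integrable_intervalMeasure.const_mul lam)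
    (continuousOn_const.mul (h.cont.mono Ioo_subset_Icc_self))).2
  have h2 : ∫ x, greenInt f k (fun x => lam * u x) x * (lam * u x) ∂intervalMeasure =
      lam * ∫ x, u x ^ 2 ∂intervalMeasure := by
    rw [← MeasureTheory.integral_const_mul]
    refine integral_congr_ae ?_
    filter_upwards [ae_intervalMeasure_mem] with x hx
    rw [← h.eqOn_greenInt hf hk hx]
    ring
  rw [h2] at h1
  have h3 : 0 ≤ lam * ∫ x, u x ^ 2 ∂intervalMeasure := by
    rw [← h1]
    refine integral_nonneg_of_ae ?_
    filter_upwards [ae_intervalMeasure_mem] with x hx using div_nonneg (sq_nonneg _) (hf.pos x hx).le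
  exact (nonneg_of_mul_nonneg_left h3 hsq).lt_of_ne' hl

/-- The solution operator of `L_k` on `L²(-1,1)`. -/
noncomputable def IsProfile.greenOp {f : ℝ → ℝ} (hf : IsProfile f) (k : ℕ) :
    Lp ℝ 2 intervalMeasure →L[ℝ] Lp ℝ 2 intervalMeasure :=
  kernelOp intervalMeasure (hf.isBddKernel_green k)

theorem IsProfile.greenOp_coeFn {f : ℝ → ℝ} (hf : IsProfile f) (k : ℕ)
    (e : Lp ℝ 2 intervalMeasure) : hf.greenOp k e =ᵐ[intervalMeasure] greenInt f k e :=
  kernelOp_coeFn _ e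

theorem greenInt_congr_ae (f : ℝ → ℝ) (k : ℕ) {g h : ℝ → ℝ} (H : g =ᵐ[intervalMeasure] h) (x : ℝ) :
    greenInt f k g x = greenInt f k h x := by
  refine integral_congr_ae ?_
  filter_upwards [H] with y hy
  rw [hy]

theorem IsEigenfunction.greenOp_toLp {f : ℝ → ℝ} (hf : IsProfile f) {k : ℕ} (hk : 1 ≤ k)
    {lam : ℝ} (hl : lam ≠ 0) {u p : ℝ → ℝ} (h : IsEigenfunction f k lam u p) :
    hf.greenOp k (h.cont.memLp_intervalMeasure.toLp u) =
      lam⁻¹ • h.cont.memLp_intervalMeasure.toLp u := by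
  refine Lp.ext ?_
  filter_upwards [hf.greenOp_coeFn k (h.cont.memLp_intervalMeasure.toLp u),
    Lp.coeFn_smul lam⁻¹ (h.cont.memLp_intervalMeasure.toLp u),
    h.cont.memLp_intervalMeasure.coeFn_toLp, ae_intervalMeasure_mem] with x h1 h2 h3 h4
  rw [h1, h2, Pi.smul_apply, h3, greenInt_congr_ae f k h.cont.memLp_intervalMeasure.coeFn_toLp,
    h.eq_mul_greenInt hf hk h4, smul_eq_mul, inv_mul_cancel_left₀ hl]

theorem IsProfile.exists_isEigenfunction_of_greenOp {f : ℝ → ℝ} (hf : IsProfile f) {k : ℕ}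
    (hk : 1 ≤ k) {κ : ℝ} (hκ : κ ≠ 0) {e : Lp ℝ 2 intervalMeasure} (he : hf.greenOp k e = κ • e) :
    ∃ u p, IsEigenfunction f k κ⁻¹ u p ∧ e =ᵐ[intervalMeasure] u := by
  set u : ℝ → ℝ := fun x => κ⁻¹ * greenInt f k e x with hu
  have hei := Lp.integrable_of_two e
  have hae : e =ᵐ[intervalMeasure] u := by
    filter_upwards [hf.greenOp_coeFn k e, Lp.coeFn_smul κ e] with x h1 h2
    rw [he, h2, Pi.smul_apply, smul_eq_mul] at h1
    rw [hu]
    simp only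
    rw [← h1, inv_mul_cancel_left₀ hκ]
  have huc : ContinuousOn u (Icc (-1) 1) := continuousOn_const.mul (hf.continuousOn_greenInt k hei)
  have hsol := (hf.isSolution_greenInt hk huc.integrable_intervalMeasure
    (huc.mono Ioo_subset_Icc_self)).const_mul κ⁻¹
  have heq : (fun x => κ⁻¹ * greenInt f k u x) = u := by
    ext x
    rw [hu, ← greenInt_congr_ae f k hae]
  rw [heq] at hsol
  refine ⟨u, _, ⟨huc, ?_, ?_, hsol⟩, hae⟩
  · simp only [hu]
    rw [greenInt_of_notMem f hk _ (by simp), mul_zero]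
  · simp only [hu]
    rw [greenInt_of_notMem f hk _ (by simp), mul_zero]

theorem exists_ne_zero_of_ae_eq {e : Lp ℝ 2 intervalMeasure} (he : e ≠ 0) {u : ℝ → ℝ}
    (h : e =ᵐ[intervalMeasure] u) : ∃ x ∈ Ioo (-1:ℝ) 1, u x ≠ 0 := by
  by_contra! hc
  refine he (Lp.ext ?_)
  filter_upwards [h, ae_intervalMeasure_mem, Lp.coeFn_zero ℝ 2 intervalMeasure] with x h1 h2 h3
  rw [h1, h3, hc x h2, Pi.zero_apply]

theorem MemLp.norm_toLp_sq {g : ℝ → ℝ} (hg : MemLp g 2 intervalMeasure) :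
    ‖hg.toLp g‖ ^ 2 = ∫ x, g x ^ 2 ∂intervalMeasure := by
  rw [← real_inner_self_eq_norm_sq, Lp.real_inner_toLp]
  simp only [sq]

/-- The bottom of the spectrum of `L_k` is an eigenvalue and is given by the Rayleigh quotient
of the inverse. -/
theorem IsProfile.exists_bottom_eigenvalue {f : ℝ → ℝ} (hf : IsProfile f) {k : ℕ} (hk : 1 ≤ k) :
    ∃ ν, 0 < ν ∧ InSpec f k ν ∧ ∀ g : ℝ → ℝ, ContinuousOn g (Icc (-1) 1) →
      ν * ∫ x, greenInt f k g x * g x ∂intervalMeasure ≤ ∫ x, g x ^ 2 ∂intervalMeasure := by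
  obtain ⟨κ, hκ, ⟨e, he0, he⟩, hmax⟩ := exists_top_eigenvalue (μ := intervalMeasure)
    (hf.isBddKernel_green k) (green_comm f k) (green_nonneg f k)
    (by filter_upwards [ae_intervalMeasure_mem] with x hx
        filter_upwards [ae_intervalMeasure_mem] with y hy
        exact green_pos f hk hx hy) intervalMeasure_ne_zero
  obtain ⟨u, p, hu, hae⟩ := hf.exists_isEigenfunction_of_greenOp hk hκ.ne' he
  refine ⟨κ⁻¹, inv_pos.2 hκ, hu.inSpec hf (exists_ne_zero_of_ae_eq he0 hae), fun g hg => ?_⟩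
  have h1 := hmax (hg.memLp_intervalMeasure.toLp g)
  rw [inner_kernelOp_toLp, MemLp.norm_toLp_sq] at h1
  rw [inv_mul_le_iff₀ hκ]
  exact h1

theorem IsEigenfunction.integral_greenInt_mul {f : ℝ → ℝ} (hf : IsProfile f) {k : ℕ} (hk : 1 ≤ k)
    {lam : ℝ} {u p : ℝ → ℝ} (h : IsEigenfunction f k lam u p) :
    lam * ∫ x, greenInt f k u x * u x ∂intervalMeasure = ∫ x, u x ^ 2 ∂intervalMeasure := by
  rw [← MeasureTheory.integral_const_mul]
  refine integral_congr_ae ?_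
  filter_upwards [ae_intervalMeasure_mem] with x hx
  rw [← mul_assoc, ← h.eq_mul_greenInt hf hk hx, sq]

theorem IsProfile.le_of_inSpec {f : ℝ → ℝ} (hf : IsProfile f) {k : ℕ} (hk : 1 ≤ k) {lam : ℝ}
    (h : InSpec f k lam) : (k:ℝ) ≤ lam := by
  obtain ⟨u, p, hu, hne⟩ := hf.exists_isEigenfunction hk h
  have hl := hu.pos hf hk hne
  have hi := hu.cont.integrable_intervalMeasure
  have hk0 : (0:ℝ) < k := by exact_mod_cast hk
  have hpos : 0 < ∫ x, |u x| ∂intervalMeasure :=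
    integral_pos_of_continuousOn hi.abs (hu.cont.mono Ioo_subset_Icc_self).abs
      (fun x _ => abs_nonneg _) (by simpa using hne)
  have hle : ∫ x, |u x| ∂intervalMeasure ≤
      ∫ _, lam * (1 / (2 * k) * ∫ y, |u y| ∂intervalMeasure) ∂intervalMeasure := by
    refine integral_mono_ae hi.abs (integrable_const _) ?_
    filter_upwards [ae_intervalMeasure_mem] with x hx
    rw [hu.eq_mul_greenInt hf hk hx, abs_mul, abs_of_pos hl]
    exact mul_le_mul_of_nonneg_left ((hf.isBddKernel_green k).abs_integral_le hi x) hl.le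
  rw [MeasureTheory.integral_const, intervalMeasure_real_univ, smul_eq_mul] at hle
  set S := ∫ x, |u x| ∂intervalMeasure
  have : 1 * S ≤ lam / k * S := by
    have e : 2 * (lam * (1 / (2 * k) * S)) = lam / k * S := by field_simp
    rw [one_mul, ← e]
    exact hle
  have := le_of_mul_le_mul_right this hpos
  rwa [le_div_iff₀ hk0, one_mul] at this

theorem green_succ_le (f : ℝ → ℝ) {k : ℕ} (hk : 1 ≤ k) (x y : ℝ) :
    green f (k + 1) x y ≤ k / (k + 1) * green f k x y := by
  have hk0 : (0:ℝ) < k := by exact_mod_cast hk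
  have h0 := minMaxRatio_nonneg (expCoord_nonneg f x) (expCoord_nonneg f y)
  have h1 := minMaxRatio_le_one (b := expCoord f y) (expCoord_nonneg f x)
  have h2 : minMaxRatio (expCoord f x) (expCoord f y) ^ (k + 1) ≤
      minMaxRatio (expCoord f x) (expCoord f y) ^ k := pow_le_pow_of_le_one h0 h1 (by omega)
  calc green f (k + 1) x y ≤ minMaxRatio (expCoord f x) (expCoord f y) ^ k / (2 * (k + 1 : ℕ)) :=
        div_le_div_of_nonneg_right h2 (by positivity)
    _ = _ := by rw [green]; push_cast; field_simp

theorem IsProfile.exists_inSpec_lt {f : ℝ → ℝ} (hf : IsProfile f) {k : ℕ} (hk : 1 ≤ k) {lam : ℝ}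
    (h : InSpec f (k + 1) lam) : ∃ ν, InSpec f k ν ∧ ν < lam := by
  obtain ⟨ν, hν, hspec, hmin⟩ := hf.exists_bottom_eigenvalue hk
  refine ⟨ν, hspec, ?_⟩
  obtain ⟨u, p, hu, hne⟩ := hf.exists_isEigenfunction (by omega) h
  have hl := hu.pos hf (by omega) hne
  have hk0 : (0:ℝ) < k := by exact_mod_cast hk
  have hi := hu.cont.integrable_intervalMeasure
  have hsq := hu.cont.integral_sq_pos hne
  have h1 := hmin (fun x => |u x|) hu.cont.abs
  simp only [sq_abs] at h1
  have h2 : ∫ x, u x ^ 2 ∂intervalMeasure ≤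
      lam * (k / (k + 1)) * ∫ x, greenInt f k (fun x => |u x|) x * |u x| ∂intervalMeasure := by
    rw [← MeasureTheory.integral_const_mul]
    refine integral_mono_ae hu.cont.integrable_sq
      ((hf.integrable_greenInt_mul k hi.abs hi.abs).const_mul _) ?_
    filter_upwards [ae_intervalMeasure_mem] with x hx
    have h3 : |u x| ≤ lam * (k / (k + 1) * greenInt f k (fun x => |u x|) x) := by
      conv_lhs => rw [hu.eq_mul_greenInt hf (by omega) hx, abs_mul, abs_of_pos hl]
      refine mul_le_mul_of_nonneg_left ?_ hl.le
      rw [greenInt, greenInt, ← Real.norm_eq_abs, ← MeasureTheory.integral_const_mul]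
      refine norm_integral_le_of_norm_le
        (((hf.isBddKernel_green k).integrable_mul hi.abs x).const_mul _)
        (Eventually.of_forall fun y => ?_)
      rw [norm_mul, Real.norm_of_nonneg (green_nonneg f _ x y), Real.norm_eq_abs, ← mul_assoc]
      exact mul_le_mul_of_nonneg_right (green_succ_le f hk x y) (abs_nonneg _)
    calc u x ^ 2 = |u x| * |u x| := by rw [← sq, sq_abs]
      _ ≤ lam * (k / (k + 1) * greenInt f k (fun x => |u x|) x) * |u x| :=
        mul_le_mul_of_nonneg_right h3 (abs_nonneg _)
      _ = _ := by ring
  set S := ∫ x, u x ^ 2 ∂intervalMeasure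
  set G := ∫ x, greenInt f k (fun x => |u x|) x * |u x| ∂intervalMeasure
  have hG : 0 < G := by
    have h0 : 0 < lam * (k / (k + 1)) := by positivity
    exact pos_of_mul_pos_right (hsq.trans_le h2) h0.le
  have h4 : ν * G ≤ lam * (k / (k + 1)) * G := h1.trans h2
  have h5 := le_of_mul_le_mul_right h4 hG
  have h6 : (k:ℝ) / (k + 1) < 1 := by rw [div_lt_one (by positivity)]; linarith
  nlinarith

theorem IsSolution.eq_zero_of_initial {f : ℝ → ℝ} (hf : IsProfile f) {k : ℕ} {lam : ℝ}
    {y p : ℝ → ℝ} (h : IsSolution f k (fun x => lam * y x) y p) {x₀ : ℝ}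
    (hx₀ : x₀ ∈ Ioo (-1:ℝ) 1) (hy : y x₀ = 0) (hp : p x₀ = 0) {x : ℝ} (hx : x ∈ Ioo (-1:ℝ) 1) :
    y x = 0 := by
  obtain ⟨a, ha1, ha2⟩ := exists_between (lt_min hx.1 hx₀.1)
  obtain ⟨b, hb1, hb2⟩ := exists_between (max_lt hx.2 hx₀.2)
  have hsub : Icc a b ⊆ Ioo (-1:ℝ) 1 := fun z hz => ⟨ha1.trans_le hz.1, hz.2.trans_lt hb2⟩
  have hinv : ContinuousOn (fun t => (f t)⁻¹) (Icc a b) :=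
    (hf.smoothOn.continuousOn.mono hsub).inv₀ fun t ht => hf.ne_zero (hsub ht)
  obtain ⟨C₁, hC₁⟩ := isCompact_Icc.exists_bound_of_continuousOn hinv
  obtain ⟨C₂, hC₂⟩ := isCompact_Icc.exists_bound_of_continuousOn
    ((continuousOn_const (c := (k:ℝ) ^ 2).mul hinv).sub (continuousOn_const (c := lam)))
  set K : NNReal := (max C₁ C₂).toNNReal with hK
  have hKle : max C₁ C₂ ≤ K := Real.le_coe_toNNReal _
  have hmem : ∀ z, z = x ∨ z = x₀ → z ∈ Ioo a b := by
    rintro z (rfl | rfl)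
    · exact ⟨ha2.trans_le (min_le_left _ _), (le_max_left _ _).trans_lt hb1⟩
    · exact ⟨ha2.trans_le (min_le_right _ _), (le_max_right _ _).trans_lt hb1⟩
  have key := ODE_solution_unique_of_mem_Ioo (E := ℝ × ℝ) (a := a) (b := b) (t₀ := x₀) (K := K)
    (v := fun t z => ((f t)⁻¹ * z.2, ((k:ℝ) ^ 2 * (f t)⁻¹ - lam) * z.1)) (s := fun _ => univ)
    (f := fun t => (y t, p t)) (g := fun _ => (0, 0)) ?_ (hmem x₀ (Or.inr rfl)) ?_ ?_
    (by simp [hy, hp])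
  · exact congrArg Prod.fst (key (hmem x (Or.inl rfl)))
  · intro t ht
    have ht' := Ioo_subset_Icc_self ht
    refine LipschitzOnWith.of_dist_le_mul fun z _ w _ => ?_
    rw [Prod.dist_eq]
    simp only [Real.dist_eq, ← mul_sub, abs_mul]
    have h1 : |z.1 - w.1| ≤ dist z w := by
      rw [Prod.dist_eq, ← Real.dist_eq]; exact le_max_left _ _
    have h2 : |z.2 - w.2| ≤ dist z w := by
      rw [Prod.dist_eq, ← Real.dist_eq (x := z.2)]; exact le_max_right _ _
    refine max_le ?_ ?_
    · exact mul_le_mul (((hC₁ t ht').trans (le_max_left _ _)).trans hKle) h2 (abs_nonneg _)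
        K.coe_nonneg
    · exact mul_le_mul (((hC₂ t ht').trans (le_max_right _ _)).trans hKle) h1 (abs_nonneg _)
        K.coe_nonneg
  · intro t ht
    have := h t (hsub (Ioo_subset_Icc_self ht))
    refine ⟨(this.1.congr_deriv ?_).prodMk (this.2.congr_deriv ?_), mem_univ _⟩
    · simp only; ring
    · simp only; ring
  · intro t _
    refine ⟨?_, mem_univ _⟩
    simp only [mul_zero]
    exact hasDerivAt_const t _

theorem IsEigenfunction.flux_bounded {f : ℝ → ℝ} (hf : IsProfile f) {k : ℕ} (hk : 1 ≤ k)
    {lam : ℝ} {u p : ℝ → ℝ} (h : IsEigenfunction f k lam u p) :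
    ∃ C, ∀ x ∈ Ioo (-1:ℝ) 1, |p x| ≤ C := by
  have hi := h.cont.integrable_intervalMeasure.const_mul lam
  have hc : ContinuousOn (fun x => lam * u x) (Ioo (-1) 1) :=
    continuousOn_const.mul (h.cont.mono Ioo_subset_Icc_self)
  refine ⟨∫ x, |lam * u x| ∂intervalMeasure, fun x hx => ?_⟩
  have h1 : HasDerivAt u _ x := (hf.hasDerivAt_greenInt hk hi hc hx).congr_of_eventuallyEq (by
    filter_upwards [isOpen_Ioo.mem_nhds hx] with z hz using h.eqOn_greenInt hf hk hz)
  have h2 := (div_left_inj' (hf.ne_zero hx)).1 (h1.unique (h.sol x hx).1)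
  rw [← h2, abs_div, abs_two]
  have h3 := hf.abs_upInt_le hk hi hx
  have h4 := hf.abs_lowInt_le k hi hx
  have h5 := abs_sub (upInt f k (fun x => lam * u x) x) (lowInt f k (fun x => lam * u x) x)
  linarith

/-- Eigenspaces of `L_k` are one-dimensional. -/
theorem IsEigenfunction.exists_eq_mul {f : ℝ → ℝ} (hf : IsProfile f) {k : ℕ} (hk : 1 ≤ k)
    {lam : ℝ} {u p w q : ℝ → ℝ} (hu : IsEigenfunction f k lam u p)
    (hw : IsEigenfunction f k lam w q) (hne : ∃ x ∈ Ioo (-1:ℝ) 1, u x ≠ 0) :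
    ∃ c, ∀ x ∈ Ioo (-1:ℝ) 1, w x = c * u x := by
  obtain ⟨x₀, hx₀, hux₀⟩ := hne
  obtain ⟨C, hC⟩ := hu.flux_bounded hf hk
  obtain ⟨D, hD⟩ := hw.flux_bounded hf hk
  have hW : ∀ x ∈ Ioo (-1:ℝ) 1, HasDerivAt (fun x => p x * w x - u x * q x) 0 x := fun x hx => by
    refine (((hu.sol x hx).2.mul (hw.sol x hx).1).sub
      ((hu.sol x hx).1.mul (hw.sol x hx).2)).congr_deriv ?_
    ring
  have hlim : ∀ {v : ℝ → ℝ}, ContinuousOn v (Icc (-1) 1) → v 1 = 0 →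
      Tendsto (fun x => |v x|) (nhdsWithin 1 (Ioo (-1) 1)) (nhds 0) := by
    intro v hv h1
    have := (hv 1 (by simp)).mono Ioo_subset_Icc_self
    rw [ContinuousWithinAt, h1] at this
    simpa using this.abs
  have hW0 : p x₀ * w x₀ - u x₀ * q x₀ = 0 := by
    have t1 : Tendsto (fun x => p x * w x - u x * q x) (nhdsWithin 1 (Ioo (-1) 1)) (nhds 0) := by
      refine squeeze_zero_norm' (a := fun x => C * |w x| + |u x| * D) ?_ ?_
      · filter_upwards [self_mem_nhdsWithin] with x hx
        rw [Real.norm_eq_abs]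
        refine (abs_sub _ _).trans ?_
        rw [abs_mul, abs_mul]
        exact add_le_add (mul_le_mul_of_nonneg_right (hC x hx) (abs_nonneg _))
          (mul_le_mul_of_nonneg_left (hD x hx) (abs_nonneg _))
      · simpa using ((hlim hw.cont hw.one).const_mul C).add ((hlim hu.cont hu.one).mul_const D)
    refine tendsto_nhds_unique (tendsto_const_nhds.congr' ?_) t1
    filter_upwards [self_mem_nhdsWithin] with x hx
    exact eq_of_hasDerivAt_zero_Ioo hW hx₀ hx
  set c := w x₀ / u x₀
  have hz := hw.sol.sub (hu.sol.const_mul c)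
  have hz' : IsSolution f k (fun x => lam * (w x - c * u x)) (fun x => w x - c * u x)
      (fun x => q x - c * p x) := by
    convert hz using 2
    ring
  refine ⟨c, fun x hx => sub_eq_zero.1 (hz'.eq_zero_of_initial hf hx₀ ?_ ?_ hx)⟩
  · simp only [c]; field_simp; ring
  · simp only [c]; field_simp; linarith

theorem IsProfile.isSymmetric_greenOp {f : ℝ → ℝ} (hf : IsProfile f) (k : ℕ) :
    (hf.greenOp k).IsSymmetric := isSymmetric_kernelOp _ (green_comm f k)

theorem IsProfile.isCompactOperator_greenOp {f : ℝ → ℝ} (hf : IsProfile f) (k : ℕ) :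
    IsCompactOperator (hf.greenOp k) := isCompactOperator_kernelOp _

theorem IsProfile.greenOp_injective {f : ℝ → ℝ} (hf : IsProfile f) {k : ℕ} (hk : 1 ≤ k)
    {e : Lp ℝ 2 intervalMeasure} (he : hf.greenOp k e = 0) : e = 0 := by
  have hei := Lp.integrable_of_two e
  have key : ∀ᵐ x ∂volume, x ∈ Ioo (-1:ℝ) 1 → e x = 0 := by
    refine isOpen_Ioo.ae_eq_zero_of_integral_contDiff_smul_eq_zero
      (IntegrableOn.locallyIntegrableOn hei) fun ψ hψ hcs hsupp => ?_
    set h : ℝ → ℝ := fun x => (k:ℝ) ^ 2 / f x * ψ x - deriv (fun y => f y * deriv ψ y) x with hh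
    have hdψ : ContDiff ℝ (⊤ : ℕ∞) (deriv ψ) := hψ.iterate_deriv 1
    have hp : ContDiffOn ℝ (⊤ : ℕ∞) (fun y => f y * deriv ψ y) (Ioo (-1) 1) :=
      hf.smoothOn.mul hdψ.contDiffOn
    have hhc : ContinuousOn h (Ioo (-1) 1) :=
      ((continuousOn_const.div hf.smoothOn.continuousOn fun x hx => hf.ne_zero hx).mul
        hψ.continuous.continuousOn).sub
        (hp.deriv_of_isOpen (m := 0) isOpen_Ioo (by norm_num)).continuousOn
    obtain ⟨C, hC⟩ := hcs.isCompact.exists_bound_of_continuousOn (hhc.mono hsupp)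
    have hmem : MemLp h 2 intervalMeasure := by
      refine MemLp.of_bound (hhc.aestronglyMeasurable measurableSet_Ioo) (max C 0)
        (Eventually.of_forall fun x => ?_)
      by_cases hx : x ∈ tsupport ψ
      · exact (hC x hx).trans (le_max_left _ _)
      · have h1 : ψ =ᶠ[nhds x] 0 := notMem_tsupport_iff_eventuallyEq.1 hx
        have h2 : (fun y => f y * deriv ψ y) =ᶠ[nhds x] fun _ => 0 := by
          filter_upwards [h1.eventuallyEq_nhds] with z hz
          rw [hz.deriv_eq]
          simp
        have : h x = 0 := by
          simp only [hh]
          rw [h2.deriv_eq, h1.eq_of_nhds]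
          simp
        rw [this]
        simp
    have hsol : IsSolution f k h ψ (fun y => f y * deriv ψ y) := fun x hx => by
      refine ⟨?_, ?_⟩
      · rw [mul_div_cancel_left₀ _ (hf.ne_zero hx)]
        exact (hψ.differentiable (by norm_num) x).hasDerivAt
      · have h1 := ((hp.contDiffAt (isOpen_Ioo.mem_nhds hx)).differentiableAt (by norm_num)).hasDerivAt
        refine h1.congr_deriv ?_
        simp only [hh]
        ring
    have hzero : ∀ x, x ∉ Ioo (-1:ℝ) 1 → ψ x = 0 := fun x hx =>
      image_eq_zero_of_notMem_tsupport fun h => hx (hsupp h)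
    have heq := hsol.eq_greenInt hf hk (hmem.integrable (by norm_num)) hhc hψ.continuous.continuousOn
      (hzero _ (by simp)) (hzero _ (by simp))
    have hsym := hf.isSymmetric_greenOp k (hmem.toLp h) e
    change inner ℝ (hf.greenOp k _) _ = inner ℝ _ (hf.greenOp k e) at hsym
    rw [he, inner_zero_right, Lp.real_inner_eq] at hsym
    rw [← setIntegral_eq_integral_of_forall_compl_eq_zero (s := Ioo (-1:ℝ) 1)
      (fun x hx => by rw [hzero x hx, zero_smul]), ← hsym]
    refine integral_congr_ae ?_
    filter_upwards [ae_intervalMeasure_mem, hf.greenOp_coeFn k (hmem.toLp h)] with x hx h1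
    rw [h1, greenInt_congr_ae f k hmem.coeFn_toLp, heq hx, smul_eq_mul]
  refine Lp.ext ?_
  filter_upwards [(ae_restrict_iff' measurableSet_Ioo).2 key, Lp.coeFn_zero ℝ 2 intervalMeasure]
    with x h1 h2
  rw [h1, h2, Pi.zero_apply]

/-- The one-sided kernel whose integral operator is a square root of the Green operator. -/
noncomputable def lowKernel (f : ℝ → ℝ) (k : ℕ) (x : ℝ) : ℝ → ℝ :=
  (Iic x).indicator fun t => minMaxRatio (expCoord f x) (expCoord f t) ^ k

theorem IsProfile.memLp_lowKernel {f : ℝ → ℝ} (hf : IsProfile f) (k : ℕ) (x : ℝ) :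
    MemLp (lowKernel f k x) 2 intervalMeasure := by
  refine MemLp.of_bound (C := 1) ?_ (Eventually.of_forall fun t => ?_)
  · refine Measurable.aestronglyMeasurable (Measurable.indicator ?_ measurableSet_Iic)
    exact ((measurable_const.min hf.measurable_expCoord).mul
      (measurable_const.max hf.measurable_expCoord).inv).pow_const k
  · have h0 := minMaxRatio_nonneg (expCoord_nonneg f x) (expCoord_nonneg f t)
    rw [lowKernel, indicator_apply]
    split_ifs
    · rw [Real.norm_of_nonneg (pow_nonneg h0 k)]
      exact pow_le_one₀ h0 (minMaxRatio_le_one (expCoord_nonneg f x))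
    · simp

theorem IsProfile.lowInt_eq_integral {f : ℝ → ℝ} (hf : IsProfile f) (k : ℕ) (g : ℝ → ℝ)
    {x : ℝ} (hx : x ∈ Ioo (-1:ℝ) 1) :
    lowInt f k g x = ∫ t, lowKernel f k x t * g t ∂intervalMeasure := by
  have h : (fun t => lowKernel f k x t * g t) =
      (Iic x).indicator fun t => minMaxRatio (expCoord f x) (expCoord f t) ^ k * g t := by
    ext t
    simp only [lowKernel, indicator_apply]
    split_ifs <;> simp
  have hs : Ioo (-1:ℝ) 1 ∩ Iic x = Ioc (-1) x := by
    ext t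
    simp only [mem_inter_iff, mem_Ioo, mem_Iic, mem_Ioc]
    exact ⟨fun h => ⟨h.1.1, h.2⟩, fun h => ⟨⟨h.1, h.2.trans_lt hx.2⟩, h.2⟩⟩
  rw [h, setIntegral_indicator measurableSet_Iic, hs, hf.lowInt_eq k g hx,
    intervalIntegral.integral_of_le hx.1.le]

theorem lowKernel_mul_self (f : ℝ → ℝ) (k : ℕ) (x t : ℝ) :
    lowKernel f k x t * lowKernel f k x t = lowKernel f (2 * k) x t * 1 := by
  simp only [lowKernel, indicator_apply]
  split_ifs
  · ring
  · simp

theorem IsProfile.lowInt_nonneg {f : ℝ → ℝ} (hf : IsProfile f) (k : ℕ) {g : ℝ → ℝ}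
    (hg : ∀ t, 0 ≤ g t) {x : ℝ} (hx : x ∈ Ioo (-1:ℝ) 1) : 0 ≤ lowInt f k g x := by
  rw [hf.lowInt_eq k g hx]
  refine intervalIntegral.integral_nonneg hx.1.le fun t _ => ?_
  exact mul_nonneg (pow_nonneg (minMaxRatio_nonneg (expCoord_nonneg f x) (expCoord_nonneg f t)) k)
    (hg t)

theorem IsProfile.upInt_nonneg {f : ℝ → ℝ} (hf : IsProfile f) {k : ℕ} (hk : 1 ≤ k) {g : ℝ → ℝ}
    (hg : ∀ t, 0 ≤ g t) {x : ℝ} (hx : x ∈ Ioo (-1:ℝ) 1) : 0 ≤ upInt f k g x := by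
  rw [hf.upInt_eq hk g hx]
  refine intervalIntegral.integral_nonneg hx.2.le fun t _ => ?_
  exact mul_nonneg (pow_nonneg (minMaxRatio_nonneg (expCoord_nonneg f x) (expCoord_nonneg f t)) k)
    (hg t)

/-- If `g ≥ 0`, then `lowInt f k g` tends to zero wherever the Green integral does. -/
theorem IsProfile.tendsto_lowInt {f : ℝ → ℝ} (hf : IsProfile f) {k : ℕ} (hk : 1 ≤ k) {g : ℝ → ℝ}
    (hgi : Integrable g intervalMeasure) (hg : ∀ t, 0 ≤ g t) {l : Filter ℝ}
    (hl : Ioo (-1:ℝ) 1 ∈ l) (h : Tendsto (greenInt f k g) l (nhds 0)) :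
    Tendsto (lowInt f k g) l (nhds 0) := by
  have hk0 : (k:ℝ) ≠ 0 := by positivity
  refine squeeze_zero' (g := fun x => 2 * k * greenInt f k g x) ?_ ?_ (by simpa using h.const_mul (2 * (k:ℝ)))
  · filter_upwards [hl] with x hx using hf.lowInt_nonneg k hg hx
  · filter_upwards [hl] with x hx
    have := hf.upInt_nonneg hk hg hx
    rw [hf.greenInt_eq hk hgi hx]
    field_simp
    linarith

/-- The trace of the Green operator, computed on the diagonal. -/
theorem IsProfile.integral_lowInt_one_div {f : ℝ → ℝ} (hf : IsProfile f) {k : ℕ} (hk : 1 ≤ k) :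
    Integrable (fun x => lowInt f (2 * k) (fun _ => 1) x / f x) intervalMeasure ∧
      ∫ x, lowInt f (2 * k) (fun _ => 1) x / f x ∂intervalMeasure = (k:ℝ)⁻¹ := by
  have hk2 : 1 ≤ 2 * k := by omega
  have hk0 : (k:ℝ) ≠ 0 := by positivity
  have hi : Integrable (fun _ : ℝ => (1:ℝ)) intervalMeasure := integrable_const 1
  have key := integrable_and_integral_of_hasDerivAt (F := lowInt f (2 * k) fun _ => 1)
    (G₁ := fun _ => 1) (G₂ := fun x => 2 * k * (lowInt f (2 * k) (fun _ => 1) x / f x)) hi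
    continuousOn_const
    (fun x hx => mul_nonneg (by positivity)
      (div_nonneg (hf.lowInt_nonneg _ (fun _ => zero_le_one) hx) (hf.pos x hx).le))
    (fun x hx => by
      refine (hf.hasDerivAt_lowInt (2 * k) hi continuousOn_const hx).congr_deriv ?_
      push_cast
      ring)
    (hf.tendsto_lowInt hk2 hi (fun _ => zero_le_one) self_mem_nhdsWithin
      ((hf.tendsto_greenInt_neg_one hk2 hi).mono_left nhdsGT_neg_one_le))
    (hf.tendsto_lowInt hk2 hi (fun _ => zero_le_one) self_mem_nhdsWithin
      ((hf.tendsto_greenInt_one hk2 hi).mono_left nhdsLT_one_le))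
  refine ⟨(integrable_const_mul_iff (Ne.isUnit (by positivity)) _).1 key.1, ?_⟩
  have h2 := key.2
  rw [MeasureTheory.integral_const_mul, MeasureTheory.integral_const, intervalMeasure_real_univ] at h2
  simp only [smul_eq_mul, mul_one, add_zero, sub_zero] at h2
  field_simp
  linarith

/-- A normalized eigenfunction for every eigenvalue. -/
theorem IsProfile.exists_normalized {f : ℝ → ℝ} (hf : IsProfile f) {k : ℕ} (hk : 1 ≤ k)
    {lam : ℝ} (h : InSpec f k lam) :
    ∃ u p, IsEigenfunction f k lam u p ∧ ∫ x, u x ^ 2 ∂intervalMeasure = 1 := by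
  obtain ⟨u, p, hu, hne⟩ := hf.exists_isEigenfunction hk h
  have hpos := hu.cont.integral_sq_pos hne
  set c : ℝ := (√(∫ x, u x ^ 2 ∂intervalMeasure))⁻¹ with hc
  refine ⟨fun x => c * u x, fun x => c * p x, ⟨continuousOn_const.mul hu.cont, by simp [hu.neg_one],
    by simp [hu.one], ?_⟩, ?_⟩
  · convert hu.sol.const_mul c using 2
    ring
  · simp only [mul_pow]
    rw [MeasureTheory.integral_const_mul, hc, inv_pow, Real.sq_sqrt hpos.le, inv_mul_cancel₀ hpos.ne']

/-- Normalized eigenfunctions of `L_k` form a Hilbert basis. -/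
theorem IsProfile.exists_hilbertBasis {f : ℝ → ℝ} (hf : IsProfile f) {k : ℕ} (hk : 1 ≤ k) :
    ∃ (b : HilbertBasis (Spec f k) ℝ (Lp ℝ 2 intervalMeasure)) (u p : Spec f k → ℝ → ℝ),
      (∀ s : Spec f k, IsEigenfunction f k s (u s) (p s)) ∧ (∀ s, ∫ x, u s x ^ 2 ∂intervalMeasure = 1) ∧
      ∀ s, b s =ᵐ[intervalMeasure] u s := by
  choose u p hu hn using fun s : Spec f k => hf.exists_normalized hk s.2
  have hne : ∀ s, ∃ x ∈ Ioo (-1:ℝ) 1, u s x ≠ 0 := fun s => by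
    by_contra! hc
    have : ∫ x, u s x ^ 2 ∂intervalMeasure = 0 := by
      refine integral_eq_zero_of_ae ?_
      filter_upwards [ae_intervalMeasure_mem] with x hx
      simp [hc x hx]
    linarith [hn s]
  have hpos : ∀ s : Spec f k, 0 < (s:ℝ) := fun s => (hu s).pos hf hk (hne s)
  set v : Spec f k → Lp ℝ 2 intervalMeasure := fun s => (hu s).cont.memLp_intervalMeasure.toLp (u s)
    with hv
  have hKv : ∀ s, hf.greenOp k (v s) = (s:ℝ)⁻¹ • v s := fun s =>
    (hu s).greenOp_toLp hf hk (hpos s).ne'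
  have hon : Orthonormal ℝ v := by
    refine ⟨fun s => ?_, fun s t hst => ?_⟩
    · have := MemLp.norm_toLp_sq (hu s).cont.memLp_intervalMeasure
      rw [hn s] at this
      exact (pow_eq_one_iff_of_nonneg (norm_nonneg _) two_ne_zero).1 this
    · have h1 : inner ℝ (hf.greenOp k (v s)) (v t) = inner ℝ (v s) (hf.greenOp k (v t)) :=
        hf.isSymmetric_greenOp k (v s) (v t)
      rw [hKv, hKv, real_inner_smul_left, real_inner_smul_right] at h1
      by_contra h0
      exact hst (Subtype.ext (inv_injective (mul_right_cancel₀ h0 h1)))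
  have hsp : (Submodule.span ℝ (range v))ᗮ = ⊥ := by
    rw [eq_bot_iff, ← ContinuousLinearMap.orthogonalComplement_iSup_eigenspaces_eq_bot
      (hf.isCompactOperator_greenOp k) (hf.isSymmetric_greenOp k)]
    refine Submodule.orthogonal_le (iSup_le fun κ e he => ?_)
    have he' : hf.greenOp k e = κ • e := Module.End.mem_eigenspace_iff.1 he
    by_cases he0 : e = 0
    · rw [he0]; exact Submodule.zero_mem _
    have hκ : κ ≠ 0 := fun h => he0 (hf.greenOp_injective hk (by rw [he', h, zero_smul]))
    obtain ⟨w, q, hw, hew⟩ := hf.exists_isEigenfunction_of_greenOp hk hκ he'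
    have hs : κ⁻¹ ∈ Spec f k := hw.inSpec hf (exists_ne_zero_of_ae_eq he0 hew)
    obtain ⟨c, hc⟩ := IsEigenfunction.exists_eq_mul hf hk (hu ⟨κ⁻¹, hs⟩) hw (hne _)
    have : e = c • v ⟨κ⁻¹, hs⟩ := by
      refine Lp.ext ?_
      filter_upwards [hew, ae_intervalMeasure_mem, Lp.coeFn_smul c (v ⟨κ⁻¹, hs⟩),
        (hu ⟨κ⁻¹, hs⟩).cont.memLp_intervalMeasure.coeFn_toLp] with x h1 h2 h3 h4
      rw [h1, h3, hc x h2, Pi.smul_apply, hv, h4, smul_eq_mul]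
    rw [this]
    exact Submodule.smul_mem _ _ (Submodule.subset_span (mem_range_self _))
  refine ⟨HilbertBasis.mkOfOrthogonalEqBot hon hsp, u, p, hu, hn, fun s => ?_⟩
  rw [HilbertBasis.coe_mkOfOrthogonalEqBot]
  exact (hu s).cont.memLp_intervalMeasure.coeFn_toLp

/-- The trace formula `∑ 1/λ = 1/k` over the spectrum of `L_k`. -/
theorem IsProfile.hasSum_inv_spec {f : ℝ → ℝ} (hf : IsProfile f) {k : ℕ} (hk : 1 ≤ k)
    (hcount : (Spec f k).Countable) : HasSum (fun s : Spec f k => (s:ℝ)⁻¹) (k:ℝ)⁻¹ := by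
  obtain ⟨b, u, p, hu, hn, hb⟩ := hf.exists_hilbertBasis hk
  have : Countable (Spec f k) := hcount.to_subtype
  have hui : ∀ s, Integrable (u s) intervalMeasure := fun s => (hu s).cont.integrable_intervalMeasure
  have huc : ∀ s, ContinuousOn (u s) (Ioo (-1) 1) := fun s => (hu s).cont.mono Ioo_subset_Icc_self
  have hlow : ∀ s, ∫ x, lowInt f k (u s) x ^ 2 / f x ∂intervalMeasure = (s:ℝ)⁻¹ := fun s => by
    rw [(hf.integral_greenInt_mul_self hk (hui s) (huc s)).2]
    have h1 := (hu s).integral_greenInt_mul hf hk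
    rw [hn s] at h1
    exact eq_inv_of_mul_eq_one_right h1
  have hsum : ∀ x ∈ Ioo (-1:ℝ) 1, HasSum (fun s => lowInt f k (u s) x ^ 2 / f x)
      (lowInt f (2 * k) (fun _ => 1) x / f x) := fun x hx => by
    refine HasSum.div_const ?_ _
    have h1 := b.hasSum_inner_mul_inner ((hf.memLp_lowKernel k x).toLp _)
      ((hf.memLp_lowKernel k x).toLp _)
    rw [Lp.real_inner_toLp] at h1
    have h2 : ∀ s, inner ℝ ((hf.memLp_lowKernel k x).toLp _) (b s) = lowInt f k (u s) x := fun s => by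
      rw [Lp.real_inner_eq, hf.lowInt_eq_integral k _ hx]
      refine integral_congr_ae ?_
      filter_upwards [hb s, (hf.memLp_lowKernel k x).coeFn_toLp] with t h3 h4
      rw [h3, h4]
    simp only [lowKernel_mul_self] at h1
    rw [hf.lowInt_eq_integral (2 * k) _ hx]
    convert h1 using 2 with s
    rw [real_inner_comm _ (b s), h2, sq]
  have hfin := hf.integral_lowInt_one_div hk
  have key := MeasureTheory.hasSum_integral_of_dominated_convergence (μ := intervalMeasure)
    (F := fun (s : Spec f k) x => lowInt f k (u s) x ^ 2 / f x)
    (f := fun x => lowInt f (2 * k) (fun _ => 1) x / f x)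
    (fun (s : Spec f k) x => lowInt f k (u s) x ^ 2 / f x)
    (fun s => (hf.integral_greenInt_mul_self hk (hui s) (huc s)).1.aestronglyMeasurable)
    (fun s => by
      filter_upwards [ae_intervalMeasure_mem] with x hx
      rw [Real.norm_of_nonneg (div_nonneg (sq_nonneg _) (hf.pos x hx).le)])
    (by filter_upwards [ae_intervalMeasure_mem] with x hx using (hsum x hx).summable)
    (hfin.1.congr (by filter_upwards [ae_intervalMeasure_mem] with x hx using (hsum x hx).tsum_eq.symm))
    (by filter_upwards [ae_intervalMeasure_mem] with x hx using hsum x hx)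
  rw [hfin.2] at key
  simpa only [hlow] using key

theorem IsProfile.finite_setOf_mem_spec {f : ℝ → ℝ} (hf : IsProfile f) (lam : ℝ) :
    {k : ℕ | 1 ≤ k ∧ lam ∈ Spec f k}.Finite := by
  refine (Set.finite_Iic ⌊lam⌋₊).subset fun k hk => ?_
  exact Nat.le_floor (hf.le_of_inSpec hk.1 hk.2)

/-- The multiplicities `2m+1` force `Λ m` to lie in exactly the spectra of `L_0, …, L_m`. -/
theorem IsProfile.mem_spec_iff_of_multiplicity {f : ℝ → ℝ} (hf : IsProfile f) {Λ : ℕ → ℝ}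
    (hmono : StrictMono Λ) (hrange : range Λ = Eigs f)
    (h : ∀ m : ℕ, 2 * ({k : ℕ | 1 ≤ k ∧ Λ m ∈ Spec f k}).ncard
          + (if Λ m ∈ Spec f 0 then 1 else 0) = 2 * m + 1) {k : ℕ} (hk : 1 ≤ k) (m : ℕ) :
    Λ m ∈ Spec f k ↔ k ≤ m := by
  have hcard : ∀ m, ({k : ℕ | 1 ≤ k ∧ Λ m ∈ Spec f k}).ncard = m := fun m => by
    have := h m
    split_ifs at this <;> omega
  have hle : ∀ k, 1 ≤ k → ∀ m, Λ m ∈ Spec f k → k ≤ m := fun k hk => by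
    induction k, hk using Nat.le_induction with
    | base =>
      intro m hm
      by_contra! hlt
      obtain rfl : m = 0 := by omega
      have he := (Set.ncard_eq_zero (hf.finite_setOf_mem_spec _)).1 (hcard 0)
      exact (he ▸ (⟨le_rfl, hm⟩ : 1 ∈ {k : ℕ | 1 ≤ k ∧ Λ 0 ∈ Spec f k}) : 1 ∈ (∅ : Set ℕ))
    | succ k hk ih =>
      intro m hm
      obtain ⟨ν, hν, hlt⟩ := hf.exists_inSpec_lt hk hm
      obtain ⟨m', rfl⟩ : ν ∈ range Λ := hrange ▸ mem_iUnion.2 ⟨k, hν⟩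
      have := ih m' hν
      have := hmono.lt_iff_lt.1 hlt
      omega
  refine ⟨hle k hk m, fun hkm => ?_⟩
  have hsub : {k : ℕ | 1 ≤ k ∧ Λ m ∈ Spec f k} ⊆ Icc 1 m := fun j hj => ⟨hj.1, hle j hj.1 m hj.2⟩
  have heq := Set.eq_of_subset_of_ncard_le hsub (by
    rw [hcard m, Set.ncard_eq_toFinset_card']
    simp) (Set.finite_Icc 1 m)
  exact (heq.symm ▸ (⟨hk, hkm⟩ : k ∈ Icc 1 m) : k ∈ {k : ℕ | 1 ≤ k ∧ Λ m ∈ Spec f k}).2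

theorem IsProfile.hasSum_inv_of_multiplicity {f : ℝ → ℝ} (hf : IsProfile f) {Λ : ℕ → ℝ}
    (hmono : StrictMono Λ) (hrange : range Λ = Eigs f)
    (h : ∀ m : ℕ, 2 * ({k : ℕ | 1 ≤ k ∧ Λ m ∈ Spec f k}).ncard
          + (if Λ m ∈ Spec f 0 then 1 else 0) = 2 * m + 1) {k : ℕ} (hk : 1 ≤ k) :
    HasSum (fun m => (Λ (m + k))⁻¹) (k:ℝ)⁻¹ := by
  have hS : Spec f k = range fun m => Λ (m + k) := by
    ext lam
    refine ⟨fun hlam => ?_, ?_⟩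
    · obtain ⟨m, rfl⟩ : lam ∈ range Λ := hrange ▸ mem_iUnion.2 ⟨k, hlam⟩
      exact ⟨m - k, by
        dsimp only
        rw [Nat.sub_add_cancel ((hf.mem_spec_iff_of_multiplicity hmono hrange h hk m).1 hlam)]⟩
    · rintro ⟨m, rfl⟩
      exact (hf.mem_spec_iff_of_multiplicity hmono hrange h hk _).2 (Nat.le_add_left k m)
  have key := hf.hasSum_inv_spec hk (hS ▸ countable_range _)
  have hinj : Function.Injective fun m => Λ (m + k) := fun a b hab =>
    Nat.add_right_cancel (hmono.injective hab)
  rw [hS] at key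
  exact hinj.hasSum_range_iff.1 key

theorem IsProfile.enum_one_of_multiplicity {f : ℝ → ℝ} (hf : IsProfile f) {Λ : ℕ → ℝ}
    (hmono : StrictMono Λ) (hrange : range Λ = Eigs f)
    (h : ∀ m : ℕ, 2 * ({k : ℕ | 1 ≤ k ∧ Λ m ∈ Spec f k}).ncard
          + (if Λ m ∈ Spec f 0 then 1 else 0) = 2 * m + 1) : Λ 1 = 2 := by
  have h1 := (hasSum_nat_add_iff' 1).2 (hf.hasSum_inv_of_multiplicity hmono hrange h le_rfl)
  have h2 := hf.hasSum_inv_of_multiplicity hmono hrange h one_le_two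
  simp only [Finset.sum_range_one, zero_add, add_assoc, one_add_one_eq_two] at h1
  have h3 := h1.unique h2
  have h4 : (Λ 1)⁻¹ = 2⁻¹ := by push_cast at h3; linarith
  exact inv_injective h4

theorem continuousOn_primitive_Icc {g : ℝ → ℝ} (hg : Integrable g intervalMeasure) :
    ContinuousOn (fun x => ∫ t in (-1:ℝ)..x, g t) (Icc (-1) 1) := by
  have := intervalIntegral.continuousOn_primitive_interval (a := (-1:ℝ)) (b := 1) (f := g)
    (μ := volume) (by
      rw [uIcc_of_le (by norm_num)]
      exact (intervalIntegrable_iff_integrableOn_Icc_of_le (by norm_num)).1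
        (integrable_intervalMeasure_iff.1 hg))
  rwa [uIcc_of_le (by norm_num)] at this

theorem hasDerivAt_primitive_Ioo {g : ℝ → ℝ} (hg : Integrable g intervalMeasure)
    (hgc : ContinuousOn g (Ioo (-1) 1)) {x : ℝ} (hx : x ∈ Ioo (-1:ℝ) 1) :
    HasDerivAt (fun x => ∫ t in (-1:ℝ)..x, g t) (g x) x :=
  integral_hasDerivAt_right (intervalIntegrable_sub hg (by simp) (Ioo_subset_Icc_self hx))
    (hgc.stronglyMeasurableAtFilter isOpen_Ioo x hx) (hgc.continuousAt (isOpen_Ioo.mem_nhds hx))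

theorem integral_of_hasDerivAt_of_tendsto {F G : ℝ → ℝ} {a b : ℝ} (hG : Integrable G intervalMeasure)
    (hF : ∀ x ∈ Ioo (-1:ℝ) 1, HasDerivAt F (G x) x)
    (ha : Tendsto F (nhdsWithin (-1) (Ioo (-1) 1)) (nhds a))
    (hb : Tendsto F (nhdsWithin 1 (Ioo (-1) 1)) (nhds b)) :
    ∫ x, G x ∂intervalMeasure = b - a := by
  rw [nhdsWithin_Ioo_eq_nhdsGT (by norm_num)] at ha
  rw [nhdsWithin_Ioo_eq_nhdsLT (by norm_num)] at hb
  rw [integral_intervalMeasure]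
  exact intervalIntegral.integral_eq_sub_of_hasDerivAt_of_tendsto (by norm_num) hF
    (integrable_intervalMeasure_iff.1 hG) ha hb

/-- The Dirichlet Green kernel of `-d²/dx²` on `(-1,1)`. -/
noncomputable def dirGreen (x y : ℝ) : ℝ := (1 + min x y) * (1 - max x y) / 2

theorem dirGreen_comm (x y : ℝ) : dirGreen x y = dirGreen y x := by
  rw [dirGreen, dirGreen, min_comm, max_comm]

theorem dirGreen_pos {x y : ℝ} (hx : x ∈ Ioo (-1:ℝ) 1) (hy : y ∈ Ioo (-1:ℝ) 1) :
    0 < dirGreen x y := by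
  have h1 : -1 < min x y := lt_min hx.1 hy.1
  have h2 : max x y < 1 := max_lt hx.2 hy.2
  exact div_pos (mul_pos (by linarith) (by linarith)) two_pos

theorem dirGreen_sq_le {x y : ℝ} (hx : x ∈ Ioo (-1:ℝ) 1) (hy : y ∈ Ioo (-1:ℝ) 1) :
    dirGreen x y ^ 2 ≤ (1 - x ^ 2) * (1 - y ^ 2) / 4 := by
  wlog h : x ≤ y generalizing x y
  · rw [dirGreen_comm]
    exact (this hy hx (le_of_not_ge h)).trans (by linarith)
  rw [dirGreen, min_eq_left h, max_eq_right h]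
  have := mul_nonneg (mul_nonneg (by linarith [hx.1] : 0 ≤ 1 + x) (by linarith [hy.2] : 0 ≤ 1 - y))
    (sub_nonneg.2 h)
  nlinarith

/-- The solution of `-y'' = q` with `y(±1) = 0`. -/
noncomputable def dirInt (q : ℝ → ℝ) (x : ℝ) : ℝ := ∫ y, dirGreen x y * q y ∂intervalMeasure

/-- The derivative of `dirInt q`. -/
noncomputable def dirSlope (q : ℝ → ℝ) (x : ℝ) : ℝ :=
  (∫ t in (-1:ℝ)..1, (1 - t) * q t) / 2 - ∫ t in (-1:ℝ)..x, q t

theorem Integrable.continuous_mul {q : ℝ → ℝ} (hq : Integrable q intervalMeasure) {a : ℝ → ℝ}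
    (ha : Continuous a) : Integrable (fun t => a t * q t) intervalMeasure := by
  obtain ⟨C, hC⟩ := isCompact_Icc.exists_bound_of_continuousOn
    (ha.continuousOn (s := Icc (-1:ℝ) 1))
  refine hq.bdd_mul (c := C) ha.aestronglyMeasurable ?_
  filter_upwards [ae_intervalMeasure_mem] with x hx using hC x (Ioo_subset_Icc_self hx)

theorem dirInt_eq {q : ℝ → ℝ} (hq : Integrable q intervalMeasure) {x : ℝ}
    (hx : x ∈ Icc (-1:ℝ) 1) :
    dirInt q x = (1 + x) * ((∫ t in (-1:ℝ)..1, (1 - t) * q t) / 2) - x * (∫ t in (-1:ℝ)..x, q t)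
      + ∫ t in (-1:ℝ)..x, t * q t := by
  have hg : Continuous fun t => dirGreen x t := by unfold dirGreen; fun_prop
  have h1 := Integrable.continuous_mul hq hg
  have h2 : Integrable (fun t => (1 - t) * q t) intervalMeasure :=
    Integrable.continuous_mul hq (continuous_const.sub continuous_id)
  have h3 : Integrable (fun t => t * q t) intervalMeasure :=
    Integrable.continuous_mul hq continuous_id
  have m1 : (-1:ℝ) ∈ Icc (-1:ℝ) 1 := by simp
  have p1 : (1:ℝ) ∈ Icc (-1:ℝ) 1 := by simp
  rw [dirInt, integral_intervalMeasure, ← integral_add_adjacent_intervals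
    (intervalIntegrable_sub h1 m1 hx) (intervalIntegrable_sub h1 hx p1),
    ← integral_add_adjacent_intervals (f := fun t => (1 - t) * q t)
    (intervalIntegrable_sub h2 m1 hx) (intervalIntegrable_sub h2 hx p1)]
  have e1 : ∫ t in (-1:ℝ)..x, dirGreen x t * q t =
      (1 + x) / 2 * (∫ t in (-1:ℝ)..x, (1 - t) * q t) - x * (∫ t in (-1:ℝ)..x, q t)
      + ∫ t in (-1:ℝ)..x, t * q t := by
    rw [← intervalIntegral.integral_const_mul, ← intervalIntegral.integral_const_mul,
      ← intervalIntegral.integral_sub ((intervalIntegrable_sub h2 m1 hx).const_mul _)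
        ((intervalIntegrable_sub hq m1 hx).const_mul _),
      ← intervalIntegral.integral_add (((intervalIntegrable_sub h2 m1 hx).const_mul _).sub
        ((intervalIntegrable_sub hq m1 hx).const_mul _)) (intervalIntegrable_sub h3 m1 hx)]
    refine intervalIntegral.integral_congr fun t ht => ?_
    rw [uIcc_of_le hx.1] at ht
    simp only [dirGreen, min_eq_right ht.2, max_eq_left ht.2]
    ring
  have e2 : ∫ t in x..1, dirGreen x t * q t = (1 + x) / 2 * ∫ t in x..1, (1 - t) * q t := by
    rw [← intervalIntegral.integral_const_mul]
    refine intervalIntegral.integral_congr fun t ht => ?_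
    rw [uIcc_of_le hx.2] at ht
    simp only [dirGreen, min_eq_left ht.1, max_eq_right ht.1]
    ring
  rw [e1, e2]
  ring

theorem continuousOn_dirInt {q : ℝ → ℝ} (hq : Integrable q intervalMeasure) :
    ContinuousOn (dirInt q) (Icc (-1) 1) := by
  refine ContinuousOn.congr ?_ fun x hx => dirInt_eq hq hx
  exact (((continuousOn_const.add continuousOn_id).mul continuousOn_const).sub
    (continuousOn_id.mul (continuousOn_primitive_Icc hq))).add
    (continuousOn_primitive_Icc (Integrable.continuous_mul hq continuous_id))

theorem continuousOn_dirSlope {q : ℝ → ℝ} (hq : Integrable q intervalMeasure) :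
    ContinuousOn (dirSlope q) (Icc (-1) 1) :=
  continuousOn_const.sub (continuousOn_primitive_Icc hq)

theorem dirInt_neg_one (q : ℝ → ℝ) : dirInt q (-1) = 0 := by
  refine integral_eq_zero_of_ae ?_
  filter_upwards [ae_intervalMeasure_mem] with x hx
  simp [dirGreen, min_eq_left hx.1.le]

theorem dirInt_one (q : ℝ → ℝ) : dirInt q 1 = 0 := by
  refine integral_eq_zero_of_ae ?_
  filter_upwards [ae_intervalMeasure_mem] with x hx
  simp [dirGreen, max_eq_left hx.2.le]

theorem hasDerivAt_dirInt {q : ℝ → ℝ} (hq : Integrable q intervalMeasure)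
    (hqc : ContinuousOn q (Ioo (-1) 1)) {x : ℝ} (hx : x ∈ Ioo (-1:ℝ) 1) :
    HasDerivAt (dirInt q) (dirSlope q x) x := by
  have h1 := hasDerivAt_primitive_Ioo hq hqc hx
  have h2 := hasDerivAt_primitive_Ioo (Integrable.continuous_mul hq continuous_id)
    (continuousOn_id.mul hqc) hx
  have h3 := ((((hasDerivAt_id x).const_add 1).mul_const
    ((∫ t in (-1:ℝ)..1, (1 - t) * q t) / 2)).sub ((hasDerivAt_id x).mul h1)).add h2
  refine (h3.congr_of_eventuallyEq ?_).congr_deriv ?_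
  · filter_upwards [isOpen_Ioo.mem_nhds hx] with y hy
    rw [dirInt_eq hq (Ioo_subset_Icc_self hy)]
    rfl
  · simp only [dirSlope, id]
    ring

theorem hasDerivAt_dirSlope {q : ℝ → ℝ} (hq : Integrable q intervalMeasure)
    (hqc : ContinuousOn q (Ioo (-1) 1)) {x : ℝ} (hx : x ∈ Ioo (-1:ℝ) 1) :
    HasDerivAt (dirSlope q) (-q x) x :=
  (hasDerivAt_primitive_Ioo hq hqc hx).const_sub _

/-- `1/√f` on `(-1,1)`, extended by zero. -/
noncomputable def halfWeight (f : ℝ → ℝ) : ℝ → ℝ := (Ioo (-1:ℝ) 1).indicator fun x => (√(f x))⁻¹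

theorem halfWeight_of_mem {f : ℝ → ℝ} {x : ℝ} (hx : x ∈ Ioo (-1:ℝ) 1) :
    halfWeight f x = (√(f x))⁻¹ := indicator_of_mem hx _

theorem halfWeight_of_notMem {f : ℝ → ℝ} {x : ℝ} (hx : x ∉ Ioo (-1:ℝ) 1) :
    halfWeight f x = 0 := indicator_of_notMem hx _

theorem IsProfile.halfWeight_pos {f : ℝ → ℝ} (hf : IsProfile f) {x : ℝ} (hx : x ∈ Ioo (-1:ℝ) 1) :
    0 < halfWeight f x := by
  rw [halfWeight_of_mem hx]
  exact inv_pos.2 (Real.sqrt_pos.2 (hf.pos x hx))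

theorem IsProfile.measurable_halfWeight {f : ℝ → ℝ} (hf : IsProfile f) :
    Measurable (halfWeight f) := by
  have := ContinuousOn.measurable_piecewise (f := fun x => (√(f x))⁻¹) (g := (0 : ℝ → ℝ))
    (s := Ioo (-1:ℝ) 1) ((Real.continuous_sqrt.comp_continuousOn hf.smoothOn.continuousOn).inv₀
      fun x hx => (Real.sqrt_pos.2 (hf.pos x hx)).ne') continuousOn_const measurableSet_Ioo
  rwa [piecewise_eq_indicator] at this

theorem integrable_inv_sqrt_one_sub_sq :
    Integrable (fun x : ℝ => 1 / √(1 - x ^ 2)) intervalMeasure := by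
  have := integrable_and_integral_of_hasDerivAt (F := fun x => -Real.arcsin x) (G₁ := fun _ => 0)
    (G₂ := fun x => 1 / √(1 - x ^ 2)) (a := -Real.arcsin (-1)) (b := -Real.arcsin 1)
    (integrable_const 0) continuousOn_const (fun x _ => by positivity)
    (fun x hx => ((Real.hasDerivAt_arcsin hx.1.ne' hx.2.ne).neg).congr_deriv (by ring))
    (Real.continuous_arcsin.neg.continuousWithinAt) (Real.continuous_arcsin.neg.continuousWithinAt)
  exact this.1

theorem IsProfile.integrable_halfWeight {f : ℝ → ℝ} (hf : IsProfile f) :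
    Integrable (halfWeight f) intervalMeasure := by
  obtain ⟨c, C, hc, hC, hb⟩ := hf.exists_bounds
  refine (integrable_inv_sqrt_one_sub_sq.const_mul (√c)⁻¹).mono'
    hf.measurable_halfWeight.aestronglyMeasurable ?_
  filter_upwards [ae_intervalMeasure_mem] with x hx
  have h1 : 0 < 1 - x ^ 2 := by nlinarith [hx.1, hx.2]
  rw [Real.norm_of_nonneg (hf.halfWeight_pos hx).le, halfWeight_of_mem hx, one_div, ← mul_inv,
    ← Real.sqrt_mul hc.le]
  exact inv_anti₀ (Real.sqrt_pos.2 (by positivity))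
    (Real.sqrt_le_sqrt (hb x (Ioo_subset_Icc_self hx)).1)

theorem IsProfile.exists_isBddKernel_dirGreen {f : ℝ → ℝ} (hf : IsProfile f) :
    ∃ C, IsBddKernel (fun x y => dirGreen x y * halfWeight f x * halfWeight f y) C := by
  obtain ⟨c, C, hc, hC, hb⟩ := hf.exists_bounds
  refine ⟨(2 * c)⁻¹, ?_, fun x y => ?_⟩
  · have h1 : Measurable fun z : ℝ × ℝ => dirGreen z.1 z.2 := by
      refine Continuous.measurable ?_
      unfold dirGreen
      fun_prop
    exact (h1.mul (hf.measurable_halfWeight.comp measurable_fst)).mul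
      (hf.measurable_halfWeight.comp measurable_snd)
  · by_cases hx : x ∈ Ioo (-1:ℝ) 1
    swap
    · rw [halfWeight_of_notMem hx, mul_zero, zero_mul, abs_zero]; positivity
    by_cases hy : y ∈ Ioo (-1:ℝ) 1
    swap
    · rw [halfWeight_of_notMem hy, mul_zero, abs_zero]; positivity
    have h1 : 0 < 1 - x ^ 2 := by nlinarith [hx.1, hx.2]
    have h2 : 0 < 1 - y ^ 2 := by nlinarith [hy.1, hy.2]
    have hfx := hf.pos x hx
    have hfy := hf.pos y hy
    refine abs_le_of_sq_le_sq ?_ (by positivity)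
    rw [halfWeight_of_mem hx, halfWeight_of_mem hy, mul_pow, mul_pow, inv_pow, inv_pow, inv_pow,
      Real.sq_sqrt hfx.le, Real.sq_sqrt hfy.le]
    have h3 := dirGreen_sq_le hx hy
    have h4 : c * (1 - x ^ 2) * (c * (1 - y ^ 2)) ≤ f x * f y :=
      mul_le_mul (hb x (Ioo_subset_Icc_self hx)).1 (hb y (Ioo_subset_Icc_self hy)).1
        (by positivity) hfx.le
    have h5 : dirGreen x y ^ 2 * (2 * c) ^ 2 ≤ f x * f y := by nlinarith [sq_nonneg c]
    rw [← div_eq_mul_inv, ← div_eq_mul_inv, div_div, div_le_iff₀ (by positivity), inv_mul_eq_div,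
      le_div_iff₀ (by positivity)]
    exact h5

theorem integral_dirGreen_halfWeight {f : ℝ → ℝ} (g q : ℝ → ℝ) (x : ℝ)
    (hq : ∀ y ∈ Ioo (-1:ℝ) 1, q y = halfWeight f y * g y) :
    ∫ y, dirGreen x y * halfWeight f x * halfWeight f y * g y ∂intervalMeasure =
      halfWeight f x * dirInt q x := by
  rw [dirInt, ← MeasureTheory.integral_const_mul]
  refine integral_congr_ae ?_
  filter_upwards [ae_intervalMeasure_mem] with y hy
  rw [hq y hy]
  ring

theorem IsProfile.halfWeight_sq {f : ℝ → ℝ} (hf : IsProfile f) {x : ℝ} (hx : x ∈ Ioo (-1:ℝ) 1) :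
    halfWeight f x * halfWeight f x = (f x)⁻¹ := by
  rw [halfWeight_of_mem hx, ← mul_inv, Real.mul_self_sqrt (hf.pos x hx).le]

/-- If all positive eigenvalues of `L_0` are at least `a ≥ 0`, then `a ∫ (dirInt q) q ≤ ∫ f q²`. -/
theorem IsProfile.mul_integral_dirInt_le {f : ℝ → ℝ} (hf : IsProfile f) {a : ℝ} (h : 0 ≤ a)
    (hgap : ∀ lam, 0 < lam → InSpec f 0 lam → a ≤ lam) {q : ℝ → ℝ}
    (hqc : ContinuousOn q (Ioo (-1) 1))
    (hq2 : Integrable (fun x => f x * q x ^ 2) intervalMeasure) :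
    a * ∫ x, dirInt q x * q x ∂intervalMeasure ≤ ∫ x, f x * q x ^ 2 ∂intervalMeasure := by
  obtain ⟨C, hN⟩ := hf.exists_isBddKernel_dirGreen
  obtain ⟨κ, hκ, ⟨e, he0, he⟩, hmax⟩ := exists_top_eigenvalue (μ := intervalMeasure) hN
    (fun x y => by rw [dirGreen_comm]; ring)
    (fun x y => by
      by_cases hx : x ∈ Ioo (-1:ℝ) 1
      swap
      · rw [halfWeight_of_notMem hx, mul_zero, zero_mul]
      by_cases hy : y ∈ Ioo (-1:ℝ) 1
      swap
      · rw [halfWeight_of_notMem hy, mul_zero]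
      exact mul_nonneg (mul_nonneg (dirGreen_pos hx hy).le (hf.halfWeight_pos hx).le)
        (hf.halfWeight_pos hy).le)
    (by filter_upwards [ae_intervalMeasure_mem] with x hx
        filter_upwards [ae_intervalMeasure_mem] with y hy
        exact mul_pos (mul_pos (dirGreen_pos hx hy) (hf.halfWeight_pos hx)) (hf.halfWeight_pos hy))
    intervalMeasure_ne_zero
  have hspec : InSpec f 0 κ⁻¹ := by
    have hei := Lp.integrable_of_two e
    set ψ : ℝ → ℝ := fun x => κ⁻¹ * ∫ y, dirGreen x y * halfWeight f x * halfWeight f y * e y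
      ∂intervalMeasure with hψ
    have hae : e =ᵐ[intervalMeasure] ψ := by
      filter_upwards [kernelOp_coeFn hN e, Lp.coeFn_smul κ e] with x h1 h2
      rw [he, h2, Pi.smul_apply, smul_eq_mul] at h1
      rw [hψ]
      dsimp only
      rw [← h1, inv_mul_cancel_left₀ hκ.ne']
    set r : ℝ → ℝ := fun x => halfWeight f x * ψ x with hr
    have hψm : AEStronglyMeasurable ψ intervalMeasure :=
      (hN.aestronglyMeasurable_integral hei.aestronglyMeasurable).const_mul _
    have hri : Integrable r intervalMeasure := by
      have := hf.integrable_halfWeight.bdd_mul (c := κ⁻¹ * (C * ∫ y, |e y| ∂intervalMeasure)) hψm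
        (Eventually.of_forall fun x => by
          rw [hψ, norm_mul, Real.norm_of_nonneg (inv_pos.2 hκ).le]
          exact mul_le_mul_of_nonneg_left (hN.abs_integral_le hei x) (inv_pos.2 hκ).le)
      exact this.congr (Eventually.of_forall fun x => mul_comm _ _)
    have hψr : ∀ x, ψ x = κ⁻¹ * (halfWeight f x * dirInt r x) := fun x => by
      rw [hψ]
      dsimp only
      rw [← integral_dirGreen_halfWeight ψ r x fun y _ => rfl]
      congr 1
      refine integral_congr_ae ?_
      filter_upwards [hae] with y hy
      rw [hy]
    have hr' : ∀ x ∈ Ioo (-1:ℝ) 1, r x = κ⁻¹ * dirInt r x / f x := fun x hx => by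
      rw [hr]
      dsimp only
      rw [hψr, div_eq_mul_inv, ← hf.halfWeight_sq hx]
      ring
    have hrc : ContinuousOn r (Ioo (-1) 1) := by
      refine ContinuousOn.congr ?_ hr'
      exact (continuousOn_const.mul ((continuousOn_dirInt hri).mono Ioo_subset_Icc_self)).div
        hf.smoothOn.continuousOn fun x hx => hf.ne_zero hx
    have hsol : IsSolution f 0 (fun x => κ⁻¹ * dirSlope r x) (dirSlope r)
        (fun x => -(κ⁻¹ * dirInt r x)) := fun x hx => by
      refine ⟨(hasDerivAt_dirSlope hri hrc hx).congr_deriv ?_,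
        ((hasDerivAt_dirInt hri hrc hx).const_mul κ⁻¹).neg.congr_deriv ?_⟩
      · rw [hr' x hx]; ring
      · simp
    refine hsol.inSpec hf (continuousOn_dirSlope hri) ?_ (by simp)
    by_contra! hc
    obtain ⟨x, hx, hne⟩ := exists_ne_zero_of_ae_eq he0 hae
    have h1 : HasDerivAt (dirSlope r) 0 x := (hasDerivAt_const x 0).congr_of_eventuallyEq (by
      filter_upwards [isOpen_Ioo.mem_nhds hx] with y hy using hc y hy)
    have h2 : r x = 0 := neg_eq_zero.1 ((hasDerivAt_dirSlope hri hrc hx).unique h1)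
    exact hne ((mul_eq_zero.1 h2).resolve_left (hf.halfWeight_pos hx).ne')
  have ha := hgap _ (inv_pos.2 hκ) hspec
  set g : ℝ → ℝ := fun x => √(f x) * q x with hg
  have hgsq : ∀ x ∈ Ioo (-1:ℝ) 1, g x ^ 2 = f x * q x ^ 2 := fun x hx => by
    rw [hg]
    dsimp only
    rw [mul_pow, Real.sq_sqrt (hf.pos x hx).le]
  have hgm : MemLp g 2 intervalMeasure := by
    rw [memLp_two_iff_integrable_sq]
    · refine hq2.congr ?_
      filter_upwards [ae_intervalMeasure_mem] with x hx using (hgsq x hx).symm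
    · exact ((Real.continuous_sqrt.comp_continuousOn hf.smoothOn.continuousOn).mul
        hqc).aestronglyMeasurable measurableSet_Ioo
  have hqg : ∀ x ∈ Ioo (-1:ℝ) 1, q x = halfWeight f x * g x := fun x hx => by
    rw [halfWeight_of_mem hx, hg, inv_mul_cancel_left₀ (Real.sqrt_pos.2 (hf.pos x hx)).ne']
  have key := hmax (hgm.toLp g)
  have e1 : ∫ x, g x ^ 2 ∂intervalMeasure = ∫ x, f x * q x ^ 2 ∂intervalMeasure := by
    refine integral_congr_ae ?_
    filter_upwards [ae_intervalMeasure_mem] with x hx using hgsq x hx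
  have e2 : ∫ x, (∫ y, dirGreen x y * halfWeight f x * halfWeight f y * g y ∂intervalMeasure) * g x
      ∂intervalMeasure = ∫ x, dirInt q x * q x ∂intervalMeasure := by
    refine integral_congr_ae ?_
    filter_upwards [ae_intervalMeasure_mem] with x hx
    rw [integral_dirGreen_halfWeight g q x hqg, hqg x hx]
    ring
  rw [inner_kernelOp_toLp, MemLp.norm_toLp_sq, e1, e2] at key
  have h0 : 0 ≤ ∫ x, f x * q x ^ 2 ∂intervalMeasure := by
    rw [← e1]
    exact integral_nonneg fun x => sq_nonneg _
  calc _ ≤ a * (κ * ∫ x, f x * q x ^ 2 ∂intervalMeasure) := mul_le_mul_of_nonneg_left key h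
    _ = a * κ * ∫ x, f x * q x ^ 2 ∂intervalMeasure := by ring
    _ ≤ 1 * ∫ x, f x * q x ^ 2 ∂intervalMeasure := by
        refine mul_le_mul_of_nonneg_right ?_ h0
        calc a * κ ≤ κ⁻¹ * κ := mul_le_mul_of_nonneg_right ha hκ.le
          _ = 1 := inv_mul_cancel₀ hκ.ne'
    _ = _ := one_mul _

/-- The height function of the conformal dilation by `α`. -/
noncomputable def confHeight (f : ℝ → ℝ) (α x : ℝ) : ℝ :=
  (expCoord f x ^ 2 - α ^ 2) / (expCoord f x ^ 2 + α ^ 2)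

/-- The radius function of the conformal dilation by `α`. -/
noncomputable def confRadius (f : ℝ → ℝ) (α x : ℝ) : ℝ :=
  2 * α * expCoord f x / (expCoord f x ^ 2 + α ^ 2)

theorem abs_confHeight_le_one (f : ℝ → ℝ) (α x : ℝ) : |confHeight f α x| ≤ 1 := by
  rw [confHeight, abs_div, abs_of_nonneg (by positivity : 0 ≤ expCoord f x ^ 2 + α ^ 2)]
  refine div_le_one_of_le₀ (abs_le.2 ⟨?_, ?_⟩) (by positivity) <;>
    nlinarith [sq_nonneg (expCoord f x), sq_nonneg α]

theorem confRadius_sq {f : ℝ → ℝ} {α : ℝ} (hα : 0 < α) (x : ℝ) :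
    confRadius f α x ^ 2 = 1 - confHeight f α x ^ 2 := by
  have : expCoord f x ^ 2 + α ^ 2 ≠ 0 := by positivity
  rw [confRadius, confHeight]
  field_simp
  ring

theorem confRadius_nonneg {f : ℝ → ℝ} {α : ℝ} (hα : 0 < α) (x : ℝ) : 0 ≤ confRadius f α x := by
  have := expCoord_nonneg f x
  rw [confRadius]
  positivity

theorem confRadius_pos {f : ℝ → ℝ} {α : ℝ} (hα : 0 < α) {x : ℝ} (hx : x ∈ Ioo (-1:ℝ) 1) :
    0 < confRadius f α x := by
  have := expCoord_pos (f := f) hx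
  rw [confRadius]
  positivity

theorem IsProfile.hasDerivAt_confHeight {f : ℝ → ℝ} (hf : IsProfile f) {α : ℝ} (hα : 0 < α)
    {x : ℝ} (hx : x ∈ Ioo (-1:ℝ) 1) :
    HasDerivAt (confHeight f α) (confRadius f α x ^ 2 / f x) x := by
  have hE := hf.hasDerivAt_expCoord hx
  have h0 : expCoord f x ^ 2 + α ^ 2 ≠ 0 := by positivity
  have hfx := hf.ne_zero hx
  refine (((hE.pow 2).sub_const (α ^ 2)).div ((hE.pow 2).add_const (α ^ 2)) h0).congr_deriv ?_
  simp only [confRadius, Pi.pow_apply]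
  field_simp
  ring

theorem IsProfile.hasDerivAt_confRadius {f : ℝ → ℝ} (hf : IsProfile f) {α : ℝ} (hα : 0 < α)
    {x : ℝ} (hx : x ∈ Ioo (-1:ℝ) 1) :
    HasDerivAt (confRadius f α) (-(confHeight f α x * confRadius f α x / f x)) x := by
  have hE := hf.hasDerivAt_expCoord hx
  have h0 : expCoord f x ^ 2 + α ^ 2 ≠ 0 := by positivity
  have hfx := hf.ne_zero hx
  refine ((hE.const_mul (2 * α)).div ((hE.pow 2).add_const (α ^ 2)) h0).congr_deriv ?_
  simp only [confRadius, confHeight, Pi.pow_apply]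
  field_simp
  ring

theorem IsProfile.tendsto_confHeight_neg_one {f : ℝ → ℝ} (hf : IsProfile f) {α : ℝ} (hα : 0 < α) :
    Tendsto (confHeight f α) (nhdsWithin (-1) (Ioo (-1) 1)) (nhds (-1)) := by
  have h := hf.tendsto_expCoord_neg_one.mono_left nhdsGT_neg_one_le
  have h2 := ((h.pow 2).sub_const (α ^ 2)).div ((h.pow 2).add_const (α ^ 2)) (by positivity)
  have e : ((0:ℝ) ^ 2 - α ^ 2) / (0 ^ 2 + α ^ 2) = -1 := by
    rw [zero_pow two_ne_zero, zero_sub, zero_add, neg_div, div_self (by positivity)]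
  rw [e] at h2
  exact h2

theorem IsProfile.tendsto_confHeight_one {f : ℝ → ℝ} (hf : IsProfile f) {α : ℝ} :
    Tendsto (confHeight f α) (nhdsWithin 1 (Ioo (-1) 1)) (nhds 1) := by
  have h := hf.tendsto_inv_expCoord_one.mono_left nhdsLT_one_le
  have h2 := (((h.pow 2).const_mul (α ^ 2)).const_sub 1).div
    (((h.pow 2).const_mul (α ^ 2)).const_add 1) (by simp)
  have h3 : Tendsto _ _ (nhds (1:ℝ)) := h2.congr' (f₂ := confHeight f α) (by
    filter_upwards [self_mem_nhdsWithin] with x hx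
    have := expCoord_pos (f := f) hx
    simp only [Pi.div_apply, confHeight]
    field_simp) |>.trans (by simp)
  exact h3

theorem IsProfile.tendsto_confRadius {f : ℝ → ℝ} {α : ℝ} (hα : 0 < α) {l : Filter ℝ}
    {s : ℝ} (hs : s ^ 2 = 1) (h : Tendsto (confHeight f α) l (nhds s)) :
    Tendsto (confRadius f α) l (nhds 0) := by
  have h1 := ((h.pow 2).const_sub 1).sqrt
  rw [hs, sub_self, Real.sqrt_zero] at h1
  refine h1.congr fun x => ?_
  rw [← confRadius_sq hα, Real.sqrt_sq (confRadius_nonneg hα x)]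

theorem IsProfile.continuousOn_confHeight {f : ℝ → ℝ} (hf : IsProfile f) {α : ℝ} (hα : 0 < α) :
    ContinuousOn (confHeight f α) (Ioo (-1) 1) := fun _ hx =>
  (hf.hasDerivAt_confHeight hα hx).continuousAt.continuousWithinAt

theorem IsProfile.continuousOn_confRadius {f : ℝ → ℝ} (hf : IsProfile f) {α : ℝ} (hα : 0 < α) :
    ContinuousOn (confRadius f α) (Icc (-1) 1) := by
  have hm : confRadius f α (-1) = 0 := by simp [confRadius, expCoord_of_notMem]
  have hp : confRadius f α 1 = 0 := by simp [confRadius, expCoord_of_notMem]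
  intro x hx
  rcases hx.1.eq_or_lt with h1 | h1
  · rw [ContinuousWithinAt, ← h1, hm]
    have h := hf.tendsto_expCoord_neg_one
    have h2 := (h.const_mul (2 * α)).div ((h.pow 2).add_const (α ^ 2)) (by positivity)
    rw [mul_zero, zero_div] at h2
    exact h2
  rcases hx.2.eq_or_lt with h2 | h2
  · rw [ContinuousWithinAt, h2, hp]
    have h := hf.tendsto_inv_expCoord_one.const_mul (2 * α)
    rw [mul_zero] at h
    refine squeeze_zero (confRadius_nonneg hα) (fun y => ?_) h
    rw [confRadius, ← div_eq_mul_inv]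
    rcases (expCoord_nonneg f y).eq_or_lt with h0 | h0
    · simp [← h0]
    · rw [div_le_div_iff₀ (by positivity) h0]
      nlinarith [mul_pos hα (pow_pos hα 2)]
  · exact (hf.hasDerivAt_confRadius hα ⟨h1, h2⟩).continuousAt.continuousWithinAt

theorem IsProfile.measurable_confHeight {f : ℝ → ℝ} (hf : IsProfile f) (α : ℝ) :
    Measurable (confHeight f α) :=
  ((hf.measurable_expCoord.pow_const 2).sub_const _).div
    ((hf.measurable_expCoord.pow_const 2).add_const _)

theorem IsProfile.integrable_confHeight {f : ℝ → ℝ} (hf : IsProfile f) (α : ℝ) :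
    Integrable (confHeight f α) intervalMeasure :=
  Integrable.of_bound (hf.measurable_confHeight α).aestronglyMeasurable 1
    (Eventually.of_forall fun x => abs_confHeight_le_one f α x)

/-- Hersch's balancing: some conformal dilation has vanishing mean height. -/
theorem IsProfile.exists_balanced {f : ℝ → ℝ} (hf : IsProfile f) :
    ∃ α, 0 < α ∧ ∫ x, confHeight f α x ∂intervalMeasure = 0 := by
  set H : ℝ → ℝ := fun α => ∫ x, confHeight f α x ∂intervalMeasure with hH
  have hbd : ∀ α, ∀ᵐ x ∂intervalMeasure, ‖confHeight f α x‖ ≤ (1:ℝ) := fun α =>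
    Eventually.of_forall fun x => abs_confHeight_le_one f α x
  have hcont : Continuous H := by
    refine continuous_of_dominated (bound := fun _ => 1)
      (fun α => (hf.measurable_confHeight α).aestronglyMeasurable) hbd (integrable_const 1) ?_
    filter_upwards [ae_intervalMeasure_mem] with x hx
    have := expCoord_pos (f := f) hx
    exact Continuous.div (by fun_prop) (by fun_prop) fun α => by positivity
  have h0 : H 0 = 2 := by
    have : H 0 = ∫ _, (1:ℝ) ∂intervalMeasure := by
      refine integral_congr_ae ?_
      filter_upwards [ae_intervalMeasure_mem] with x hx
      have := expCoord_pos (f := f) hx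
      simp [confHeight, this.ne']
    rw [this, MeasureTheory.integral_const, intervalMeasure_real_univ]
    simp
  have hlim : Tendsto H atTop (nhds (-2)) := by
    have h1 : Tendsto H atTop (nhds (∫ _, (-1:ℝ) ∂intervalMeasure)) := by
      refine tendsto_integral_filter_of_dominated_convergence (fun _ => 1)
        (Eventually.of_forall fun α => (hf.measurable_confHeight α).aestronglyMeasurable)
        (Eventually.of_forall hbd) (integrable_const 1) (Eventually.of_forall fun x => ?_)
      have h2 : Tendsto (fun α : ℝ => expCoord f x ^ 2 * (α⁻¹) ^ 2) atTop (nhds 0) := by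
        simpa using (tendsto_inv_atTop_zero.pow 2).const_mul (expCoord f x ^ 2)
      have h3 := (h2.sub_const 1).div (h2.add_const 1) (by simp)
      simp only [zero_sub, zero_add, div_one] at h3
      refine h3.congr' ?_
      filter_upwards [eventually_gt_atTop 0] with α hα
      simp only [Pi.div_apply, confHeight]
      field_simp
    rw [MeasureTheory.integral_const, intervalMeasure_real_univ] at h1
    convert h1 using 2
    simp
  obtain ⟨A, hA, hA0⟩ := ((hlim.eventually (gt_mem_nhds (by norm_num : (-2:ℝ) < 0))).and
    (eventually_ge_atTop 0)).exists
  obtain ⟨α, hα, hα0⟩ := intermediate_value_Icc' hA0 hcont.continuousOn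
    (show (0:ℝ) ∈ Icc (H A) (H 0) from ⟨hA.le, by rw [h0]; norm_num⟩)
  refine ⟨α, hα.1.lt_of_ne fun h => ?_, hα0⟩
  rw [← h, h0] at hα0
  norm_num at hα0

theorem IsProfile.hasDerivAt_confHeight_sq {f : ℝ → ℝ} (hf : IsProfile f) {α : ℝ} (hα : 0 < α)
    {x : ℝ} (hx : x ∈ Ioo (-1:ℝ) 1) :
    HasDerivAt (confHeight f α) ((1 - confHeight f α x ^ 2) / f x) x := by
  rw [← confRadius_sq hα]
  exact hf.hasDerivAt_confHeight hα hx

theorem IsProfile.continuousOn_inv {f : ℝ → ℝ} (hf : IsProfile f) :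
    ContinuousOn (fun x => (f x)⁻¹) (Ioo (-1) 1) :=
  (hf.contOn.mono Ioo_subset_Icc_self).inv₀ fun _ hx => hf.ne_zero hx

theorem ContinuousOn.integrable_mul_intervalMeasure {a q : ℝ → ℝ} (ha : ContinuousOn a (Icc (-1) 1))
    (hq : Integrable q intervalMeasure) : Integrable (fun x => a x * q x) intervalMeasure := by
  obtain ⟨C, hC⟩ := isCompact_Icc.exists_bound_of_continuousOn ha
  refine hq.bdd_mul (c := C) ha.integrable_intervalMeasure.aestronglyMeasurable ?_
  filter_upwards [ae_intervalMeasure_mem] with x hx using hC x (Ioo_subset_Icc_self hx)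

/-- The spectral gap of the zonal operator bounds the second moment of a balanced height. -/
theorem IsProfile.mul_integral_confHeight_sq_le {f : ℝ → ℝ} (hf : IsProfile f) {a α : ℝ} (h : 0 ≤ a)
    (hgap : ∀ lam, 0 < lam → InSpec f 0 lam → a ≤ lam) (hα : 0 < α)
    (hbal : ∫ x, confHeight f α x ∂intervalMeasure = 0) :
    a * ∫ x, confHeight f α x ^ 2 ∂intervalMeasure ≤ 4 / 3 := by
  have hfc := hf.continuousOn_inv
  have hτc := hf.continuousOn_confHeight hα
  have hτm := hf.tendsto_confHeight_neg_one hα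
  have hτp := hf.tendsto_confHeight_one (α := α)
  have hτsq : ∀ x, confHeight f α x ^ 2 ≤ 1 := fun x => by
    rw [sq_le_one_iff_abs_le_one]; exact abs_confHeight_le_one f α x
  set q : ℝ → ℝ := fun x => (1 - confHeight f α x ^ 2) / f x with hqdef
  have hqc : ContinuousOn q (Ioo (-1) 1) := (continuousOn_const.sub (hτc.pow 2)).mul hfc
  have hq0 : ∀ x ∈ Ioo (-1:ℝ) 1, 0 ≤ q x := fun x hx =>
    div_nonneg (by linarith [hτsq x]) (hf.pos x hx).le
  have hqi : Integrable q intervalMeasure :=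
    (integrable_and_integral_of_hasDerivAt (F := fun x => -confHeight f α x) (G₁ := fun _ => 0)
      (integrable_zero _ _ _) continuousOn_const hq0
      (fun x hx => (hf.hasDerivAt_confHeight_sq hα hx).neg.congr_deriv (by simp [hqdef]))
      hτm.neg hτp.neg).1
  have hfq := integrable_and_integral_of_hasDerivAt
      (F := fun x => -(confHeight f α x - confHeight f α x ^ 3 / 3)) (G₁ := fun _ => 0)
      (G₂ := fun x => f x * q x ^ 2)
      (integrable_zero _ _ _) continuousOn_const
      (fun x hx => mul_nonneg (hf.pos x hx).le (sq_nonneg _))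
      (fun x hx => by
        have h1 := hf.hasDerivAt_confHeight_sq hα hx
        have := hf.ne_zero hx
        refine (h1.sub ((h1.pow 3).div_const 3)).neg.congr_deriv ?_
        simp only [hqdef]
        field_simp
        ring)
      (hτm.sub ((hτm.pow 3).div_const 3)).neg (hτp.sub ((hτp.pow 3).div_const 3)).neg
  have hslope : ∀ x ∈ Ioo (-1:ℝ) 1, dirSlope q x = -confHeight f α x := by
    have hconst : ∀ x ∈ Ioo (-1:ℝ) 1, dirSlope q x =
        (dirSlope q 0 + confHeight f α 0) - confHeight f α x := fun x hx => by
      have := eq_of_hasDerivAt_zero_Ioo (F := fun x => dirSlope q x + confHeight f α x)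
        (fun y hy => ((hasDerivAt_dirSlope hqi hqc hy).add
          (hf.hasDerivAt_confHeight_sq hα hy)).congr_deriv (by simp [hqdef]))
        hx (y := 0) (by norm_num)
      linarith
    have hint := integral_of_hasDerivAt_of_tendsto
      (continuousOn_dirSlope hqi).integrable_intervalMeasure
      (fun x hx => hasDerivAt_dirInt hqi hqc hx)
      ((continuousOn_dirInt hqi (-1) (by norm_num)).mono_left nhdsGT_neg_one_le)
      ((continuousOn_dirInt hqi 1 (by norm_num)).mono_left nhdsLT_one_le)
    rw [dirInt_neg_one, dirInt_one, sub_zero,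
      integral_congr_ae (g := fun x => (dirSlope q 0 + confHeight f α 0) - confHeight f α x)
        (by filter_upwards [ae_intervalMeasure_mem] with x hx using hconst x hx),
      MeasureTheory.integral_sub (integrable_const _) (hf.integrable_confHeight α), hbal,
      MeasureTheory.integral_const, intervalMeasure_real_univ, smul_eq_mul] at hint
    intro x hx
    rw [hconst x hx]
    linarith
  have hDc := continuousOn_dirInt hqi
  have hsqi : Integrable (fun x => confHeight f α x ^ 2) intervalMeasure :=
    Integrable.of_bound ((hf.measurable_confHeight α).pow_const 2).aestronglyMeasurable 1
      (Eventually.of_forall fun x => by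
        rw [Real.norm_of_nonneg (sq_nonneg _)]; exact hτsq x)
  have hDq := hDc.integrable_mul_intervalMeasure hqi
  have hDm : Tendsto (dirInt q) (nhdsWithin (-1) (Ioo (-1) 1)) (nhds 0) := by
    have : Tendsto (dirInt q) _ _ := (hDc (-1) (by norm_num)).mono_left nhdsGT_neg_one_le
    rwa [dirInt_neg_one] at this
  have hDp : Tendsto (dirInt q) (nhdsWithin 1 (Ioo (-1) 1)) (nhds 0) := by
    have : Tendsto (dirInt q) _ _ := (hDc 1 (by norm_num)).mono_left nhdsLT_one_le
    rwa [dirInt_one] at this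
  have hparts := integral_of_hasDerivAt_of_tendsto (F := fun x => dirInt q x * confHeight f α x)
      (hDq.sub hsqi) (fun x hx => ((hasDerivAt_dirInt hqi hqc hx).mul
        (hf.hasDerivAt_confHeight_sq hα hx)).congr_deriv (by
          rw [hslope x hx, Pi.sub_apply]; simp only [hqdef]; ring)) (hDm.mul hτm) (hDp.mul hτp)
  simp only [Pi.sub_apply] at hparts
  rw [MeasureTheory.integral_sub hDq hsqi] at hparts
  have hle := hf.mul_integral_dirInt_le h hgap hqc hfq.1
  rw [hfq.2, MeasureTheory.integral_zero] at hle
  have : ∫ x, dirInt q x * q x ∂intervalMeasure = ∫ x, confHeight f α x ^ 2 ∂intervalMeasure := by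
    linarith
  rw [this] at hle
  linarith

theorem IsProfile.eq_round_of_gap {f : ℝ → ℝ} (hf : IsProfile f)
    (hgap₀ : ∀ lam, 0 < lam → InSpec f 0 lam → 2 ≤ lam)
    (hgap₁ : ∀ lam, InSpec f 1 lam → 2 ≤ lam) : ∀ x ∈ Icc (-1:ℝ) 1, f x = 1 - x ^ 2 := by
  obtain ⟨α, hα, hbal⟩ := hf.exists_balanced
  have hτ2 := hf.mul_integral_confHeight_sq_le zero_le_two hgap₀ hα hbal
  have hτc := hf.continuousOn_confHeight hα
  have hτm := hf.tendsto_confHeight_neg_one hα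
  have hτp := hf.tendsto_confHeight_one (α := α)
  have hφm := IsProfile.tendsto_confRadius hα (by norm_num) hτm
  have hφp := IsProfile.tendsto_confRadius hα (by norm_num) hτp
  have hφc := hf.continuousOn_confRadius hα
  have hφi := hφc.integrable_intervalMeasure
  have hφo := hφc.mono Ioo_subset_Icc_self
  have hφ0 := confRadius_nonneg (f := f) hα
  have hτ1 : ∀ x, 0 ≤ 1 + confHeight f α x := fun x => by
    linarith [neg_le_of_abs_le (abs_confHeight_le_one f α x)]
  set h : ℝ → ℝ := fun x => confRadius f α x * (1 + confHeight f α x) with hh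
  set b : ℝ → ℝ := lowInt f 1 (confRadius f α) with hb
  have hbd : ∀ x ∈ Ioo (-1:ℝ) 1, HasDerivAt b (-(b x / f x) + confRadius f α x) x := fun x hx => by
    simpa using hf.hasDerivAt_lowInt 1 hφi hφo hx
  have hb0 : ∀ x ∈ Ioo (-1:ℝ) 1, 0 ≤ b x := fun x hx => hf.lowInt_nonneg 1 hφ0 hx
  have hbm : Tendsto b (nhdsWithin (-1) (Ioo (-1) 1)) (nhds 0) :=
    hf.tendsto_lowInt le_rfl hφi hφ0 self_mem_nhdsWithin
      ((hf.tendsto_greenInt_neg_one le_rfl hφi).mono_left nhdsGT_neg_one_le)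
  have hbp : Tendsto b (nhdsWithin 1 (Ioo (-1) 1)) (nhds 0) :=
    hf.tendsto_lowInt le_rfl hφi hφ0 self_mem_nhdsWithin
      ((hf.tendsto_greenInt_one le_rfl hφi).mono_left nhdsLT_one_le)
  have hφ2i : Integrable (fun x => confRadius f α x ^ 2) intervalMeasure :=
    (hφc.pow 2).integrable_intervalMeasure
  have hh2 := integrable_and_integral_of_hasDerivAt
      (F := fun x => -((1 + confHeight f α x) ^ 3 / 3)) (G₁ := fun _ => 0)
      (G₂ := fun x => h x ^ 2 / f x) (integrable_zero _ _ _) continuousOn_const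
      (fun x hx => div_nonneg (sq_nonneg _) (hf.pos x hx).le)
      (fun x hx => by
        refine ((((hf.hasDerivAt_confHeight hα hx).const_add 1).pow 3).div_const 3).neg.congr_deriv ?_
        simp only [hh]
        ring)
      (((hτm.const_add 1).pow 3).div_const 3).neg (((hτp.const_add 1).pow 3).div_const 3).neg
  have hhb := integrable_and_integral_of_hasDerivAt
      (F := fun x => confRadius f α x * b x) (G₁ := fun x => confRadius f α x ^ 2)
      (G₂ := fun x => h x * b x / f x) hφ2i (hφo.pow 2)
      (fun x hx => div_nonneg (mul_nonneg (mul_nonneg (hφ0 x) (hτ1 x)) (hb0 x hx)) (hf.pos x hx).le)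
      (fun x hx => by
        refine ((hf.hasDerivAt_confRadius hα hx).mul (hbd x hx)).congr_deriv ?_
        simp only [hh]
        ring)
      (hφm.mul hbm) (hφp.mul hbp)
  have hbb := hf.integral_greenInt_mul_self le_rfl hφi hφo
  obtain ⟨ν, hν, hνs, hνle⟩ := hf.exists_bottom_eigenvalue (le_refl 1)
  have hbot := hνle _ hφc
  have hν2 := hgap₁ ν hνs
  rw [← hbb.2] at hbot
  have hbbi : Integrable (fun x => b x ^ 2 / f x) intervalMeasure := hbb.1
  have hbb0 : 0 ≤ ∫ x, b x ^ 2 / f x ∂intervalMeasure := by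
    refine integral_nonneg_of_ae ?_
    filter_upwards [ae_intervalMeasure_mem] with x hx
    exact div_nonneg (sq_nonneg _) (hf.pos x hx).le
  have hA : ∫ x, confRadius f α x ^ 2 ∂intervalMeasure =
      2 - ∫ x, confHeight f α x ^ 2 ∂intervalMeasure := by
    have hsqi : Integrable (fun x => confHeight f α x ^ 2) intervalMeasure := by
      refine ((integrable_const 1).sub hφ2i).congr (Eventually.of_forall fun x => ?_)
      simp only [Pi.sub_apply]
      rw [confRadius_sq hα]
      ring
    simp only [confRadius_sq hα]
    rw [MeasureTheory.integral_sub (integrable_const _) hsqi, MeasureTheory.integral_const,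
      intervalMeasure_real_univ]
    simp
  have hdi : Integrable (fun x => b x ^ 2 / f x - h x * b x / f x) intervalMeasure :=
    hbbi.sub hhb.1
  have hsq : ∫ x, (b x - h x / 2) ^ 2 / f x ∂intervalMeasure =
      (∫ x, b x ^ 2 / f x ∂intervalMeasure) - (∫ x, h x * b x / f x ∂intervalMeasure) +
        (1 / 4) * ∫ x, h x ^ 2 / f x ∂intervalMeasure := by
    rw [← MeasureTheory.integral_const_mul, ← MeasureTheory.integral_sub hbbi hhb.1,
      ← MeasureTheory.integral_add hdi (hh2.1.const_mul _)]
    refine integral_congr_ae (Eventually.of_forall fun x => ?_)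
    simp only
    ring
  have hsqi : Integrable (fun x => (b x - h x / 2) ^ 2 / f x) intervalMeasure := by
    refine ((hbbi.sub hhb.1).add (hh2.1.const_mul (1 / 4))).congr (Eventually.of_forall fun x => ?_)
    simp only [Pi.add_apply, Pi.sub_apply]
    ring
  have hnn : 0 ≤ᵐ[intervalMeasure] fun x => (b x - h x / 2) ^ 2 / f x := by
    filter_upwards [ae_intervalMeasure_mem] with x hx
    exact div_nonneg (sq_nonneg _) (hf.pos x hx).le
  have hzero : ∫ x, (b x - h x / 2) ^ 2 / f x ∂intervalMeasure = 0 := by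
    refine le_antisymm ?_ (integral_nonneg_of_ae hnn)
    rw [hsq, hhb.2, hh2.2, MeasureTheory.integral_zero]
    change ν * ∫ x, b x ^ 2 / f x ∂intervalMeasure ≤ _ at hbot
    nlinarith [mul_le_mul_of_nonneg_right hν2 hbb0]
  have hhd : ∀ x ∈ Ioo (-1:ℝ) 1, HasDerivAt h
      (confRadius f α x * (1 + confHeight f α x) * (1 - 2 * confHeight f α x) / f x) x :=
    fun x hx => by
      refine ((hf.hasDerivAt_confRadius hα hx).mul
        ((hf.hasDerivAt_confHeight hα hx).const_add 1)).congr_deriv ?_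
      rw [confRadius_sq hα]
      ring
  have hbh : ∀ x ∈ Ioo (-1:ℝ) 1, b x = h x / 2 := fun x hx => by
    have hc : ContinuousOn (fun x => (b x - h x / 2) ^ 2 / f x) (Ioo (-1) 1) :=
      (ContinuousOn.pow (fun y hy => ((hbd y hy).sub ((hhd y hy).div_const 2)).continuousAt.continuousWithinAt) 2).mul
        hf.continuousOn_inv
    have h0 := eq_zero_of_ae_eq_zero hc ((integral_eq_zero_iff_of_nonneg_ae hnn hsqi).1 hzero) x hx
    rw [div_eq_zero_iff, or_iff_left (hf.ne_zero hx)] at h0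
    linarith [pow_eq_zero_iff two_ne_zero |>.1 h0]
  have hfφ : ∀ x ∈ Ioo (-1:ℝ) 1, f x = 1 - confHeight f α x ^ 2 := fun x hx => by
    have h1 := hbd x hx
    have h2 := ((hhd x hx).div_const 2).congr_of_eventuallyEq (f₁ := b) (by
      filter_upwards [isOpen_Ioo.mem_nhds hx] with y hy using hbh y hy)
    have h3 := h1.unique h2
    have hφ := confRadius_pos (f := f) hα hx
    have hfx := hf.ne_zero hx
    rw [hbh x hx] at h3
    simp only [hh] at h3
    field_simp at h3
    nlinarith
  have hτx : ∀ x ∈ Ioo (-1:ℝ) 1, confHeight f α x = x := fun x hx => by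
    have hd : ∀ y ∈ Ioo (-1:ℝ) 1, HasDerivAt (fun y => confHeight f α y - y) 0 y := fun y hy => by
      refine ((hf.hasDerivAt_confHeight_sq hα hy).sub (hasDerivAt_id y)).congr_deriv ?_
      rw [← hfφ y hy, div_self (hf.ne_zero hy), sub_self]
    have hl : Tendsto (fun y => confHeight f α y - y) (nhdsWithin 1 (Ioo (-1) 1)) (nhds (1 - 1)) :=
      hτp.sub (tendsto_id.mono_left nhdsWithin_le_nhds)
    have hl' : Tendsto (fun y => confHeight f α y - y) (nhdsWithin 1 (Ioo (-1) 1))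
        (nhds (confHeight f α x - x)) := by
      refine tendsto_const_nhds.congr' ?_
      filter_upwards [self_mem_nhdsWithin] with y hy using eq_of_hasDerivAt_zero_Ioo hd hx hy
    linarith [tendsto_nhds_unique hl hl']
  intro x hx
  rcases hx.1.eq_or_lt with h1 | h1
  · rw [← h1, hf.zero_neg_one]; norm_num
  rcases hx.2.eq_or_lt with h2 | h2
  · rw [h2, hf.zero_one]; norm_num
  · rw [hfφ x ⟨h1, h2⟩, hτx x ⟨h1, h2⟩]

open Polynomial in
/-- The operator `L_k` on the round sphere, conjugated by `(1 - x²)^(k/2)`. -/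
noncomputable def gegenbauerOp (k : ℕ) (Q : ℝ[X]) : ℝ[X] :=
  (X ^ 2 - 1) * derivative (derivative Q) + C (2 * (k + 1) : ℝ) * X * derivative Q +
    C (k * (k + 1) : ℝ) * Q

open Polynomial in
/-- The polynomial `((X² - 1)^m)^(j)` solves the Gegenbauer equation of index `j - m + 1/2`. -/
theorem iterate_derivative_sq_sub_one_pow (m j : ℕ) :
    (X ^ 2 - 1) * derivative^[j + 2] ((X ^ 2 - 1 : ℝ[X]) ^ m) +
      C (2 * (j - m + 1) : ℝ) * X * derivative^[j + 1] ((X ^ 2 - 1 : ℝ[X]) ^ m) =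
      C ((2 * m - j) * (j + 1) : ℝ) * derivative^[j] ((X ^ 2 - 1 : ℝ[X]) ^ m) := by
  induction j with
  | zero =>
    have h1 : (X ^ 2 - 1) * derivative ((X ^ 2 - 1 : ℝ[X]) ^ m) =
        C (2 * m : ℝ) * X * (X ^ 2 - 1) ^ m := by
      rcases m with _ | n
      · simp
      · rw [derivative_pow]
        simp only [derivative_sub, derivative_X_pow, derivative_one, C_mul, Nat.cast_add,
          Nat.cast_one, Nat.add_sub_cancel, C_add, map_natCast, map_ofNat, map_one, Nat.cast_ofNat]
        ring
    have h2 := congrArg derivative h1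
    simp only [derivative_mul, derivative_C, derivative_X, derivative_sub, derivative_X_pow,
      derivative_one] at h2
    simp only [zero_add, Function.iterate_succ, Function.iterate_zero, Function.comp, id]
    simp only [C_mul, C_add, C_sub, map_natCast, map_ofNat, map_one, Nat.cast_ofNat, map_zero,
      CharP.cast_eq_zero] at h2 ⊢
    linear_combination h2
  | succ j ih =>
    have h2 := congrArg derivative ih
    simp only [derivative_mul, derivative_C, derivative_X, derivative_sub, derivative_X_pow,
      derivative_add, derivative_one, ← Function.iterate_succ_apply' derivative] at h2
    simp only [C_mul, C_add, C_sub, map_natCast, map_ofNat, map_one, Nat.cast_ofNat,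
      Nat.cast_add, Nat.cast_one] at h2 ⊢
    linear_combination h2

open Polynomial in
theorem exists_gegenbauerOp_eq {k m : ℕ} (h : k ≤ m) :
    ∃ Q : ℝ[X], Q ≠ 0 ∧ gegenbauerOp k Q = C (m * (m + 1) : ℝ) * Q := by
  refine ⟨derivative^[m + k] ((X ^ 2 - 1) ^ m), fun h0 => ?_, ?_⟩
  · have hmon : ((X ^ 2 - 1 : ℝ[X]) ^ m).Monic := by
      have := monic_X_pow_sub_C (1:ℝ) two_ne_zero
      rw [C_1] at this
      exact this.pow m
    have hdeg : ((X ^ 2 - 1 : ℝ[X]) ^ m).natDegree = m - k + (m + k) := by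
      have := natDegree_X_pow_sub_C (n := 2) (r := (1:ℝ))
      rw [C_1] at this
      rw [natDegree_pow, this]
      omega
    have h1 := congrArg (fun P => coeff P (m - k)) h0
    simp only [coeff_iterate_derivative, ← hdeg, coeff_zero, coeff_natDegree, hmon.leadingCoeff,
      nsmul_eq_mul, mul_one, Nat.cast_eq_zero, Nat.descFactorial_eq_zero_iff_lt] at h1
    omega
  · have := iterate_derivative_sq_sub_one_pow m (m + k)
    rw [gegenbauerOp, ← Function.iterate_succ_apply' derivative,
      ← Function.iterate_succ_apply' derivative]
    simp only [C_mul, C_add, C_sub, map_natCast, map_ofNat, map_one,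
      Nat.cast_add, Nat.succ_eq_add_one] at this ⊢
    linear_combination this

/-- The radius of the latitude circle at height `x` on the round sphere. -/
noncomputable def latRadius (x : ℝ) : ℝ := √(1 - x ^ 2)

theorem latRadius_sq {x : ℝ} (hx : x ∈ Icc (-1:ℝ) 1) : latRadius x ^ 2 = 1 - x ^ 2 :=
  Real.sq_sqrt (by nlinarith [hx.1, hx.2])

theorem latRadius_pos {x : ℝ} (hx : x ∈ Ioo (-1:ℝ) 1) : 0 < latRadius x :=
  Real.sqrt_pos.2 (by nlinarith [hx.1, hx.2])

theorem continuous_latRadius : Continuous latRadius := by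
  unfold latRadius
  fun_prop

theorem latRadius_neg_one : latRadius (-1) = 0 := by simp [latRadius]

theorem latRadius_one : latRadius 1 = 0 := by simp [latRadius]

theorem hasDerivAt_latRadius_pow (k : ℕ) {x : ℝ} (hx : x ∈ Ioo (-1:ℝ) 1) :
    HasDerivAt (fun x => latRadius x ^ k) (-(k * x / (1 - x ^ 2)) * latRadius x ^ k) x := by
  have hs := latRadius_pos hx
  have h1 : HasDerivAt latRadius (-(x / latRadius x)) x := by
    have := ((hasDerivAt_pow 2 x).const_sub 1).sqrt (by nlinarith [hx.1, hx.2])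
    refine this.congr_deriv ?_
    rw [← latRadius]
    field_simp
    norm_num
  refine (h1.pow k).congr_deriv ?_
  rw [← latRadius_sq (Ioo_subset_Icc_self hx)]
  rcases k with _ | k
  · simp
  · rw [Nat.add_sub_cancel]
    field_simp
    ring

open Polynomial in
theorem IsProfile.isSolution_round {f : ℝ → ℝ} (hf : IsProfile f)
    (hr : ∀ x ∈ Icc (-1:ℝ) 1, f x = 1 - x ^ 2) (k : ℕ) (Q : ℝ[X]) :
    IsSolution f k (fun x => latRadius x ^ k * (gegenbauerOp k Q).eval x)
      (fun x => latRadius x ^ k * Q.eval x)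
      (fun x => latRadius x ^ k * ((1 - x ^ 2) * (derivative Q).eval x - k * x * Q.eval x)) := by
  intro x hx
  have hfx := hr x (Ioo_subset_Icc_self hx)
  have h0 : 1 - x ^ 2 ≠ 0 := hfx ▸ hf.ne_zero hx
  have hR := hasDerivAt_latRadius_pow k hx
  rw [hfx]
  refine ⟨(hR.mul (Q.hasDerivAt x)).congr_deriv ?_, ?_⟩
  · field_simp
    ring
  · refine (hR.mul (((hasDerivAt_pow 2 x).const_sub 1).mul ((derivative Q).hasDerivAt x) |>.sub
      (((hasDerivAt_id x).const_mul (k:ℝ)).mul (Q.hasDerivAt x)))).congr_deriv ?_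
    simp only [gegenbauerOp, eval_add, eval_mul, eval_sub, eval_pow, eval_X, eval_one, eval_C, id,
      Pi.mul_apply, Pi.sub_apply]
    field_simp
    push_cast
    ring

theorem IsProfile.inSpec_round {f : ℝ → ℝ} (hf : IsProfile f)
    (hr : ∀ x ∈ Icc (-1:ℝ) 1, f x = 1 - x ^ 2) {k m : ℕ} (h : k ≤ m) :
    InSpec f k (m * (m + 1)) := by
  obtain ⟨Q, hQ, hop⟩ := exists_gegenbauerOp_eq h
  have hs := hf.isSolution_round hr k Q
  simp only [hop, Polynomial.eval_mul, Polynomial.eval_C, mul_left_comm (_ ^ k)] at hs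
  refine hs.inSpec hf ((continuous_latRadius.pow k).mul Q.continuous).continuousOn ?_ fun hk => ?_
  · by_contra! h0
    refine hQ (Polynomial.eq_zero_of_infinite_isRoot Q ((Ioo_infinite (by norm_num)).mono
      (s := Ioo (-1:ℝ) 1) fun x hx => ?_))
    exact (mul_eq_zero.1 (h0 x hx)).resolve_left (pow_ne_zero k (latRadius_pos hx).ne')
  · simp [latRadius_neg_one, latRadius_one, show k ≠ 0 by omega]

theorem IsProfile.comp_neg {f : ℝ → ℝ} (hf : IsProfile f) : IsProfile fun x => f (-x) where
  contOn := hf.contOn.comp continuous_neg.continuousOn fun x hx =>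
    ⟨by linarith [hx.2], by linarith [hx.1]⟩
  smoothOn := hf.smoothOn.comp contDiff_neg.contDiffOn fun x hx =>
    ⟨by linarith [hx.2], by linarith [hx.1]⟩
  pos x hx := hf.pos _ ⟨by linarith [hx.2], by linarith [hx.1]⟩
  zero_neg_one := by simpa using hf.zero_one
  zero_one := hf.zero_neg_one
  deriv_neg_one := by
    have h : HasDerivAt f (-2) (-(-1)) := by simpa using hf.deriv_one
    exact (h.scomp (-1:ℝ) (hasDerivAt_neg (-1))).congr_deriv (by simp)
  deriv_one := by
    exact (hf.deriv_neg_one.scomp (1:ℝ) (hasDerivAt_neg 1)).congr_deriv (by simp)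

theorem IsProfile.flux_limit_nonpos {f : ℝ → ℝ} (hf : IsProfile f) {u p : ℝ → ℝ} {a c : ℝ}
    (hd : ∀ x ∈ Ioo (-1:ℝ) 1, HasDerivAt u (p x / f x) x)
    (hu : Tendsto u (nhdsWithin 1 (Ioo (-1) 1)) (nhds a))
    (hp : Tendsto p (nhdsWithin 1 (Ioo (-1) 1)) (nhds c)) : c ≤ 0 := by
  by_contra! hc
  have hev : ∀ᶠ x in nhdsWithin (1:ℝ) (Ioo (-1) 1), c / 2 < p x :=
    hp.eventually (lt_mem_nhds (by linarith))
  rw [nhdsWithin_Ioo_eq_nhdsLT (by norm_num)] at hev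
  obtain ⟨l, hl1, hl⟩ := (mem_nhdsLT_iff_exists_Ioo_subset' (show (0:ℝ) < 1 by norm_num)).1 hev
  set l' := max l 0 with hl'
  have hl'1 : l' < 1 := max_lt hl1 one_pos
  have hmem : ∀ x ∈ Ioo l' 1, x ∈ Ioo (-1:ℝ) 1 ∧ c / 2 < p x := fun x hx =>
    ⟨⟨by linarith [hx.1, le_max_right l 0], hx.2⟩, hl ⟨(le_max_left _ _).trans_lt hx.1, hx.2⟩⟩
  have hgd : ∀ x ∈ Ioo l' 1, HasDerivAt (fun x => u x - c / 2 * Real.log (expCoord f x))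
      ((p x - c / 2) / f x) x := fun x hx => by
    have hx' := (hmem x hx).1
    have hE := expCoord_pos (f := f) hx'
    refine ((hd x hx').sub (((hf.hasDerivAt_expCoord hx').log hE.ne').const_mul _)).congr_deriv ?_
    have := hf.ne_zero hx'
    field_simp
  have hmono : MonotoneOn (fun x => u x - c / 2 * Real.log (expCoord f x)) (Ioo l' 1) := by
    refine monotoneOn_of_deriv_nonneg (convex_Ioo _ _)
      (fun x hx => (hgd x hx).continuousAt.continuousWithinAt) ?_ ?_
    · rw [interior_Ioo]
      exact fun x hx => (hgd x hx).differentiableAt.differentiableWithinAt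
    · rw [interior_Ioo]
      intro x hx
      rw [(hgd x hx).deriv]
      exact div_nonneg (by linarith [(hmem x hx).2]) (hf.pos x (hmem x hx).1).le
  obtain ⟨y, hy⟩ := nonempty_Ioo.2 hl'1
  have hE : Tendsto (expCoord f) (nhdsWithin 1 (Ioo (-1) 1)) atTop := by
    have h1 := hf.tendsto_inv_expCoord_one.mono_left nhdsLT_one_le
    have h2 : Tendsto (fun x => (expCoord f x)⁻¹) (nhdsWithin 1 (Ioo (-1) 1))
        (nhdsWithin 0 (Ioi 0)) := tendsto_nhdsWithin_iff.2 ⟨h1, by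
      filter_upwards [self_mem_nhdsWithin] with x hx using inv_pos.2 (expCoord_pos hx)⟩
    exact h2.inv_tendsto_nhdsGT_zero.congr fun x => inv_inv _
  have hlog := ((Real.tendsto_log_atTop.comp hE).const_mul_atTop (show 0 < c / 2 by linarith))
  have hlog' := tendsto_atTop_add_const_right _ (u y - c / 2 * Real.log (expCoord f y)) hlog
  refine not_tendsto_nhds_of_tendsto_atTop (tendsto_atTop_mono' _ ?_ hlog') a hu
  rw [nhdsWithin_Ioo_eq_nhdsLT (by norm_num)]
  filter_upwards [Ioo_mem_nhdsLT hy.2] with x hx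
  have := hmono hy ⟨hy.1.trans hx.1, hx.2⟩ hx.1.le
  simp only [Function.comp] at this ⊢
  linarith

theorem IsProfile.flux_limit_one {f : ℝ → ℝ} (hf : IsProfile f) {u p : ℝ → ℝ} {a c : ℝ}
    (hd : ∀ x ∈ Ioo (-1:ℝ) 1, HasDerivAt u (p x / f x) x)
    (hu : Tendsto u (nhdsWithin 1 (Ioo (-1) 1)) (nhds a))
    (hp : Tendsto p (nhdsWithin 1 (Ioo (-1) 1)) (nhds c)) : c = 0 := by
  have h1 := hf.flux_limit_nonpos hd hu hp
  have h2 := hf.flux_limit_nonpos (u := fun x => -u x) (p := fun x => -p x)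
    (fun x hx => (hd x hx).neg.congr_deriv (by ring)) hu.neg hp.neg
  linarith

theorem IsProfile.flux_limit_neg_one {f : ℝ → ℝ} (hf : IsProfile f) {u p : ℝ → ℝ} {a c : ℝ}
    (hd : ∀ x ∈ Ioo (-1:ℝ) 1, HasDerivAt u (p x / f x) x)
    (hu : Tendsto u (nhdsWithin (-1) (Ioo (-1) 1)) (nhds a))
    (hp : Tendsto p (nhdsWithin (-1) (Ioo (-1) 1)) (nhds c)) : c = 0 := by
  have hneg : Tendsto (fun x : ℝ => -x) (nhdsWithin 1 (Ioo (-1) 1))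
      (nhdsWithin (-1) (Ioo (-1) 1)) := by
    refine tendsto_nhdsWithin_iff.2 ⟨(continuous_neg.tendsto 1).mono_left nhdsWithin_le_nhds, ?_⟩
    filter_upwards [self_mem_nhdsWithin] with x hx
    exact ⟨by linarith [hx.2], by linarith [hx.1]⟩
  have := hf.comp_neg.flux_limit_one (u := fun x => u (-x)) (p := fun x => -p (-x))
    (fun x hx => by
      have := (hd (-x) ⟨by linarith [hx.2], by linarith [hx.1]⟩).scomp x (hasDerivAt_neg x)
      refine this.congr_deriv ?_
      rw [smul_eq_mul]
      ring)
    (hu.comp hneg) (hp.comp hneg).neg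
  linarith

/-- An eigenfunction of the zonal operator has vanishing flux at the poles. -/
theorem IsSolution.tendsto_flux_zero {f : ℝ → ℝ} (hf : IsProfile f) {lam : ℝ} {u p : ℝ → ℝ}
    (hu : ContinuousOn u (Icc (-1) 1)) (h : IsSolution f 0 (fun x => lam * u x) u p) :
    Tendsto p (nhdsWithin (-1) (Ioo (-1) 1)) (nhds 0) ∧
      Tendsto p (nhdsWithin 1 (Ioo (-1) 1)) (nhds 0) := by
  have hi : Integrable (fun x => lam * u x) intervalMeasure :=
    hu.integrable_intervalMeasure.const_mul lam
  have hc : ContinuousOn (fun x => lam * u x) (Ioo (-1) 1) :=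
    (continuousOn_const.mul hu).mono Ioo_subset_Icc_self
  set P : ℝ → ℝ := fun x => p 0 + (∫ t in (-1:ℝ)..0, lam * u t) - ∫ t in (-1:ℝ)..x, lam * u t
  have hPc : ContinuousOn P (Icc (-1) 1) := continuousOn_const.sub (continuousOn_primitive_Icc hi)
  have hpP : ∀ x ∈ Ioo (-1:ℝ) 1, p x = P x := fun x hx => by
    have := eq_of_hasDerivAt_zero_Ioo (F := fun x => p x + ∫ t in (-1:ℝ)..x, lam * u t)
      (fun y hy => ((h y hy).2.add (hasDerivAt_primitive_Ioo hi hc hy)).congr_deriv (by simp))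
      hx (y := 0) (by norm_num)
    simp only [P]
    linarith
  have hm : Tendsto p (nhdsWithin (-1) (Ioo (-1) 1)) (nhds (P (-1))) :=
    ((hPc (-1) (by norm_num)).mono_left nhdsGT_neg_one_le).congr' (by
      filter_upwards [self_mem_nhdsWithin] with x hx using (hpP x hx).symm)
  have hp : Tendsto p (nhdsWithin 1 (Ioo (-1) 1)) (nhds (P 1)) :=
    ((hPc 1 (by norm_num)).mono_left nhdsLT_one_le).congr' (by
      filter_upwards [self_mem_nhdsWithin] with x hx using (hpP x hx).symm)
  have hm0 := hf.flux_limit_neg_one (fun x hx => (h x hx).1)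
    ((hu (-1) (by norm_num)).mono_left nhdsGT_neg_one_le) hm
  have hp0 := hf.flux_limit_one (fun x hx => (h x hx).1)
    ((hu 1 (by norm_num)).mono_left nhdsLT_one_le) hp
  exact ⟨hm0 ▸ hm, hp0 ▸ hp⟩

/-- A function continuous on `[-1,1]` and orthogonal to all polynomials vanishes. -/
theorem eq_zero_of_integral_mul_polynomial {v : ℝ → ℝ} (hv : ContinuousOn v (Icc (-1) 1))
    (h : ∀ Q : Polynomial ℝ, ∫ x, v x * Q.eval x ∂intervalMeasure = 0) :
    ∀ x ∈ Ioo (-1:ℝ) 1, v x = 0 := by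
  by_contra! hne
  have hpos := hv.integral_sq_pos hne
  have hle : ∀ ε, 0 < ε → ∫ x, v x ^ 2 ∂intervalMeasure ≤ (∫ x, |v x| ∂intervalMeasure) * ε := by
    intro ε hε
    obtain ⟨Q, hQ⟩ := exists_polynomial_near_of_continuousOn (-1) 1 v hv ε hε
    have hi2 : Integrable (fun x => v x ^ 2) intervalMeasure := (hv.pow 2).integrable_intervalMeasure
    have hiQ : Integrable (fun x => v x * Q.eval x) intervalMeasure :=
      (hv.mul Q.continuous.continuousOn).integrable_intervalMeasure
    have hia := hv.integrable_intervalMeasure.abs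
    calc ∫ x, v x ^ 2 ∂intervalMeasure
        = ∫ x, (v x ^ 2 - v x * Q.eval x) ∂intervalMeasure := by
          rw [MeasureTheory.integral_sub hi2 hiQ, h Q, sub_zero]
      _ ≤ ∫ x, |v x| * ε ∂intervalMeasure := by
          refine integral_mono_ae (hi2.sub hiQ) (hia.mul_const ε) ?_
          filter_upwards [ae_intervalMeasure_mem] with x hx
          have h1 := (hQ x (Ioo_subset_Icc_self hx)).le
          calc v x ^ 2 - v x * Q.eval x ≤ |v x * (Q.eval x - v x)| := by
                rw [← abs_neg]
                exact (le_of_eq (by ring)).trans (le_abs_self _)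
            _ ≤ |v x| * ε := by
                rw [abs_mul]
                exact mul_le_mul_of_nonneg_left h1 (abs_nonneg _)
      _ = _ := MeasureTheory.integral_mul_const _ _
  have hlim : Tendsto (fun ε : ℝ => (∫ x, |v x| ∂intervalMeasure) * ε) (nhdsWithin 0 (Ioi 0))
      (nhds ((∫ x, |v x| ∂intervalMeasure) * 0)) :=
    (tendsto_id.mono_left nhdsWithin_le_nhds).const_mul _
  have := ge_of_tendsto hlim (by filter_upwards [self_mem_nhdsWithin] with ε hε using hle ε hε)
  linarith

/-- Green's identity between an eigenfunction and `(1 - x²)^(k/2) Q` on the round sphere. -/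
theorem IsProfile.integral_mul_gegenbauerOp {f : ℝ → ℝ} (hf : IsProfile f)
    (hr : ∀ x ∈ Icc (-1:ℝ) 1, f x = 1 - x ^ 2) {k : ℕ} {lam : ℝ} {u p : ℝ → ℝ}
    (hu : ContinuousOn u (Icc (-1) 1)) (hb : 1 ≤ k → u (-1) = 0 ∧ u 1 = 0)
    (h : IsSolution f k (fun x => lam * u x) u p) (Q : Polynomial ℝ) :
    ∫ x, u x * latRadius x ^ k * (gegenbauerOp k Q).eval x ∂intervalMeasure =
      lam * ∫ x, u x * latRadius x ^ k * Q.eval x ∂intervalMeasure := by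
  set y : ℝ → ℝ := fun x => latRadius x ^ k * Q.eval x with hy
  set r : ℝ → ℝ := fun x => latRadius x ^ k *
    ((1 - x ^ 2) * (Polynomial.derivative Q).eval x - k * x * Q.eval x) with hrdef
  have hs := hf.isSolution_round hr k Q
  have hRc := continuous_latRadius.pow k
  have hyc : Continuous y := hRc.mul Q.continuous
  have hrc : Continuous r := hRc.mul (by fun_prop)
  have hint : ∀ P : Polynomial ℝ,
      Integrable (fun x => u x * latRadius x ^ k * P.eval x) intervalMeasure := fun P =>
    ((hu.mul hRc.continuousOn).mul P.continuous.continuousOn).integrable_intervalMeasure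
  have hd : ∀ x ∈ Ioo (-1:ℝ) 1, HasDerivAt (fun x => p x * y x - u x * r x)
      (u x * latRadius x ^ k * (gegenbauerOp k Q).eval x -
        lam * (u x * latRadius x ^ k * Q.eval x)) x := fun x hx => by
    refine (((h x hx).2.mul (hs x hx).1).sub ((h x hx).1.mul (hs x hx).2)).congr_deriv ?_
    ring
  have hr0 : r (-1) = 0 ∧ r 1 = 0 := by
    rcases Nat.eq_zero_or_pos k with rfl | hk
    · simp [hrdef]
    · simp [hrdef, latRadius_neg_one, latRadius_one, hk.ne']
  have hpy : Tendsto (fun x => p x * y x) (nhdsWithin (-1) (Ioo (-1) 1)) (nhds 0) ∧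
      Tendsto (fun x => p x * y x) (nhdsWithin 1 (Ioo (-1) 1)) (nhds 0) := by
    have hyl : ∀ a, Tendsto y (nhdsWithin a (Ioo (-1) 1)) (nhds (y a)) := fun a =>
      (hyc.tendsto a).mono_left nhdsWithin_le_nhds
    rcases Nat.eq_zero_or_pos k with rfl | hk
    · have := h.tendsto_flux_zero hf hu
      exact ⟨by simpa only [zero_mul] using this.1.mul (hyl _),
        by simpa only [zero_mul] using this.2.mul (hyl _)⟩
    · obtain ⟨C, hC⟩ := IsEigenfunction.flux_bounded hf hk ⟨hu, (hb hk).1, (hb hk).2, h⟩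
      have key : ∀ a, y a = 0 →
          Tendsto (fun x => p x * y x) (nhdsWithin a (Ioo (-1) 1)) (nhds 0) := fun a ha => by
        refine bdd_le_mul_tendsto_zero' C ?_ (ha ▸ hyl a)
        filter_upwards [self_mem_nhdsWithin] with x hx using hC x hx
      exact ⟨key _ (by simp [hy, latRadius_neg_one, hk.ne']),
        key _ (by simp [hy, latRadius_one, hk.ne'])⟩
  have hm : Tendsto (fun x => p x * y x - u x * r x) (nhdsWithin (-1) (Ioo (-1) 1)) (nhds 0) := by
    have h1 : Tendsto u (nhdsWithin (-1) (Ioo (-1) 1)) (nhds (u (-1))) :=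
      (hu (-1) (by norm_num)).mono_left nhdsGT_neg_one_le
    have h2 := hpy.1.sub (h1.mul ((hrc.tendsto (-1)).mono_left nhdsWithin_le_nhds))
    rwa [hr0.1, mul_zero, sub_zero] at h2
  have hp : Tendsto (fun x => p x * y x - u x * r x) (nhdsWithin 1 (Ioo (-1) 1)) (nhds 0) := by
    have h1 : Tendsto u (nhdsWithin 1 (Ioo (-1) 1)) (nhds (u 1)) :=
      (hu 1 (by norm_num)).mono_left nhdsLT_one_le
    have h2 := hpy.2.sub (h1.mul ((hrc.tendsto 1).mono_left nhdsWithin_le_nhds))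
    rwa [hr0.2, mul_zero, sub_zero] at h2
  have hfin := integral_of_hasDerivAt_of_tendsto ((hint _).sub ((hint Q).const_mul lam)) hd hm hp
  simp only [Pi.sub_apply] at hfin
  rw [MeasureTheory.integral_sub (hint _) ((hint Q).const_mul lam),
    MeasureTheory.integral_const_mul, sub_self] at hfin
  linarith

open Polynomial in
theorem gegenbauerOp_X_pow (k n : ℕ) :
    gegenbauerOp k (X ^ n) =
      C ((n + k) * (n + k + 1) : ℝ) * X ^ n - C (n * (n - 1) : ℝ) * X ^ (n - 2) := by
  rcases n with _ | _ | n
  · simp [gegenbauerOp]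
  · simp only [gegenbauerOp, zero_add, pow_one, derivative_X, derivative_one, Nat.cast_one, sub_self,
      mul_zero, C_0, zero_mul, sub_zero, mul_one, C_mul, C_add, map_natCast, map_ofNat, map_one]
    ring
  · have h2 : n + 1 + 1 - 2 = n := by omega
    simp only [gegenbauerOp, derivative_X_pow, derivative_mul, C_mul, C_add, C_sub, map_natCast,
      map_ofNat, map_one, Nat.cast_add, Nat.cast_one, Nat.add_sub_cancel, derivative_add,
      derivative_natCast, derivative_one, h2]
    ring

/-- The spectrum of `L_k` on the round sphere. -/
theorem IsProfile.mem_spec_round {f : ℝ → ℝ} (hf : IsProfile f)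
    (hr : ∀ x ∈ Icc (-1:ℝ) 1, f x = 1 - x ^ 2) {k : ℕ} {lam : ℝ} :
    lam ∈ Spec f k ↔ ∃ m : ℕ, k ≤ m ∧ lam = m * (m + 1) := by
  refine ⟨fun ⟨u, hc, hs, ⟨x₀, hx₀, hne⟩, hb, hode⟩ => ?_,
    fun ⟨m, hm, e⟩ => e ▸ hf.inSpec_round hr hm⟩
  by_contra! hlam
  have hpair := hf.integral_mul_gegenbauerOp hr hc hb (hf.isSolution_of_eigen hs hode)
  have hcR : ContinuousOn (fun x => u x * latRadius x ^ k) (Icc (-1) 1) :=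
    hc.mul (continuous_latRadius.pow k).continuousOn
  have hint : ∀ P : Polynomial ℝ,
      Integrable (fun x => u x * latRadius x ^ k * P.eval x) intervalMeasure := fun P =>
    (hcR.mul P.continuous.continuousOn).integrable_intervalMeasure
  have hmom : ∀ n : ℕ, ∫ x, u x * latRadius x ^ k * x ^ n ∂intervalMeasure = 0 := by
    intro n
    induction n using Nat.strong_induction_on with
    | _ n ih =>
      have hX : ∀ j : ℕ, Integrable (fun x => u x * latRadius x ^ k * x ^ j) intervalMeasure :=
        fun j => by simpa using hint (Polynomial.X ^ j)
      have h1 := hpair (Polynomial.X ^ n)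
      have h2 : ((n:ℝ) * (n - 1)) *
          ∫ x, u x * latRadius x ^ k * x ^ (n - 2) ∂intervalMeasure = 0 := by
        rcases n with _ | _ | n
        · simp
        · simp
        · rw [ih _ (by omega), mul_zero]
      have h3 : ∫ x, u x * latRadius x ^ k *
            (gegenbauerOp k (Polynomial.X ^ n)).eval x ∂intervalMeasure =
          ((n + k) * (n + k + 1)) * ∫ x, u x * latRadius x ^ k * x ^ n ∂intervalMeasure -
          (n * (n - 1)) * ∫ x, u x * latRadius x ^ k * x ^ (n - 2) ∂intervalMeasure := by
        rw [← MeasureTheory.integral_const_mul, ← MeasureTheory.integral_const_mul,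
          ← MeasureTheory.integral_sub ((hX n).const_mul _) ((hX (n - 2)).const_mul _)]
        refine integral_congr_ae (Eventually.of_forall fun x => ?_)
        simp only [gegenbauerOp_X_pow, Polynomial.eval_sub, Polynomial.eval_mul,
          Polynomial.eval_C, Polynomial.eval_pow, Polynomial.eval_X]
        ring
      rw [h3] at h1
      simp only [Polynomial.eval_pow, Polynomial.eval_X] at h1
      have h4 : ((n + k) * (n + k + 1) - lam) *
          ∫ x, u x * latRadius x ^ k * x ^ n ∂intervalMeasure = 0 := by linarith
      refine (mul_eq_zero.1 h4).resolve_left (sub_ne_zero.2 fun e => ?_)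
      exact hlam (n + k) (Nat.le_add_left k n) (by rw [← e]; push_cast; ring)
  have hall : ∀ Q : Polynomial ℝ,
      ∫ x, u x * latRadius x ^ k * Q.eval x ∂intervalMeasure = 0 := fun Q => by
    induction Q using Polynomial.induction_on' with
    | add P Q hP hQ =>
      simp only [Polynomial.eval_add, mul_add]
      rw [MeasureTheory.integral_add (hint P) (hint Q), hP, hQ, add_zero]
    | monomial n a =>
      simp only [Polynomial.eval_monomial, mul_left_comm _ a]
      rw [MeasureTheory.integral_const_mul, hmom, mul_zero]
  have := eq_zero_of_integral_mul_polynomial hcR hall x₀ hx₀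
  exact (mul_ne_zero hne (pow_ne_zero k (latRadius_pos hx₀).ne')) this

theorem strictMono_mul_add_one : StrictMono fun m : ℕ => (m:ℝ) * (m + 1) :=
  strictMono_nat_of_lt_succ fun m => by push_cast; nlinarith [(Nat.cast_nonneg m : (0:ℝ) ≤ m)]

theorem IsProfile.multiplicity_round {f : ℝ → ℝ} (hf : IsProfile f)
    (hr : ∀ x ∈ Icc (-1:ℝ) 1, f x = 1 - x ^ 2) {Λ : ℕ → ℝ} (hmono : StrictMono Λ)
    (hrange : range Λ = Eigs f) (m : ℕ) :
    2 * ({k : ℕ | 1 ≤ k ∧ Λ m ∈ Spec f k}).ncard + (if Λ m ∈ Spec f 0 then 1 else 0) =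
      2 * m + 1 := by
  have hE : Eigs f = range fun m : ℕ => (m:ℝ) * (m + 1) := by
    ext lam
    simp only [Eigs, mem_iUnion, hf.mem_spec_round hr, mem_range]
    exact ⟨fun ⟨_, m, _, e⟩ => ⟨m, e.symm⟩, fun ⟨m, e⟩ => ⟨0, m, m.zero_le, e.symm⟩⟩
  have hΛ := (hmono.range_inj strictMono_mul_add_one).1 (hrange.trans hE)
  have hmem : ∀ k, Λ m ∈ Spec f k ↔ k ≤ m := fun k => by
    rw [hf.mem_spec_round hr, hΛ]
    refine ⟨fun ⟨j, hj, e⟩ => ?_, fun h => ⟨m, h, rfl⟩⟩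
    rwa [strictMono_mul_add_one.injective e]
  have hset : {k : ℕ | 1 ≤ k ∧ Λ m ∈ Spec f k} = Icc 1 m := by
    ext k
    simp [hmem]
  rw [hset, if_pos ((hmem 0).2 m.zero_le), Set.ncard_eq_toFinset_card']
  simp

theorem IsProfile.round_of_multiplicity {f : ℝ → ℝ} (hf : IsProfile f) {Λ : ℕ → ℝ}
    (hmono : StrictMono Λ) (hrange : range Λ = Eigs f)
    (h : ∀ m : ℕ, 2 * ({k : ℕ | 1 ≤ k ∧ Λ m ∈ Spec f k}).ncard
          + (if Λ m ∈ Spec f 0 then 1 else 0) = 2 * m + 1) :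
    ∀ x ∈ Icc (-1:ℝ) 1, f x = 1 - x ^ 2 := by
  have h1 := hf.enum_one_of_multiplicity hmono hrange h
  have h0 : InSpec f 0 0 :=
    ⟨fun _ => 1, continuousOn_const, contDiffOn_const, ⟨0, by norm_num, one_ne_zero⟩,
      fun h => absurd h (by norm_num), fun x _ => by simp⟩
  obtain ⟨j₀, hj₀⟩ : (0:ℝ) ∈ range Λ := hrange ▸ mem_iUnion.2 ⟨0, h0⟩
  refine hf.eq_round_of_gap (fun lam hpos hlam => ?_) fun lam hlam => ?_
  · obtain ⟨m, rfl⟩ : lam ∈ range Λ := hrange ▸ mem_iUnion.2 ⟨0, hlam⟩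
    rw [← hj₀] at hpos
    rw [← h1]
    exact hmono.monotone (Nat.one_le_of_lt (hmono.lt_iff_lt.1 hpos))
  · obtain ⟨m, rfl⟩ : lam ∈ range Λ := hrange ▸ mem_iUnion.2 ⟨1, hlam⟩
    rw [← h1]
    exact hmono.monotone ((hf.mem_spec_iff_of_multiplicity hmono hrange h le_rfl m).1 hlam)

/-- Rigidity: the multiplicity of the `m`-th distinct eigenvalue equals `2m+1` for
every `m` if and only if `f(x) = 1 - x²`, i.e. the surface is the round sphere. -/
theorem multiplicity_eq_iff_round (f : ℝ → ℝ) (hf : IsProfile f)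
    (Λ : ℕ → ℝ) (hΛmono : StrictMono Λ) (hΛrange : Set.range Λ = Eigs f) :
    (∀ m : ℕ,
        2 * ({k : ℕ | 1 ≤ k ∧ Λ m ∈ Spec f k}).ncard
          + (if Λ m ∈ Spec f 0 then 1 else 0) = 2 * m + 1)
      ↔ (∀ x ∈ Icc (-1:ℝ) 1, f x = 1 - x^2) :=
  ⟨hf.round_of_multiplicity hΛmono hΛrange, fun hr => hf.multiplicity_round hr hΛmono hΛrange⟩
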